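/- Fix an integer n ≥ 3 and a nonzero integer h. For X > 0, let N*_h(n,X) denote the number of integral binary forms F of degree n whose coefficients are each less than X in absolute value such that F is maximal, F locally represents h everywhere, and F(x,y) = h has no solution (x,y) ∈ ℤ²; let N*(n,X) denote the total number of integral binary forms of degree n whose coefficients are each less than X in absolute value. Then liminf_{X→∞} N*_h(n,X)/N*(n,X) > 0. -/

import Mathlib

open Finset

/-- Evaluation of the binary form of degree `n` with coefficient vector `c` at `(x, y)`:
`c 0 * x^n + c 1 * x^(n-1) * y + ⋯ + c n * y^n`. -/
def binEval {n : ℕ} {R : Type*} [CommRing R] (c : Fin (n + 1) → R) (x y : R) : R :=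
  ∑ i : Fin (n + 1), c i * x ^ (n - (i : ℕ)) * y ^ (i : ℕ)

/-- The binary form with coefficient vector `c` as an element of `MvPolynomial (Fin 2) R`. -/
noncomputable def formPolyR {n : ℕ} {R : Type*} [CommRing R] (c : Fin (n + 1) → R) :
    MvPolynomial (Fin 2) R :=
  ∑ i : Fin (n + 1), MvPolynomial.C (c i) * MvPolynomial.X 0 ^ (n - (i : ℕ)) *
    MvPolynomial.X 1 ^ (i : ℕ)

/-- The binary form with integer coefficient vector `c`, base-changed to `R`. -/
noncomputable def formPoly {n : ℕ} (R : Type*) [CommRing R] (c : Fin (n + 1) → ℤ) :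
    MvPolynomial (Fin 2) R :=
  formPolyR (fun i => ((c i : R)))

/-- `F(X, 1)` over `R`, for the binary form with integer coefficient vector `c`. -/
noncomputable def formPolyX {n : ℕ} (R : Type*) [CommRing R] (c : Fin (n + 1) → ℤ) :
    Polynomial R :=
  ∑ i : Fin (n + 1), Polynomial.C ((c i : R)) * Polynomial.X ^ (n - (i : ℕ))

/-- `IsDisc c D`: the binary form with coefficient vector `c` factors over `ℂ` as
`∏ (αᵢ x - βᵢ y)` and `D = ∏_{i<j} (αᵢ βⱼ - αⱼ βᵢ)²` is its discriminant. -/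
def IsDisc {n : ℕ} (c : Fin (n + 1) → ℤ) (D : ℤ) : Prop :=
  ∃ α β : Fin n → ℂ,
    (∀ x y : ℂ, binEval (fun i => ((c i : ℂ))) x y = ∏ i : Fin n, (α i * x - β i * y)) ∧
    (D : ℂ) = ∏ i : Fin n, ∏ j ∈ Finset.univ.filter (fun j => i < j),
      (α i * β j - α j * β i) ^ 2

/-- `G` is a maximal form: it is not a proper subform of any integral binary form. -/
def IsMaximalForm {n : ℕ} (G : Fin (n + 1) → ℤ) : Prop :=
  ¬ ∃ (F : Fin (n + 1) → ℤ) (a b c d : ℤ), 1 < |a * d - b * c| ∧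
      ∀ x y : ℤ, binEval G x y = binEval F (a * x + b * y) (c * x + d * y)

/-- `GL₂(ℤ)`-equivalence of integral binary forms. -/
def FormEquiv {n : ℕ} (F G : Fin (n + 1) → ℤ) : Prop :=
  ∃ a b c d : ℤ, |a * d - b * c| = 1 ∧
    ∀ x y : ℤ, binEval G x y = binEval F (a * x + b * y) (c * x + d * y)

/-- The form locally represents `h` everywhere: over `ℝ` and over `ℤ_p` for all primes `p`. -/
def LocallyRep {n : ℕ} (c : Fin (n + 1) → ℤ) (h : ℤ) : Prop :=
  (∃ x y : ℝ, binEval (fun i => ((c i : ℝ))) x y = (h : ℝ)) ∧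
  ∀ (p : ℕ) (hp : p.Prime),
    haveI : Fact p.Prime := ⟨hp⟩
    ∃ x y : ℤ_[p], binEval (fun i => ((c i : ℤ_[p]))) x y = (h : ℤ_[p])

/-- The integral binary form is primitive: the gcd of its coefficients is 1. -/
def IsPrimitiveForm {n : ℕ} (c : Fin (n + 1) → ℤ) : Prop :=
  ∀ d : ℤ, (∀ i, d ∣ c i) → IsUnit d

/-- The form splits completely modulo `p`: modulo `p` it is a product of pairwise
non-proportional linear forms over `ℤ/pℤ`. -/
def SplitsCompletelyMod (p : ℕ) {n : ℕ} (c : Fin (n + 1) → ℤ) : Prop :=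
  ∃ L : Fin n → ZMod p × ZMod p,
    (∀ i j, i ≠ j → (L i).1 * (L j).2 ≠ (L j).1 * (L i).2) ∧
    formPoly (ZMod p) c =
      ∏ i : Fin n, (MvPolynomial.C (L i).1 * MvPolynomial.X 0 +
        MvPolynomial.C (L i).2 * MvPolynomial.X 1)

/-! ### Stepanov's method for superelliptic curves -/

section Stepanov

open Polynomial

theorem Polynomial.card_mul_le_natDegree {K : Type*} [Field K] {R : K[X]}
    (S : Finset K) (M : ℕ) (hS : ∀ t ∈ S, M ≤ R.rootMultiplicity t) :
    S.card * M ≤ R.natDegree := by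
  classical
  rcases Nat.eq_zero_or_pos M with rfl | hM
  · simp
  have hsub : S ⊆ R.roots.toFinset := by
    intro t ht
    rw [Multiset.mem_toFinset, ← Multiset.count_pos, count_roots]
    exact hM.trans_le (hS t ht)
  calc S.card * M = ∑ t ∈ S, M := by simp
    _ ≤ ∑ t ∈ S, R.roots.count t := Finset.sum_le_sum fun t ht => by
        rw [count_roots]; exact hS t ht
    _ ≤ ∑ t ∈ R.roots.toFinset, R.roots.count t :=
        Finset.sum_le_sum_of_subset hsub
    _ = R.roots.card := Multiset.toFinset_sum_count_eq _
    _ ≤ R.natDegree := card_roots' R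

variable {L : Type*} [Field L]

/-- The operator `k ↦ E` with `(g ^ a * k)^(ℓ) = g ^ (a - ℓ) * E`. -/
noncomputable def stepanovOp (g : L[X]) (a : ℕ) : ℕ → L[X] →ₗ[L] L[X]
  | 0 => LinearMap.id
  | ℓ + 1 =>
    (((a - ℓ : ℕ) : L) • LinearMap.mulLeft L (derivative g)) ∘ₗ stepanovOp g a ℓ +
      LinearMap.mulLeft L g ∘ₗ derivative ∘ₗ stepanovOp g a ℓ

theorem stepanovOp_succ (g : L[X]) (a ℓ : ℕ) (k : L[X]) :
    stepanovOp g a (ℓ + 1) k = C ((a - ℓ : ℕ) : L) * (derivative g * stepanovOp g a ℓ k) +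
      g * derivative (stepanovOp g a ℓ k) := by
  simp [stepanovOp, smul_eq_C_mul]

theorem natDegree_stepanovOp_le {g : L[X]} {n : ℕ} (hg : g.natDegree ≤ n) (a ℓ : ℕ) (k : L[X]) :
    (stepanovOp g a ℓ k).natDegree ≤ k.natDegree + ℓ * n := by
  induction ℓ with
  | zero => simp [stepanovOp]
  | succ ℓ ih =>
    rw [stepanovOp_succ]
    refine (natDegree_add_le _ _).trans (max_le ?_ ?_)
    · refine (natDegree_C_mul_le _ _).trans (natDegree_mul_le.trans ?_)
      have := natDegree_derivative_le g
      have h2 : (ℓ + 1) * n = ℓ * n + n := by ring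
      omega
    · refine natDegree_mul_le.trans ?_
      have := natDegree_derivative_le (stepanovOp g a ℓ k)
      have h2 : (ℓ + 1) * n = ℓ * n + n := by ring
      omega

theorem iterate_derivative_stepanov {g T : L[X]} (hT : derivative T = 0) (a : ℕ) (k : L[X])
    (ℓ : ℕ) (hℓ : ℓ ≤ a) :
    derivative^[ℓ] (g ^ a * k * T) = g ^ (a - ℓ) * stepanovOp g a ℓ k * T := by
  induction ℓ with
  | zero => simp [stepanovOp]
  | succ ℓ ih =>
    rw [Function.iterate_succ_apply', ih (by omega), stepanovOp_succ]
    obtain ⟨b, hb⟩ : ∃ b, a - ℓ = b + 1 := ⟨a - ℓ - 1, by omega⟩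
    have hb' : a - (ℓ + 1) = b := by omega
    rw [hb, hb']
    simp only [derivative_mul, hT, derivative_pow, Nat.add_sub_cancel]
    ring

/-- The family of monomials used in Stepanov's auxiliary polynomial has no short relation. -/
theorem stepanov_no_relation {u : L[X]} (hu : u.coeff 0 ≠ 0) {p c d S : ℕ}
    (hp : p = d * c + 1) (k : ℕ → L[X]) (hk : ∀ s, (k s).degree < (c : ℕ))
    (hrel : ∑ s ∈ range S, k s * X ^ ((s / d) * p) * (X * u) ^ ((s % d) * c) = 0) :
    ∀ s < S, k s = 0 := by
  intro s
  induction s using Nat.strong_induction_on with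
  | _ s ih =>
    intro hs
    have hexp : ∀ r, (r / d) * p + (r % d) * c = r * c + r / d := by
      intro r
      have := Nat.div_add_mod r d
      calc (r / d) * p + (r % d) * c = (d * (r / d) + r % d) * c + r / d := by rw [hp]; ring
        _ = _ := by rw [this]
    have hterm : ∀ r, k r * X ^ ((r / d) * p) * (X * u) ^ ((r % d) * c) =
        X ^ (r * c + r / d) * (k r * u ^ ((r % d) * c)) := by
      intro r
      rw [← hexp r, mul_pow, pow_add]
      ring
    simp only [hterm] at hrel
    have hdvd : X ^ (s * c + s / d + c) ∣
        X ^ (s * c + s / d) * (k s * u ^ ((s % d) * c)) := by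
      have h1 : X ^ (s * c + s / d) * (k s * u ^ ((s % d) * c)) =
          - ∑ r ∈ (range S).erase s, X ^ (r * c + r / d) * (k r * u ^ ((r % d) * c)) := by
        rw [← Finset.add_sum_erase _ _ (Finset.mem_range.2 hs)] at hrel
        exact eq_neg_of_add_eq_zero_left hrel
      rw [h1]
      refine (Finset.dvd_sum fun r hr => ?_).neg_right
      rw [Finset.mem_erase, Finset.mem_range] at hr
      rcases lt_or_gt_of_ne hr.1 with h | h
      · rw [ih r h hr.2]; simp
      · refine Dvd.dvd.mul_right (pow_dvd_pow _ ?_) _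
        have h2 : s / d ≤ r / d := Nat.div_le_div_right h.le
        have h3 : (s + 1) * c ≤ r * c := Nat.mul_le_mul_right _ h
        have h4 : (s + 1) * c = s * c + c := by ring
        omega
    rw [pow_add _ (s * c + s / d) c] at hdvd
    have hdvd2 : X ^ c ∣ k s * u ^ ((s % d) * c) :=
      (mul_dvd_mul_iff_left (pow_ne_zero _ X_ne_zero)).1 hdvd
    have hcop : IsCoprime (X ^ c : L[X]) (u ^ ((s % d) * c)) := by
      refine IsCoprime.pow ?_
      rw [Polynomial.irreducible_X.coprime_iff_not_dvd, X_dvd_iff]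
      exact hu
    have hdvd3 := hcop.dvd_of_dvd_mul_right hdvd2
    by_contra hne
    have := degree_le_of_dvd hdvd3 hne
    rw [degree_X_pow] at this
    exact absurd (hk s) (not_lt.2 this)

theorem stepanov_bound {p : ℕ} [Fact p.Prime] [CharP L p] {g : L[X]} {n c d M M' J : ℕ} {β ζ : L}
    (hg : g.natDegree ≤ n) (hg0 : g.coeff 0 = 0) (hg1 : g.coeff 1 ≠ 0) (hd : 0 < d)
    (hp : p = d * c + 1) (hM : M = d * M') (hM0 : 0 < M) (hJ : J = M' + 1)
    (hlarge : M * (M * n + J) < d * c) (T : Finset L) (hTp : ∀ t ∈ T, t ^ p = t + β)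
    (hTζ : ∀ t ∈ T, g.eval t ^ c = ζ) :
    T.card * M ≤ M * n + c + M' * p + d * c * n := by
  obtain ⟨u, rfl⟩ := X_dvd_iff.2 hg0
  set g : L[X] := X * u with hgdef
  have hu : u.coeff 0 ≠ 0 := by simpa [hgdef, coeff_X_mul] using hg1
  set S := d * J
  set Dm := c + M * n + J
  let κ : (Fin S → Fin c → L) → ℕ → L[X] := fun v s =>
    if hs : s < S then ∑ i : Fin c, C (v ⟨s, hs⟩ i) * X ^ (i : ℕ) else 0
  have hκdeg : ∀ v s, (κ v s).degree < (c : ℕ) := by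
    intro v s
    simp only [κ]
    split_ifs with hs
    · refine (degree_sum_fin_lt _)
    · rw [degree_zero]; exact WithBot.bot_lt_coe c
  let E : (Fin S → Fin c → L) → ℕ → L[X] := fun v ℓ =>
    ∑ s ∈ range S, C (ζ ^ (s % d)) * (X + C β) ^ (s / d) *
      stepanovOp g (M + (s % d) * c) ℓ (κ v s)
  have hκadd : ∀ v w s, κ (v + w) s = κ v s + κ w s := by
    intro v w s
    simp only [κ]
    split_ifs
    · simp [add_mul, Finset.sum_add_distrib]
    · simp
  have hκsmul : ∀ (a : L) v s, κ (a • v) s = a • κ v s := by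
    intro a v s
    simp only [κ]
    split_ifs
    · simp [Finset.smul_sum, smul_eq_C_mul, mul_assoc]
    · simp
  let Φ : (Fin S → Fin c → L) →ₗ[L] (Fin M → Fin Dm → L) :=
    { toFun := fun v ℓ r => (E v ℓ).coeff r
      map_add' := by
        intro v w
        funext ℓ r
        simp [E, hκadd, mul_add, Finset.sum_add_distrib]
      map_smul' := by
        intro a v
        funext ℓ r
        simp [E, hκsmul, Finset.mul_sum] }
  have hker : LinearMap.ker Φ ≠ ⊥ := by
    apply LinearMap.ker_ne_bot_of_finrank_lt
    simp only [Module.finrank_pi_fintype, Module.finrank_self, Finset.sum_const, Finset.card_univ,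
      Fintype.card_fin, smul_eq_mul, mul_one]
    simp only [S, Dm]
    have h1 : M * (c + M * n + J) = M * c + M * (M * n + J) := by ring
    have h2 : d * J * c = M * c + d * c := by rw [hJ, hM]; ring
    omega
  obtain ⟨v, hv, hv0⟩ := (Submodule.ne_bot_iff _).1 hker
  have hE : ∀ ℓ < M, E v ℓ = 0 := by
    intro ℓ hℓ
    ext r
    rw [coeff_zero]
    by_cases hr : r < Dm
    · exact congrFun (congrFun (LinearMap.mem_ker.1 hv) ⟨ℓ, hℓ⟩) ⟨r, hr⟩
    · refine coeff_eq_zero_of_natDegree_lt (lt_of_lt_of_le ?_ (not_lt.1 hr))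
      have : (E v ℓ).natDegree ≤ c + M * n + (J - 1) := by
        refine natDegree_sum_le_of_forall_le _ _ fun s hs => ?_
        have hsJ : s / d < J := Nat.div_lt_of_lt_mul (Finset.mem_range.1 hs)
        refine natDegree_mul_le.trans ?_
        have e1 : (C (ζ ^ (s % d)) * (X + C β) ^ (s / d)).natDegree ≤ s / d := by
          refine (natDegree_C_mul_le _ _).trans (natDegree_pow_le.trans ?_)
          simp
        have e2 := natDegree_stepanovOp_le hg (M + (s % d) * c) ℓ (κ v s)
        have e3 : (κ v s).natDegree ≤ c := natDegree_le_of_degree_le (hκdeg v s).le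
        have e4 : ℓ * n ≤ M * n := Nat.mul_le_mul_right _ hℓ.le
        omega
      simp only [Dm]
      omega
  set R : L[X] := ∑ s ∈ range S, g ^ (M + (s % d) * c) * κ v s * X ^ ((s / d) * p) with hR
  have hRne : R ≠ 0 := by
    intro hR0
    have hg_ne : g ≠ 0 := by
      intro h
      rw [h] at hg1
      simp at hg1
    have hrel : ∑ s ∈ range S, κ v s * X ^ ((s / d) * p) * (X * u) ^ ((s % d) * c) = 0 := by
      have : g ^ M * ∑ s ∈ range S, κ v s * X ^ ((s / d) * p) * (X * u) ^ ((s % d) * c) = 0 := by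
        rw [← hR0, hR, Finset.mul_sum]
        refine Finset.sum_congr rfl fun s _ => ?_
        rw [pow_add, ← hgdef]
        ring
      exact (mul_eq_zero.1 this).resolve_left (pow_ne_zero _ hg_ne)
    have hz := stepanov_no_relation hu hp (κ v) (hκdeg v) hrel
    apply hv0
    funext s i
    have h1 := hz s s.2
    simp only [κ, s.2, dif_pos] at h1
    have h2 := congrArg (fun q => q.coeff (i : ℕ)) h1
    simp only [finsetSum_coeff, coeff_C_mul, coeff_X_pow, coeff_zero] at h2
    rw [Finset.sum_eq_single i] at h2
    · simpa using h2
    · intro b _ hb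
      have : (i : ℕ) ≠ b := fun h => hb (Fin.ext h.symm)
      simp [this]
    · simp
  have hpc : M * (M * n + J) < p := by omega
  have hMp : M < p := by
    refine lt_of_le_of_lt ?_ hpc
    exact Nat.le_mul_of_pos_right M (by omega)
  have hmult : ∀ t ∈ T, M ≤ R.rootMultiplicity t := by
    intro t ht
    obtain ⟨m, rfl⟩ : ∃ m, M = m + 1 := ⟨M - 1, by omega⟩
    refine lt_rootMultiplicity_of_isRoot_iterate_derivative_of_mem_nonZeroDivisors hRne ?_ ?_
    · intro ℓ hℓ
      have hder : ∀ j, derivative ((X : L[X]) ^ (j * p)) = 0 := by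
        intro j
        simp [derivative_X_pow]
      have h0 := congrArg (eval t) (hE ℓ (by omega))
      simp only [E, eval_finsetSum, eval_zero, eval_mul, eval_C, eval_pow, eval_add, eval_X] at h0
      rw [IsRoot.def, hR, iterate_derivative_sum, eval_finsetSum]
      rw [← mul_zero (g.eval t ^ (m + 1 - ℓ)), ← h0, Finset.mul_sum]
      refine Finset.sum_congr rfl fun s _ => ?_
      rw [iterate_derivative_stepanov (hder _) _ _ _ (by omega)]
      simp only [eval_mul, eval_pow, eval_X]
      have e1 : m + 1 + (s % d) * c - ℓ = (m + 1 - ℓ) + c * (s % d) := by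
        rw [mul_comm c]; omega
      rw [e1, pow_add, pow_mul (eval t g) c, hTζ t ht, mul_comm (s / d) p, pow_mul t p, hTp t ht]
      ring
    · rw [mem_nonZeroDivisors_iff_ne_zero, Ne, CharP.cast_eq_zero_iff L p,
        (Fact.out : p.Prime).dvd_factorial]
      omega
  refine (card_mul_le_natDegree T M hmult).trans ?_
  refine natDegree_sum_le_of_forall_le _ _ fun s hs => ?_
  have hsJ : s / d < J := Nat.div_lt_of_lt_mul (Finset.mem_range.1 hs)
  refine natDegree_mul_le.trans ?_
  rw [natDegree_X_pow]
  refine (Nat.add_le_add_right natDegree_mul_le _).trans ?_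
  have e1 : (g ^ (M + s % d * c)).natDegree ≤ (M + d * c) * n := by
    refine natDegree_pow_le.trans (Nat.mul_le_mul ?_ hg)
    have := Nat.mul_le_mul_right c (Nat.mod_lt s hd).le
    omega
  have e3 : (κ v s).natDegree ≤ c := natDegree_le_of_degree_le (hκdeg v s).le
  have e4 : (s / d) * p ≤ M' * p := Nat.mul_le_mul_right _ (by omega)
  have e5 : (M + d * c) * n = M * n + d * c * n := by ring
  omega

theorem exists_pow_eq_of_pow_eq_one {p : ℕ} [Fact p.Prime] {n c : ℕ}
    (hc : p = Nat.gcd n (p - 1) * c + 1) {u : ZMod p} (hu : u ^ c = 1) (hc0 : 0 < c) :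
    ∃ w : ZMod p, w ≠ 0 ∧ u = w ^ n := by
  have hu0 : u ≠ 0 := by
    rintro rfl
    rw [zero_pow hc0.ne'] at hu
    exact zero_ne_one hu
  obtain ⟨γ, hγ⟩ := IsCyclic.exists_generator (α := (ZMod p)ˣ)
  have hord : orderOf γ = p - 1 := by
    rw [orderOf_eq_card_of_forall_mem_zpowers hγ, Nat.card_eq_fintype_card, ZMod.card_units]
  obtain ⟨k, hk⟩ := hγ (Units.mk0 u hu0)
  have hk' : γ ^ k = Units.mk0 u hu0 := hk
  have h1 : γ ^ (k * c) = 1 := by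
    rw [zpow_mul, hk', zpow_natCast]
    ext
    simpa using hu
  have h2 : ((p - 1 : ℕ) : ℤ) ∣ k * c := by
    rw [← hord]
    exact orderOf_dvd_iff_zpow_eq_one.2 h1
  set d := Nat.gcd n (p - 1) with hd
  have h3 : p - 1 = d * c := by omega
  have h4 : (d : ℤ) ∣ k := by
    rw [h3] at h2
    push_cast at h2
    exact Int.dvd_of_mul_dvd_mul_right (by exact_mod_cast hc0.ne') h2
  obtain ⟨e, he⟩ := h4
  have hb : (d : ℤ) = n * Nat.gcdA n (p - 1) + (p - 1 : ℕ) * Nat.gcdB n (p - 1) :=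
    Nat.gcd_eq_gcd_ab n (p - 1)
  refine ⟨((γ ^ (Nat.gcdA n (p - 1) * e) : (ZMod p)ˣ) : ZMod p), Units.ne_zero _, ?_⟩
  have h5 : Units.mk0 u hu0 = (γ ^ (Nat.gcdA n (p - 1) * e)) ^ n := by
    rw [← hk', he, hb, ← zpow_natCast (γ ^ (Nat.gcdA n (p - 1) * e)) n, ← zpow_mul]
    have h6 : (↑n * Nat.gcdA n (p - 1) + ↑(p - 1) * Nat.gcdB n (p - 1)) * e =
        Nat.gcdA n (p - 1) * e * n + (p - 1 : ℕ) * (Nat.gcdB n (p - 1) * e) := by ring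
    rw [h6, zpow_add, zpow_mul _ ((p - 1 : ℕ) : ℤ), zpow_natCast, ← hord, pow_orderOf_eq_one,
      one_zpow, mul_one]
  have h7 := congrArg Units.val h5
  simpa using h7

/-- A univariate polynomial over `𝔽_p` has a simple root in an algebraic closure. -/
def HasSimpleRoot {p : ℕ} [Fact p.Prime] (f : (ZMod p)[X]) : Prop :=
  ∃ α : AlgebraicClosure (ZMod p), aeval α f = 0 ∧ aeval α (derivative f) ≠ 0

theorem card_eval_pow_eq_mul_le {p : ℕ} [Fact p.Prime] {n c d M M' J : ℕ} {ζ : ZMod p}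
    {f : (ZMod p)[X]} (hf : f.natDegree ≤ n) (hroot : HasSimpleRoot f) (hd : 0 < d)
    (hp : p = d * c + 1) (hM : M = d * M') (hM0 : 0 < M) (hJ : J = M' + 1)
    (hlarge : M * (M * n + J) < d * c) :
    (univ.filter fun t : ZMod p => f.eval t ^ c = ζ).card * M ≤
      M * n + c + M' * p + d * c * n := by
  classical
  obtain ⟨α, h0, h1⟩ := hroot
  let ι := algebraMap (ZMod p) (AlgebraicClosure (ZMod p))
  have : CharP (AlgebraicClosure (ZMod p)) p := charP_of_injective_algebraMap ι.injective p
  set g := taylor α (f.map ι)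
  have hev : ∀ t : ZMod p, g.eval (ι t - α) = ι (f.eval t) := by
    intro t
    simp [g, taylor_eval, eval_map, eval₂_at_apply]
  let T := (univ.filter fun t : ZMod p => f.eval t ^ c = ζ).map
    ⟨fun t => ι t - α, fun a b hab => ι.injective (sub_left_injective hab)⟩
  have hcard : T.card = (univ.filter fun t : ZMod p => f.eval t ^ c = ζ).card := card_map _
  rw [← hcard]
  refine stepanov_bound (g := g) (β := α - α ^ p) (ζ := ι ζ) ?_ ?_ ?_ hd hp hM hM0 hJ hlarge T ?_ ?_
  · rw [natDegree_taylor]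
    exact natDegree_map_le.trans hf
  · rw [taylor_coeff_zero, eval_map_algebraMap, h0]
  · rw [taylor_coeff_one, derivative_map, eval_map_algebraMap]
    exact h1
  · intro t ht
    obtain ⟨a, -, rfl⟩ := Finset.mem_map.1 ht
    change (ι a - α) ^ p = ι a - α + _
    rw [sub_pow_char, ← map_pow, ZMod.pow_card]
    ring
  · intro t ht
    obtain ⟨a, ha, rfl⟩ := Finset.mem_map.1 ht
    change g.eval (ι a - α) ^ c = _
    rw [hev, ← map_pow, (Finset.mem_filter.1 ha).2]

/-- A polynomial with a simple root takes a value in every class modulo nonzero `n`-th powers,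
for all large `p`. -/
theorem exists_eval_eq_mul_pow (n : ℕ) (hn : 1 ≤ n) :
    ∃ p₀ : ℕ, ∀ (p : ℕ) [Fact p.Prime], p₀ < p → ∀ f : (ZMod p)[X], f.natDegree ≤ n →
      HasSimpleRoot f → ∀ b : ZMod p, b ≠ 0 → ∃ t w : ZMod p, w ≠ 0 ∧ f.eval t = b * w ^ n := by
  set A := n * (n * (n + 1)) with hA
  refine ⟨A * (A * n + (n * (n + 1) + 1)) + n ^ 3 * A + 2, ?_⟩
  intro p _ hp f hf hroot b hb
  classical
  have hp2 : 2 ≤ p := (Fact.out : p.Prime).two_le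
  set d := Nat.gcd n (p - 1) with hdef
  have hd0 : 0 < d := Nat.gcd_pos_of_pos_left _ hn
  have hdn : d ≤ n := Nat.gcd_le_left _ hn
  obtain ⟨c, hc⟩ : d ∣ p - 1 := Nat.gcd_dvd_right _ _
  have hpc : p = d * c + 1 := by omega
  have hc0 : 0 < c := by
    rcases Nat.eq_zero_or_pos c with rfl | h
    · simp at hc; omega
    · exact h
  by_contra hcon
  have hf0 : f ≠ 0 := by
    rintro rfl
    obtain ⟨α, -, h1⟩ := hroot
    simp at h1
  set M' := n * (n + 1) with hM'
  set M := d * M' with hM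
  have hMA : M ≤ A := Nat.mul_le_mul_right _ hdn
  have hlarge : M * (M * n + (M' + 1)) < d * c := by
    have : M * (M * n + (M' + 1)) ≤ A * (A * n + (M' + 1)) := by gcongr
    omega
  have hM0 : 0 < M := by positivity
  have hnone : ∀ t : ZMod p, f.eval t ^ c ≠ b ^ c := by
    intro t ht
    apply hcon
    have hu : (f.eval t / b) ^ c = 1 := by
      rw [div_pow, ht, div_self (pow_ne_zero _ hb)]
    obtain ⟨w, hw0, hw⟩ := exists_pow_eq_of_pow_eq_one hpc hu hc0
    exact ⟨t, w, hw0, by rw [← hw]; field_simp⟩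
  have hcard1 : ∀ x : ZMod p, x ≠ 0 → (x ^ c) ^ d = 1 := by
    intro x hx
    rw [← pow_mul, mul_comm, ← hc, ZMod.pow_card_sub_one_eq_one hx]
  set Z := ((nthRoots d (1 : ZMod p)).toFinset).erase (b ^ c) with hZ
  have hZcard : Z.card + 1 ≤ d := by
    have hmem : b ^ c ∈ (nthRoots d (1 : ZMod p)).toFinset := by
      rw [Multiset.mem_toFinset, mem_nthRoots hd0]
      exact hcard1 b hb
    rw [hZ, Finset.card_erase_add_one hmem]
    exact (Multiset.toFinset_card_le _).trans (card_nthRoots d 1)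
  have hcover : (univ : Finset (ZMod p)) ⊆ f.roots.toFinset ∪
      Z.biUnion fun ζ => univ.filter fun t : ZMod p => f.eval t ^ c = ζ := by
    intro t _
    rw [Finset.mem_union, Finset.mem_biUnion]
    by_cases ht : f.eval t = 0
    · left
      rw [Multiset.mem_toFinset, mem_roots hf0]
      exact ht
    · right
      refine ⟨f.eval t ^ c, ?_, by simp⟩
      rw [hZ, Finset.mem_erase, Multiset.mem_toFinset, mem_nthRoots hd0]
      exact ⟨hnone t, hcard1 _ ht⟩
  have h1 : p ≤ n + ∑ ζ ∈ Z, (univ.filter fun t : ZMod p => f.eval t ^ c = ζ).card := by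
    calc p = (univ : Finset (ZMod p)).card := by rw [Finset.card_univ, ZMod.card]
      _ ≤ _ := Finset.card_le_card hcover
      _ ≤ _ := Finset.card_union_le _ _
      _ ≤ _ := Nat.add_le_add ((Multiset.toFinset_card_le _).trans
          ((card_roots' f).trans hf)) Finset.card_biUnion_le
  have h2 : (∑ ζ ∈ Z, (univ.filter fun t : ZMod p => f.eval t ^ c = ζ).card) * M ≤
      Z.card * (M * n + c + M' * p + d * c * n) := by
    rw [Finset.sum_mul, ← smul_eq_mul, ← Finset.sum_const]
    exact Finset.sum_le_sum fun ζ _ =>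
      card_eval_pow_eq_mul_le hf hroot hd0 hpc hM hM0 rfl hlarge
  obtain ⟨e, he⟩ : ∃ e, d = e + 1 := ⟨d - 1, by omega⟩
  have hZe : Z.card ≤ e := by omega
  have h3 : p * M ≤ n * M + e * (M * n + c + M' * p + d * c * n) := by
    calc p * M ≤ (n + ∑ ζ ∈ Z, (univ.filter fun t : ZMod p => f.eval t ^ c = ζ).card) * M :=
          Nat.mul_le_mul_right _ h1
      _ ≤ n * M + Z.card * (M * n + c + M' * p + d * c * n) := by rw [add_mul]; omega
      _ ≤ _ := by gcongr
  have hdc : d * c ≤ p := by omega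
  have hcp : c ≤ p := by nlinarith
  have h4 : p * M ≤ n * M + e * (M * n + p + M' * p + p * n) :=
    h3.trans (by gcongr)
  have h5 : p * M' ≤ n * d * M + e * (n + 1) * p := by
    have : p * M = p * M' + e * (M' * p) := by rw [hM, he]; ring
    have h6 : n * d * M = n * M + e * (M * n) := by rw [he]; ring
    have h7 : e * (M * n + p + M' * p + p * n) =
      e * (M * n) + e * (M' * p) + e * (n + 1) * p := by ring
    omega
  have h8 : (e + 1) * (n + 1) * p ≤ p * M' := by
    calc (e + 1) * (n + 1) * p ≤ n * (n + 1) * p := by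
          gcongr
          omega
      _ = p * M' := by rw [hM']; ring
  have h9 : (n + 1) * p ≤ n * d * M := by
    have : (e + 1) * (n + 1) * p = e * (n + 1) * p + (n + 1) * p := by ring
    omega
  have h10 : n * d * M ≤ n ^ 3 * A := by
    calc n * d * M ≤ n * n * A := by gcongr
      _ = n ^ 2 * A * 1 := by ring
      _ ≤ n ^ 2 * A * n := by gcongr
      _ = n ^ 3 * A := by ring
  have h11 : p ≤ (n + 1) * p := Nat.le_mul_of_pos_left p (by omega)
  omega

end Stepanov

/-! ### Thue's method -/

section Thue

open Polynomial

attribute [local instance] Matrix.seminormedAddCommGroup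

/-- Powers of `a z`, for `z` a root of `f` with leading coefficient `a`, as small combinations of
`1, z, …, z ^ (n - 1)`. -/
theorem exists_reduction {f : ℤ[X]} {n H : ℕ} (hn : 1 ≤ n) (hf : f.natDegree = n)
    (hH : ∀ i, |f.coeff i| ≤ H) (j : ℕ) :
    ∃ r : ℕ → ℤ, (∀ i, |r i| ≤ (2 * H : ℤ) ^ j) ∧
      ∀ z : ℂ, aeval z f = 0 → ((f.coeff n : ℂ) * z) ^ j = ∑ i ∈ range n, (r i : ℂ) * z ^ i := by
  induction j with
  | zero =>
    refine ⟨fun i => if i = 0 then 1 else 0, fun i => ?_, fun z _ => ?_⟩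
    · dsimp only; split_ifs <;> simp
    · obtain ⟨m, rfl⟩ : ∃ m, n = m + 1 := ⟨n - 1, by omega⟩
      rw [Finset.sum_range_succ']
      simp
  | succ j ih =>
    obtain ⟨r, hr, hrz⟩ := ih
    obtain ⟨m, rfl⟩ : ∃ m, n = m + 1 := ⟨n - 1, by omega⟩
    refine ⟨fun i => (if i = 0 then 0 else f.coeff (m + 1) * r (i - 1)) - r m * f.coeff i,
      fun i => ?_, fun z hz => ?_⟩
    · have h1 : |(if i = 0 then 0 else f.coeff (m + 1) * r (i - 1))| ≤ (H : ℤ) * (2 * H) ^ j := by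
        split_ifs
        · rw [abs_zero]; positivity
        · rw [abs_mul]
          exact mul_le_mul (hH _) (hr _) (abs_nonneg _) (by positivity)
      have h2 : |r m * f.coeff i| ≤ (2 * H) ^ j * (H : ℤ) := by
        rw [abs_mul]
        exact mul_le_mul (hr _) (hH _) (abs_nonneg _) (by positivity)
      calc _ ≤ _ := abs_sub _ _
        _ ≤ (H : ℤ) * (2 * H) ^ j + (2 * H) ^ j * (H : ℤ) := add_le_add h1 h2
        _ = _ := by ring
    · have hz' : (f.coeff (m + 1) : ℂ) * z ^ (m + 1) =
          - ∑ i ∈ range (m + 1), (f.coeff i : ℂ) * z ^ i := by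
        rw [aeval_eq_sum_range, hf, Finset.sum_range_succ] at hz
        simp only [zsmul_eq_mul] at hz
        exact eq_neg_of_add_eq_zero_right hz
      rw [pow_succ, hrz z hz, Finset.sum_range_succ, add_mul]
      have h3 : (r m : ℂ) * z ^ m * ((f.coeff (m + 1) : ℂ) * z) =
          - ∑ i ∈ range (m + 1), (r m * f.coeff i : ℂ) * z ^ i := by
        have : (r m : ℂ) * z ^ m * ((f.coeff (m + 1) : ℂ) * z) =
          r m * ((f.coeff (m + 1) : ℂ) * z ^ (m + 1)) := by ring
        rw [this, hz', mul_neg, Finset.mul_sum]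
        simp only [mul_assoc]
      rw [h3]
      push_cast
      simp only [sub_mul, Finset.sum_sub_distrib]
      rw [sub_eq_add_neg]
      congr 1
      rw [Finset.sum_range_succ', Finset.sum_mul]
      simp only [Nat.add_eq_zero_iff, one_ne_zero, and_false, if_false, Nat.add_sub_cancel,
        if_true, zero_mul, add_zero]
      refine Finset.sum_congr rfl fun i _ => ?_
      ring

theorem eval_hasseDeriv_ofFn {R : Type*} [CommRing R] {D : ℕ} (v : Fin D → R) (l : ℕ) (z : R) :
    (hasseDeriv l (∑ k : Fin D, C (v k) * X ^ (k : ℕ))).eval z =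
      ∑ k : Fin D, v k * ((k : ℕ).choose l * z ^ ((k : ℕ) - l)) := by
  rw [map_sum, eval_finsetSum]
  refine Finset.sum_congr rfl fun k _ => ?_
  rw [C_mul_X_pow_eq_monomial, hasseDeriv_monomial, eval_monomial]
  ring

theorem coeff_sum_fin {R : Type*} [CommRing R] {D : ℕ} (v : Fin D → R) (i : ℕ) :
    (∑ k : Fin D, C (v k) * X ^ (k : ℕ)).coeff i = if h : i < D then v ⟨i, h⟩ else 0 := by
  simp only [finsetSum_coeff, coeff_C_mul, coeff_X_pow, mul_ite, mul_one, mul_zero]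
  split_ifs with h
  · rw [Finset.sum_eq_single ⟨i, h⟩]
    · simp
    · intro b _ hb
      rw [if_neg]
      rintro rfl
      exact hb rfl
    · simp
  · refine Finset.sum_eq_zero fun k _ => ?_
    rw [if_neg]
    have := k.2
    omega

/-- Thue's auxiliary polynomials, from Siegel's lemma. -/
theorem exists_thue_polynomials {f : ℤ[X]} {n H T s D M : ℕ} (hn : 1 ≤ n) (hf : f.natDegree = n)
    (hH1 : 1 ≤ H) (hH : ∀ i, |f.coeff i| ≤ H) (hT : 1 ≤ T) (hs : 1 ≤ s)
    (hD : D = n * (T + 1) * s) (hM : M = 2 * T * s) :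
    ∃ P Q : ℤ[X], ¬ (P = 0 ∧ Q = 0) ∧ P.degree < D ∧ Q.degree < D ∧
      (∀ i, |P.coeff i| ≤ ((16 * H) ^ (D * T) : ℕ)) ∧
      (∀ i, |Q.coeff i| ≤ ((16 * H) ^ (D * T) : ℕ)) ∧
      ∀ z : ℂ, aeval z f = 0 → ∀ l < M,
        (hasseDeriv l (P.map (Int.castRingHom ℂ))).eval z =
          z * (hasseDeriv l (Q.map (Int.castRingHom ℂ))).eval z := by
  choose r hr hrz using exists_reduction hn hf hH
  set a := f.coeff n with ha
  have ha0 : a ≠ 0 := by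
    rw [ha, ← hf]
    refine leadingCoeff_ne_zero.2 ?_
    rintro rfl
    simp at hf
    omega
  let A : Matrix (Fin M × Fin n) (Fin D ⊕ Fin D) ℤ := fun li k =>
    Sum.elim
      (fun k : Fin D => ((k : ℕ).choose li.1 : ℤ) *
        (a ^ (D - (k - li.1 : ℕ)) * r (k - li.1 : ℕ) li.2))
      (fun k : Fin D => - (((k : ℕ).choose li.1 : ℤ) *
        (a ^ (D - (k - li.1 + 1 : ℕ)) * r (k - li.1 + 1 : ℕ) li.2))) k
  have hD0 : 0 < D := by rw [hD]; positivity
  have hM0 : 0 < M := by rw [hM]; positivity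
  have hent : ∀ (k : Fin D) (l : ℕ) (i j : ℕ), j ≤ D →
      |((k : ℕ).choose l : ℤ) * (a ^ (D - j) * r j i)| ≤ (4 * H : ℤ) ^ D := by
    intro k l i j hj
    rw [abs_mul, abs_mul, abs_pow, Nat.abs_cast]
    have h1 : (((k : ℕ).choose l : ℕ) : ℤ) ≤ 2 ^ D := by
      have : (k : ℕ).choose l ≤ 2 ^ D :=
        (Nat.choose_le_two_pow _ _).trans (Nat.pow_le_pow_right (by norm_num) k.2.le)
      exact_mod_cast this
    have h2 : |a| ^ (D - j) ≤ (2 * H : ℤ) ^ (D - j) := by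
      refine pow_le_pow_left₀ (abs_nonneg _) ((hH n).trans ?_) _
      have : (0 : ℤ) ≤ H := by positivity
      linarith
    calc _ ≤ (2 : ℤ) ^ D * ((2 * H : ℤ) ^ (D - j) * (2 * H : ℤ) ^ j) := by
          gcongr
          exact hr j i
      _ = (4 * H : ℤ) ^ D := by
          rw [← pow_add, Nat.sub_add_cancel hj, ← mul_pow]
          ring
  have hA : ‖A‖ ≤ ((4 * H) ^ D : ℕ) := by
    refine (Matrix.norm_le_iff (by positivity)).2 ?_
    rintro ⟨l, i⟩ k
    rw [Int.norm_eq_abs]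
    rcases k with k | k
    · have := hent k l i (k - l) (by have := k.2; omega)
      simp only [A, Sum.elim_inl]
      exact_mod_cast this
    · have := hent k l i (k - l + 1) (by have := k.2; omega)
      rw [← abs_neg] at this
      simp only [A, Sum.elim_inr]
      exact_mod_cast this
  have hcardα : Fintype.card (Fin M × Fin n) = 2 * n * s * T := by
    simp [hM]; ring
  have hcardβ : Fintype.card (Fin D ⊕ Fin D) = 2 * n * s * T + 2 * n * s := by
    simp [hD]; ring
  have hns : 0 < 2 * n * s := by positivity
  obtain ⟨t, ht0, hAt, htn⟩ := Int.Matrix.exists_ne_zero_int_vec_norm_le A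
    (by rw [hcardα, hcardβ]; omega) (by rw [hcardα]; positivity)
  have hexp : ((Fintype.card (Fin M × Fin n) : ℝ) /
      ((Fintype.card (Fin D ⊕ Fin D) : ℝ) - (Fintype.card (Fin M × Fin n) : ℝ))) = (T : ℝ) := by
    rw [hcardα, hcardβ]
    have : (0 : ℝ) < 2 * n * s := by exact_mod_cast hns
    push_cast
    field_simp
    ring
  rw [hexp, Real.rpow_natCast] at htn
  have htB : ∀ k, |t k| ≤ ((16 * H) ^ (D * T) : ℕ) := by
    intro k
    have h1 : ‖t k‖ ≤ ‖t‖ := norm_le_pi_norm t k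
    have h2 : (Fintype.card (Fin D ⊕ Fin D) : ℝ) ≤ 4 ^ D := by
      have : 2 * D ≤ 4 ^ D := by
        have h3 : D + 1 ≤ 2 ^ D := Nat.lt_two_pow_self
        have h4 : (4 : ℕ) ^ D = 2 ^ D * 2 ^ D := by rw [← mul_pow]; norm_num
        nlinarith
      have h5 : Fintype.card (Fin D ⊕ Fin D) = 2 * D := by simp; ring
      rw [h5]
      exact_mod_cast this
    have h3 : max 1 ‖A‖ ≤ (4 * H : ℝ) ^ D := by
      refine max_le ?_ (by exact_mod_cast hA)
      apply one_le_pow₀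
      have : (1 : ℝ) ≤ H := by exact_mod_cast hH1
      linarith
    have h4 : ‖t k‖ ≤ ((16 * H : ℝ) ^ D) ^ T := by
      refine h1.trans (htn.trans (pow_le_pow_left₀ (by positivity) ?_ T))
      calc _ ≤ (4 : ℝ) ^ D * (4 * H : ℝ) ^ D := by gcongr
        _ = _ := by rw [← mul_pow]; ring
    rw [← pow_mul, Int.norm_eq_abs] at h4
    exact_mod_cast h4
  refine ⟨∑ k : Fin D, C (t (Sum.inl k)) * X ^ (k : ℕ), ∑ k : Fin D, C (t (Sum.inr k)) * X ^ (k : ℕ),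
    ?_, degree_sum_fin_lt _, degree_sum_fin_lt _, ?_, ?_, ?_⟩
  · rintro ⟨hP, hQ⟩
    apply ht0
    funext k
    rcases k with k | k
    · have := congrArg (fun q => q.coeff (k : ℕ)) hP
      simp only [coeff_sum_fin, coeff_zero] at this
      rwa [dif_pos k.2] at this
    · have := congrArg (fun q => q.coeff (k : ℕ)) hQ
      simp only [coeff_sum_fin, coeff_zero] at this
      rwa [dif_pos k.2] at this
  · intro i
    rw [coeff_sum_fin]
    split_ifs
    · exact htB _
    · rw [abs_zero]; positivity
  · intro i
    rw [coeff_sum_fin]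
    split_ifs
    · exact htB _
    · rw [abs_zero]; positivity
  · intro z hz l hl
    have ha0' : ((a : ℤ) : ℂ) ^ D ≠ 0 := pow_ne_zero _ (by exact_mod_cast ha0)
    have hpow : ∀ j ≤ D, (a : ℂ) ^ D * z ^ j =
        ∑ i : Fin n, ((a ^ (D - j) * r j i : ℤ) : ℂ) * z ^ (i : ℕ) := by
      intro j hj
      have h1 : (a : ℂ) ^ D * z ^ j = (a : ℂ) ^ (D - j) * ((a : ℂ) * z) ^ j := by
        rw [mul_pow, ← mul_assoc, ← pow_add, Nat.sub_add_cancel hj]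
      rw [h1, hrz j z hz, Finset.sum_range, Finset.mul_sum]
      refine Finset.sum_congr rfl fun i _ => ?_
      push_cast
      ring
    simp only [Polynomial.map_sum, Polynomial.map_mul, map_C, Polynomial.map_pow, map_X]
    rw [eval_hasseDeriv_ofFn, eval_hasseDeriv_ofFn, ← sub_eq_zero]
    apply (mul_eq_zero.1 _).resolve_left ha0'
    have hrow : ∀ i : Fin n, ∑ k : Fin D, (((k : ℕ).choose l : ℤ) *
        (a ^ (D - (k - l : ℕ)) * r (k - l : ℕ) i)) * t (Sum.inl k) +
        ∑ k : Fin D, (- (((k : ℕ).choose l : ℤ) *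
        (a ^ (D - (k - l + 1 : ℕ)) * r (k - l + 1 : ℕ) i))) * t (Sum.inr k) = 0 := by
      intro i
      have := congrFun hAt (⟨l, hl⟩, i)
      simpa [Matrix.mulVec, dotProduct, A, Fintype.sum_sum_type] using this
    have key : ∑ i : Fin n, ((∑ k : Fin D, (((k : ℕ).choose l : ℤ) *
        (a ^ (D - (k - l : ℕ)) * r (k - l : ℕ) i)) * t (Sum.inl k) +
        ∑ k : Fin D, (- (((k : ℕ).choose l : ℤ) *
        (a ^ (D - (k - l + 1 : ℕ)) * r (k - l + 1 : ℕ) i))) * t (Sum.inr k) : ℤ) : ℂ) *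
          z ^ (i : ℕ) = 0 := by
      refine Finset.sum_eq_zero fun i _ => ?_
      rw [hrow i]; simp
    rw [← key]
    simp only [Int.cast_add, Int.cast_sum, add_mul, Finset.sum_add_distrib, Finset.sum_mul]
    rw [mul_sub, sub_eq_add_neg]
    congr 1
    · rw [Finset.mul_sum, Finset.sum_comm]
      refine Finset.sum_congr rfl fun k _ => ?_
      calc _ = (t (Sum.inl k) : ℂ) * ((k : ℕ).choose l) * ((a : ℂ) ^ D * z ^ ((k : ℕ) - l)) := by
            simp only [eq_intCast]; ring
        _ = _ := by
          rw [hpow _ (by have := k.2; omega), Finset.mul_sum]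
          refine Finset.sum_congr rfl fun i _ => ?_
          push_cast
          ring
    · rw [Finset.mul_sum, Finset.mul_sum, ← Finset.sum_neg_distrib, Finset.sum_comm]
      refine Finset.sum_congr rfl fun k _ => ?_
      calc _ = -((t (Sum.inr k) : ℂ) * ((k : ℕ).choose l) *
              ((a : ℂ) ^ D * z ^ ((k : ℕ) - l + 1))) := by
            simp only [eq_intCast]; ring
        _ = _ := by
          rw [hpow _ (by have := k.2; omega), Finset.mul_sum, ← Finset.sum_neg_distrib]
          refine Finset.sum_congr rfl fun i _ => ?_
          push_cast
          ring

theorem X_sub_C_pow_dvd_iff_hasseDeriv {K : Type*} [Field K] (p : K[X]) (z : K) (M : ℕ) :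
    (X - C z) ^ M ∣ p ↔ ∀ l < M, (hasseDeriv l p).eval z = 0 := by
  rw [X_sub_C_pow_dvd_iff, ← taylor_apply, X_pow_dvd_iff]
  simp only [taylor_coeff]

theorem pow_dvd_wronskian {K : Type*} [Field K] {P Q : K[X]} {z w : K} {M : ℕ}
    (h : (X - C z) ^ M ∣ P - C w * Q) : (X - C z) ^ (M - 1) ∣ wronskian P Q := by
  have h1 : wronskian P Q = wronskian (P - C w * Q) Q := by
    simp only [wronskian, derivative_sub, derivative_mul, derivative_C]
    ring
  rw [h1, wronskian]
  exact dvd_sub (((pow_dvd_pow _ (Nat.sub_le _ _)).trans h).mul_right _)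
    ((pow_sub_one_dvd_derivative_of_pow_dvd h).mul_right _)

theorem wronskian_ne_zero {P Q : ℂ[X]} {Z : Finset ℂ} {D M : ℕ} (hPQ : ¬ (P = 0 ∧ Q = 0))
    (hP : P.degree < D) (hQ : Q.degree < D) (hD : D ≤ (Z.card - 1) * M)
    (hZ : ∀ z ∈ Z, (X - C z) ^ M ∣ P - C z * Q) : wronskian P Q ≠ 0 := by
  classical
  intro hW
  obtain ⟨A, hA⟩ := EuclideanDomain.gcd_dvd_left P Q
  obtain ⟨B, hB⟩ := EuclideanDomain.gcd_dvd_right P Q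
  set G := EuclideanDomain.gcd P Q with hG
  have hG0 : G ≠ 0 := fun h0 => hPQ (by rw [hA, hB, h0]; simp)
  have hcop : IsCoprime A B := by
    obtain ⟨u, v, huv⟩ : ∃ u v, u * P + v * Q = G :=
      ⟨EuclideanDomain.gcdA P Q, EuclideanDomain.gcdB P Q, by
        rw [hG, EuclideanDomain.gcd_eq_gcd_ab P Q]; ring⟩
    refine ⟨u, v, mul_left_cancel₀ hG0 ?_⟩
    calc G * (u * A + v * B) = u * (G * A) + v * (G * B) := by ring
      _ = G * 1 := by rw [← hA, ← hB, huv, mul_one]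
  have hWAB : wronskian A B = 0 := by
    have : wronskian P Q = G ^ 2 * wronskian A B := by
      rw [hA, hB]
      simp only [wronskian, derivative_mul]
      ring
    rw [this] at hW
    exact (mul_eq_zero.1 hW).resolve_left (pow_ne_zero _ hG0)
  obtain ⟨hA', hB'⟩ := hcop.wronskian_eq_zero_iff.1 hWAB
  obtain ⟨α, rfl⟩ := natDegree_eq_zero.1 (derivative_eq_zero.1 hA')
  obtain ⟨β, rfl⟩ := natDegree_eq_zero.1 (derivative_eq_zero.1 hB')
  have hGD : G.degree < D := by
    by_cases hα : C α = 0
    · have hβ : C β ≠ 0 := fun hβ => hPQ (by rw [hA, hB, hα, hβ]; simp)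
      refine lt_of_le_of_lt ?_ hQ
      rw [hB]
      exact degree_le_mul_left _ hβ
    · refine lt_of_le_of_lt ?_ hP
      rw [hA]
      exact degree_le_mul_left _ hα
  have hcard : Z.card - 1 ≤ (Z.filter fun z => α - z * β ≠ 0).card := by
    have h1 := Finset.card_filter_add_card_filter_not (s := Z) (fun z => α - z * β ≠ 0)
    have h2 : (Z.filter fun z => ¬ (α - z * β ≠ 0)).card ≤ 1 := by
      refine Finset.card_le_one.2 fun z hz w hw => ?_
      simp only [Finset.mem_filter, ne_eq, not_not] at hz hw
      by_contra hne
      have hβ : β = 0 := by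
        have h3 : (z - w) * β = 0 := by linear_combination hw.2 - hz.2
        exact (mul_eq_zero.1 h3).resolve_left (sub_ne_zero.2 hne)
      have hα : α = 0 := by linear_combination hz.2 + z * hβ
      exact hPQ (by rw [hA, hB, hα, hβ]; simp)
    omega
  have h3 := card_mul_le_natDegree (R := G) (Z.filter fun z => α - z * β ≠ 0) M (by
    intro z hz
    obtain ⟨hzZ, hz0⟩ := Finset.mem_filter.1 hz
    refine (le_rootMultiplicity_iff hG0).2 ?_
    have h4 := hZ z hzZ
    have h5 : P - C z * Q = C (α - z * β) * G := by
      nth_rewrite 1 [hA, hB]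
      simp only [C_sub, C_mul]
      ring
    rw [h5] at h4
    exact (isUnit_C.2 (isUnit_iff_ne_zero.2 hz0)).dvd_mul_left.1 h4)
  have h6 : G.natDegree < D := by
    rwa [degree_eq_natDegree hG0, Nat.cast_lt] at hGD
  have h7 := Nat.mul_le_mul_right M hcard
  omega

/-- Some derivative of `P - t₂ Q` of small order does not vanish at `t₁`. -/
theorem exists_hasseDeriv_eval_ne {P Q : ℂ[X]} {Z : Finset ℂ} {n T s D M : ℕ} (hn : 3 ≤ n)
    (hT : n ≤ T) (hs : 1 ≤ s) (hD : D = n * (T + 1) * s) (hM : M = 2 * T * s)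
    (hPQ : ¬ (P = 0 ∧ Q = 0)) (hP : P.degree < D) (hQ : Q.degree < D) (hZn : Z.card = n)
    (hZ : ∀ z ∈ Z, ∀ l < M, (hasseDeriv l P).eval z = z * (hasseDeriv l Q).eval z)
    {t₁ : ℂ} (ht : t₁ ∉ Z) (t₂ : ℂ) :
    ∃ l < 4 * n * s, (hasseDeriv l P).eval t₁ ≠ t₂ * (hasseDeriv l Q).eval t₁ := by
  by_contra! hcon
  have hZ' : ∀ z ∈ Z, (X - C z) ^ M ∣ P - C z * Q := by
    intro z hz
    rw [X_sub_C_pow_dvd_iff_hasseDeriv]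
    intro l hl
    rw [map_sub, eval_sub, hZ z hz l hl, ← smul_eq_C_mul, map_smul, eval_smul, smul_eq_mul, sub_self]
  have ht' : (X - C t₁) ^ (4 * n * s) ∣ P - C t₂ * Q := by
    rw [X_sub_C_pow_dvd_iff_hasseDeriv]
    intro l hl
    rw [map_sub, eval_sub, hcon l hl, ← smul_eq_C_mul, map_smul, eval_smul, smul_eq_mul, sub_self]
  have hW : wronskian P Q ≠ 0 := by
    refine wronskian_ne_zero hPQ hP hQ ?_ hZ'
    obtain ⟨m, rfl⟩ : ∃ m, n = m + 3 := ⟨n - 3, by omega⟩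
    obtain ⟨u, rfl⟩ : ∃ u, T = m + 3 + u := ⟨T - (m + 3), by omega⟩
    rw [hZn, hD, hM]
    have : (m + 3 - 1) = m + 2 := by omega
    rw [this, ← mul_assoc]
    refine Nat.mul_le_mul_right _ ?_
    nlinarith
  have hcop : ∀ a b : ℂ, a ≠ b → ∀ i j : ℕ, IsCoprime ((X - C a) ^ i) ((X - C b) ^ j) :=
    fun a b hab i j => (isCoprime_X_sub_C_of_isUnit_sub
      (isUnit_iff_ne_zero.2 (sub_ne_zero.2 hab))).pow
  have h1 : ∏ z ∈ Z, (X - C z) ^ (M - 1) ∣ wronskian P Q :=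
    Finset.prod_dvd_of_coprime (fun a _ b _ hab => hcop a b hab _ _)
      fun z hz => pow_dvd_wronskian (hZ' z hz)
  have h2 := pow_dvd_wronskian ht'
  have h3 : (∏ z ∈ Z, (X - C z) ^ (M - 1)) * (X - C t₁) ^ (4 * n * s - 1) ∣ wronskian P Q := by
    refine IsCoprime.mul_dvd (IsCoprime.prod_left fun z hz => hcop z t₁ ?_ _ _) h1 h2
    rintro rfl
    exact ht hz
  have h4 := natDegree_le_of_dvd h3 hW
  have h5 := natDegree_wronskian_lt_add hW
  have hmon : ∀ (a : ℂ) (i : ℕ), ((X - C a) ^ i).Monic := fun a i => (monic_X_sub_C a).pow i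
  rw [(monic_prod_of_monic _ _ fun z _ => hmon z _).natDegree_mul (hmon _ _),
    natDegree_prod_of_monic _ _ fun z _ => hmon z _] at h4
  simp only [natDegree_pow, natDegree_X_sub_C, mul_one, Finset.sum_const, hZn, smul_eq_mul] at h4
  have hD0 : 0 < D := by rw [hD]; positivity
  have h6 : P.natDegree ≤ D - 1 := by
    by_cases h0 : P = 0
    · simp [h0]
    · rw [degree_eq_natDegree h0, Nat.cast_lt] at hP
      omega
  have h7 : Q.natDegree ≤ D - 1 := by
    by_cases h0 : Q = 0
    · simp [h0]
    · rw [degree_eq_natDegree h0, Nat.cast_lt] at hQ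
      omega
  have h8 : n * (M - 1) + n = n * M := by
    have : 0 < T := by omega
    have : 0 < M := by rw [hM]; positivity
    obtain ⟨m, hm⟩ : ∃ m, M = m + 1 := ⟨M - 1, by omega⟩
    rw [hm, Nat.add_sub_cancel]; ring
  have h9 : n * M + 2 * (n * s) = 2 * D := by rw [hM, hD]; ring
  have h10 : n ≤ n * s := Nat.le_mul_of_pos_right _ hs
  have h11 : 4 * n * s = 4 * (n * s) := by ring
  omega

theorem hasseDeriv_map {R S : Type*} [CommRing R] [CommRing S] (g : R →+* S) (l : ℕ) (p : R[X]) :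
    hasseDeriv l (p.map g) = (hasseDeriv l p).map g := by
  ext i
  simp [hasseDeriv_coeff]

theorem eval_hasseDeriv_eq_sum {R : Type*} [CommRing R] {p : R[X]} {D : ℕ} (hp : p.natDegree < D)
    (l : ℕ) (x : R) :
    (hasseDeriv l p).eval x = ∑ i ∈ range D, (i.choose l : R) * p.coeff i * x ^ (i - l) := by
  rw [hasseDeriv_apply, sum_over_range' p (by simp) D hp, eval_finsetSum]
  simp [eval_monomial]

theorem abs_eval_hasseDeriv_le {p : ℝ[X]} {D : ℕ} {A x : ℝ} (hp : p.natDegree < D)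
    (hA : ∀ i, |p.coeff i| ≤ A) (hx : |x| ≤ 2) (l : ℕ) :
    |(hasseDeriv l p).eval x| ≤ A * 4 ^ D := by
  have hA0 : 0 ≤ A := (abs_nonneg _).trans (hA 0)
  rw [eval_hasseDeriv_eq_sum hp]
  have h4 : ∑ i ∈ range D, (4 : ℝ) ^ i ≤ 4 ^ D := by
    have := Nat.geomSum_lt (m := 4) (n := D) (s := range D) (by norm_num) (by simp)
    exact_mod_cast this.le
  calc _ ≤ ∑ i ∈ range D, |(i.choose l : ℝ) * p.coeff i * x ^ (i - l)| := abs_sum_le_sum_abs _ _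
    _ ≤ ∑ i ∈ range D, A * 4 ^ i := by
        refine Finset.sum_le_sum fun i _ => ?_
        rw [abs_mul, abs_mul, abs_pow, Nat.abs_cast]
        have h1 : (i.choose l : ℝ) ≤ 2 ^ i := by exact_mod_cast Nat.choose_le_two_pow _ _
        have h2 : |x| ^ (i - l) ≤ 2 ^ i :=
          (pow_le_pow_left₀ (abs_nonneg _) hx _).trans
            (pow_le_pow_right₀ (by norm_num) (Nat.sub_le _ _))
        calc _ ≤ (2 : ℝ) ^ i * A * 2 ^ i := by
              gcongr
              exact hA i
          _ = A * 4 ^ i := by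
              have : (4 : ℝ) ^ i = 2 ^ i * 2 ^ i := by rw [← mul_pow]; norm_num
              rw [this]; ring
    _ ≤ _ := by rw [← Finset.mul_sum]; gcongr

/-- A polynomial vanishing to order `M` at `θ` is small near `θ`. -/
theorem abs_eval_hasseDeriv_le_pow {p : ℝ[X]} {D M : ℕ} {A θ t : ℝ} (hp : p.natDegree < D)
    (hA : ∀ i, |p.coeff i| ≤ A) (hθ : |θ| ≤ 2) (hM : ∀ k < M, (hasseDeriv k p).eval θ = 0)
    (ht : |t - θ| ≤ 1) (l : ℕ) :
    |(hasseDeriv l p).eval t| ≤ A * 8 ^ D * |t - θ| ^ (M - l) := by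
  have hA0 : 0 ≤ A := (abs_nonneg _).trans (hA 0)
  rw [← taylor_eval_sub θ, eval_eq_sum_range' (n := D) (by
    rw [natDegree_taylor]
    exact (natDegree_hasseDeriv_le _ _).trans_lt (by omega))]
  have hterm : ∀ i, |(taylor θ (hasseDeriv l p)).coeff i * (t - θ) ^ i| ≤
      if i + l < D then 2 ^ (i + l) * (A * 4 ^ D) * |t - θ| ^ (M - l) else 0 := by
    intro i
    have hc : (taylor θ (hasseDeriv l p)).coeff i =
        ((i + l).choose i : ℝ) * (hasseDeriv (i + l) p).eval θ := by
      rw [taylor_coeff, ← LinearMap.comp_apply, hasseDeriv_comp]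
      simp
    rw [hc]
    split_ifs with hiD
    · by_cases hiM : i + l < M
      · rw [hM _ hiM]; simp; positivity
      · rw [abs_mul, abs_mul, Nat.abs_cast, abs_pow]
        have h1 : ((i + l).choose i : ℝ) ≤ 2 ^ (i + l) := by
          exact_mod_cast Nat.choose_le_two_pow _ _
        have h2 : |t - θ| ^ i ≤ |t - θ| ^ (M - l) :=
          pow_le_pow_of_le_one (abs_nonneg _) ht (by omega)
        gcongr
        exact abs_eval_hasseDeriv_le hp hA hθ _
    · rw [hasseDeriv_eq_zero_of_lt_natDegree p (i + l) (by omega)]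
      simp
  calc _ ≤ ∑ i ∈ range D, |(taylor θ (hasseDeriv l p)).coeff i * (t - θ) ^ i| :=
        abs_sum_le_sum_abs _ _
    _ ≤ ∑ i ∈ range D, if i + l < D then 2 ^ (i + l) * (A * 4 ^ D) * |t - θ| ^ (M - l) else 0 :=
        Finset.sum_le_sum fun i _ => hterm i
    _ = (∑ i ∈ (range D).filter (fun i => i + l < D), (2 : ℝ) ^ (i + l)) *
          ((A * 4 ^ D) * |t - θ| ^ (M - l)) := by
        rw [← Finset.sum_filter, Finset.sum_mul]
        exact Finset.sum_congr rfl fun i _ => by ring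
    _ ≤ 2 ^ D * ((A * 4 ^ D) * |t - θ| ^ (M - l)) := by
        gcongr
        have h1 : ∑ i ∈ (range D).filter (fun i => i + l < D), 2 ^ (i + l) =
            ∑ j ∈ ((range D).filter (fun i => i + l < D)).image (fun i => i + l), 2 ^ j := by
          rw [Finset.sum_image]
          intro a _ b _ hab
          simpa using hab
        have h2 := Nat.geomSum_lt (m := 2) (n := D)
          (s := ((range D).filter (fun i => i + l < D)).image (fun i => i + l)) le_rfl
          (by simp; omega)
        rw [← h1] at h2
        exact_mod_cast h2.le
    _ = _ := by
        have : (8 : ℝ) ^ D = 2 ^ D * 4 ^ D := by rw [← mul_pow]; norm_num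
        rw [this]; ring

theorem exists_int_eval_mul_pow {p : ℤ[X]} {D : ℕ} (hp : p.natDegree < D) (x y : ℤ) (hy : y ≠ 0) :
    ∃ m : ℤ, (m : ℝ) = (p.map (Int.castRingHom ℝ)).eval ((x : ℝ) / y) * (y : ℝ) ^ D := by
  refine ⟨∑ i ∈ range D, p.coeff i * (x ^ i * y ^ (D - i)), ?_⟩
  have hy' : (y : ℝ) ≠ 0 := by exact_mod_cast hy
  rw [eval_eq_sum_range' (n := D) (natDegree_map_le.trans_lt hp), Finset.sum_mul]
  push_cast
  refine Finset.sum_congr rfl fun i hi => ?_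
  have : (y : ℝ) ^ D = y ^ i * y ^ (D - i) := by
    rw [← pow_add, Nat.add_sub_cancel' (Finset.mem_range.1 hi).le]
  rw [this, coeff_map, div_pow]
  field_simp
  simp [mul_comm]

theorem thue_arith {a b Γ δ₁ δ₂ : ℝ} {n s D M l : ℕ} (hn : 3 ≤ n) (ha : 1 ≤ a) (hb : 1 ≤ b)
    (hΓ : Γ < a ^ (n ^ 2 * s)) (hD : D ≤ 25 * n ^ 2 * s)
    (hMl : 44 * n * s ≤ M - l) (hlo : a ^ (13 * n ^ 2 * s) ≤ b) (hhi : b ≤ a ^ (18 * n ^ 2 * s))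
    (hδ₁ : 0 ≤ δ₁) (hδ₂ : 0 ≤ δ₂) (h₁ : δ₁ * a ^ n ≤ 1) (h₂ : δ₂ * b ^ n ≤ 1) :
    Γ * δ₁ ^ (M - l) * (a ^ D * b) < 1 ∧ Γ * δ₂ * (a ^ D * b) < 1 := by
  have haD : a ^ D ≤ a ^ (25 * n ^ 2 * s) := pow_le_pow_right₀ ha hD
  constructor
  · have h3 : δ₁ ^ (M - l) * a ^ (44 * n ^ 2 * s) ≤ 1 := by
      have h4 : (δ₁ * a ^ n) ^ (M - l) ≤ 1 := pow_le_one₀ (by positivity) h₁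
      rw [mul_pow, ← pow_mul] at h4
      refine le_trans (mul_le_mul_of_nonneg_left (pow_le_pow_right₀ ha ?_) (by positivity)) h4
      calc 44 * n ^ 2 * s = n * (44 * n * s) := by ring
        _ ≤ _ := Nat.mul_le_mul_left _ hMl
    have h5 : a ^ D * b * Γ < a ^ (44 * n ^ 2 * s) := by
      calc a ^ D * b * Γ < a ^ D * b * a ^ (n ^ 2 * s) := by gcongr
        _ ≤ a ^ (25 * n ^ 2 * s) * a ^ (18 * n ^ 2 * s) * a ^ (n ^ 2 * s) := by gcongr
        _ = _ := by rw [← pow_add, ← pow_add]; congr 1; ring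
    rcases (pow_nonneg hδ₁ (M - l)).eq_or_lt with h6 | h6
    · rw [← h6]; simp
    · have h7 := mul_lt_mul_of_pos_left h5 h6
      calc _ = δ₁ ^ (M - l) * (a ^ D * b * Γ) := by ring
        _ < _ := h7.trans_le h3
  · have h3 : δ₂ * b ^ 3 ≤ 1 :=
      le_trans (mul_le_mul_of_nonneg_left (pow_le_pow_right₀ hb hn) hδ₂) h₂
    have h5 : a ^ D * Γ < b ^ 2 := by
      calc a ^ D * Γ < a ^ D * a ^ (n ^ 2 * s) := by gcongr
        _ ≤ a ^ (25 * n ^ 2 * s) * a ^ (n ^ 2 * s) := by gcongr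
        _ = (a ^ (13 * n ^ 2 * s)) ^ 2 := by rw [← pow_add, ← pow_mul]; congr 1; ring
        _ ≤ _ := by gcongr
    rcases hδ₂.eq_or_lt with h6 | h6
    · rw [← h6]; simp
    · have h7 := mul_lt_mul_of_pos_left h5 (mul_pos h6 (zero_lt_one.trans_le hb))
      calc _ = δ₂ * b * (a ^ D * Γ) := by ring
        _ < δ₂ * b * b ^ 2 := h7
        _ = δ₂ * b ^ 3 := by ring
        _ ≤ 1 := h3

theorem thue_constant_lt {a n s D H : ℕ} (hn : 1 ≤ n) (hD0 : 0 < D) (hDle : D ≤ 25 * n ^ 2 * s)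
    (hH1 : 1 ≤ H) (hY₁ : (768 * H) ^ (600 * n) < a) :
    6 * (16 * H : ℝ) ^ (D * (24 * n)) * 8 ^ D < (a : ℝ) ^ (n ^ 2 * s) := by
  have hs : s ≠ 0 := by rintro rfl; omega
  have h3 : 6 * (16 * H : ℝ) ^ (D * (24 * n)) * 8 ^ D ≤ (768 * H : ℝ) ^ (D * (24 * n)) := by
    have h4 : (6 * 8 ^ D : ℝ) ≤ 48 ^ (D * (24 * n)) := by
      calc (6 * 8 ^ D : ℝ) ≤ 6 ^ D * 8 ^ D := by
            gcongr
            exact le_self_pow₀ (by norm_num) (by omega)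
        _ = 48 ^ D := by rw [← mul_pow]; norm_num
        _ ≤ _ := pow_le_pow_right₀ (by norm_num) (Nat.le_mul_of_pos_right _ (by omega))
    calc _ = (16 * H : ℝ) ^ (D * (24 * n)) * (6 * 8 ^ D) := by ring
      _ ≤ (16 * H : ℝ) ^ (D * (24 * n)) * 48 ^ (D * (24 * n)) := by gcongr
      _ = _ := by rw [← mul_pow]; congr 1; ring
  refine h3.trans_lt ?_
  have h5 : (768 * H) ^ (D * (24 * n)) < a ^ (n ^ 2 * s) := by
    calc (768 * H) ^ (D * (24 * n)) ≤ (768 * H) ^ (600 * n * (n ^ 2 * s)) := by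
          refine Nat.pow_le_pow_right (by omega) ?_
          nlinarith
      _ = ((768 * H) ^ (600 * n)) ^ (n ^ 2 * s) := by rw [pow_mul]
      _ < _ := Nat.pow_lt_pow_left hY₁ (by positivity)
  exact_mod_cast h5

set_option maxHeartbeats 400000 in
/-- Thue's principle: a cubic or higher algebraic number does not have two very good rational
approximations of very different heights. -/
theorem thue_principle {f : ℤ[X]} {n H : ℕ} (hn : 3 ≤ n) (hf : f.natDegree = n) (hH1 : 1 ≤ H)
    (hH : ∀ i, |f.coeff i| ≤ H) {Z : Finset ℂ} (hZn : Z.card = n)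
    (hZ : ∀ z ∈ Z, aeval z f = 0) {θ : ℝ} (hθ : aeval θ f = 0) (hθ2 : |θ| ≤ 2)
    {x₁ y₁ x₂ y₂ : ℤ} (hf1 : aeval ((x₁ : ℝ) / y₁) f ≠ 0) (hy₁ : y₁ ≠ 0) (hy₂ : y₂ ≠ 0)
    (h₁ : |(x₁ : ℝ) / y₁ - θ| * |(y₁ : ℝ)| ^ n ≤ 1) (h₂ : |(x₂ : ℝ) / y₂ - θ| * |(y₂ : ℝ)| ^ n ≤ 1)
    (hY₁ : (768 * H) ^ (600 * n) < y₁.natAbs) : y₂.natAbs < y₁.natAbs ^ (39 * n ^ 2) := by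
  by_contra! hY₂
  set a := y₁.natAbs with ha
  set b := y₂.natAbs with hb
  have ha2 : 2 ≤ a := by
    have : 1 ≤ (768 * H) ^ (600 * n) := Nat.one_le_pow _ _ (by omega)
    omega
  have hb0 : b ≠ 0 := by simpa [hb] using hy₂
  have hn2 : 0 < n ^ 2 := by positivity
  have hbase : 1 < a ^ (13 * n ^ 2) := Nat.one_lt_pow (by omega) (by omega)
  set s := Nat.log (a ^ (13 * n ^ 2)) b with hs
  have hs1 : a ^ (13 * n ^ 2 * s) ≤ b := by
    rw [pow_mul]; exact Nat.pow_log_le_self _ hb0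
  have hs2 : b < a ^ (13 * n ^ 2 * (s + 1)) := by
    rw [pow_mul]; exact Nat.lt_pow_succ_log_self hbase _
  have hs3 : 3 ≤ s := by
    have : 3 < s + 1 := by
      have h := hY₂.trans_lt hs2
      rw [Nat.pow_lt_pow_iff_right (by omega)] at h
      nlinarith
    omega
  have hs4 : b < a ^ (18 * n ^ 2 * s) := by
    refine hs2.trans_le (Nat.pow_le_pow_right (by omega) ?_)
    nlinarith
  obtain ⟨P, Q, hPQ, hP, hQ, hPc, hQc, hPQz⟩ := exists_thue_polynomials (T := 24 * n) (s := s)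
    (by omega) hf hH1 hH (by omega) (by omega) rfl rfl
  set D := n * (24 * n + 1) * s with hD
  set M := 2 * (24 * n) * s with hM
  have hD0 : 0 < D := by rw [hD]; positivity
  set φ := Int.castRingHom ℝ
  set ψ := Int.castRingHom ℂ
  have hψ : ψ = (algebraMap ℝ ℂ).comp φ := RingHom.ext_int _ _
  have hψinj : Function.Injective ψ := Int.cast_injective
  have ht₁ : ((x₁ / y₁ : ℝ) : ℂ) ∉ Z := by
    intro hmem
    have := hZ _ hmem
    apply hf1
    have h3 := aeval_algebraMap_apply ℂ ((x₁ : ℝ) / y₁) f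
    rw [Complex.coe_algebraMap, this] at h3
    exact (algebraMap ℝ ℂ).injective (by rw [map_zero]; exact h3.symm)
  obtain ⟨l, hl, hlne⟩ := exists_hasseDeriv_eval_ne (P := P.map ψ) (Q := Q.map ψ) (Z := Z) hn
    (T := 24 * n) (s := s) (by omega) (by omega) hD hM
    (by rwa [Polynomial.map_eq_zero_iff hψinj, Polynomial.map_eq_zero_iff hψinj])
    (degree_map_le.trans_lt hP) (degree_map_le.trans_lt hQ) hZn
    (fun z hz => hPQz z (hZ z hz)) ht₁ ((x₂ / y₂ : ℝ) : ℂ)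
  have hnat : ∀ p : ℤ[X], p.degree < D → p.natDegree < D := by
    intro p hp
    by_cases h0 : p = 0
    · simpa [h0] using hD0
    · rwa [natDegree_lt_iff_degree_lt h0]
  have hC : ∀ (p : ℤ[X]) (k : ℕ) (t : ℝ), (hasseDeriv k (p.map ψ)).eval (t : ℂ) =
      (((hasseDeriv k (p.map φ)).eval t : ℝ) : ℂ) := by
    intro p k t
    rw [hψ, ← Polynomial.map_map, hasseDeriv_map (algebraMap ℝ ℂ)]
    exact eval_map_apply (algebraMap ℝ ℂ) t
  set t₁ : ℝ := x₁ / y₁ with ht₁'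
  set t₂ : ℝ := x₂ / y₂ with ht₂'
  set E : ℝ := (hasseDeriv l (P.map φ)).eval t₁ - t₂ * (hasseDeriv l (Q.map φ)).eval t₁ with hE
  have hE0 : E ≠ 0 := by
    rw [hE, sub_ne_zero]
    intro h
    apply hlne
    rw [hC, hC, h]
    push_cast
    rfl
  have hE1 : 1 ≤ |E| * ((a : ℝ) ^ D * b) := by
    obtain ⟨u, hu⟩ := exists_int_eval_mul_pow (p := hasseDeriv l P) (D := D)
      ((natDegree_hasseDeriv_le _ _).trans_lt (by have := hnat P hP; omega)) x₁ y₁ hy₁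
    obtain ⟨v, hv⟩ := exists_int_eval_mul_pow (p := hasseDeriv l Q) (D := D)
      ((natDegree_hasseDeriv_le _ _).trans_lt (by have := hnat Q hQ; omega)) x₁ y₁ hy₁
    have hy₂' : (y₂ : ℝ) ≠ 0 := by exact_mod_cast hy₂
    have hy₁' : (y₁ : ℝ) ≠ 0 := by exact_mod_cast hy₁
    have h3 : ((u * y₂ - x₂ * v : ℤ) : ℝ) = E * ((y₁ : ℝ) ^ D * y₂) := by
      push_cast
      rw [hu, hv, hE, hasseDeriv_map, hasseDeriv_map, ht₂', ← ht₁']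
      field_simp
      rw [mul_comm]
    have h4 : (u * y₂ - x₂ * v : ℤ) ≠ 0 := by
      intro h0
      rw [h0] at h3
      have : E * ((y₁ : ℝ) ^ D * y₂) ≠ 0 := by positivity
      exact this (by rw [← h3]; simp)
    have h5 := Int.one_le_abs h4
    have h6 : (1 : ℝ) ≤ |((u * y₂ - x₂ * v : ℤ) : ℝ)| := by exact_mod_cast h5
    rw [h3, abs_mul, abs_mul, abs_pow] at h6
    rw [ha, hb, Nat.cast_natAbs, Nat.cast_natAbs]
    exact_mod_cast h6
  set B : ℝ := (16 * H : ℝ) ^ (D * (24 * n)) with hB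
  have hPc' : ∀ i, |(P.map φ).coeff i| ≤ B := fun i => by
    rw [coeff_map, hB, eq_intCast]; exact_mod_cast hPc i
  have hQc' : ∀ i, |(Q.map φ).coeff i| ≤ B := fun i => by
    rw [coeff_map, hB, eq_intCast]; exact_mod_cast hQc i
  have hPd : (P.map φ).natDegree < D := natDegree_map_le.trans_lt (hnat P hP)
  have hQd : (Q.map φ).natDegree < D := natDegree_map_le.trans_lt (hnat Q hQ)
  have habs : ∀ x y : ℤ, y ≠ 0 → |(x : ℝ) / y - θ| * |(y : ℝ)| ^ n ≤ 1 →
      |(x : ℝ) / y - θ| ≤ 1 := by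
    intro x y hy h
    have h3 : (1 : ℝ) ≤ |(y : ℝ)| ^ n := one_le_pow₀ (by exact_mod_cast Int.one_le_abs hy)
    nlinarith [abs_nonneg ((x : ℝ) / y - θ)]
  have hδ₁ := habs x₁ y₁ hy₁ h₁
  set δ₁ := |t₁ - θ| with hδ₁'
  set δ₂ := |t₂ - θ| with hδ₂'
  have hR : |(hasseDeriv l (P.map φ - C θ * Q.map φ)).eval t₁| ≤
      3 * B * 8 ^ D * δ₁ ^ (M - l) := by
    refine abs_eval_hasseDeriv_le_pow ?_ (fun i => ?_) hθ2 (fun k hk => ?_) hδ₁ l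
    · refine (natDegree_sub_le _ _).trans_lt (max_lt hPd ((natDegree_C_mul_le _ _).trans_lt hQd))
    · rw [coeff_sub, coeff_C_mul]
      calc _ ≤ |(P.map φ).coeff i| + |θ * (Q.map φ).coeff i| := abs_sub _ _
        _ ≤ B + 2 * B := by
          rw [abs_mul]
          gcongr
          · exact hPc' i
          · exact hQc' i
        _ = _ := by ring
    · have hθC : aeval (θ : ℂ) f = 0 := by
        have h3 := aeval_algebraMap_apply ℂ θ f
        rwa [hθ, map_zero] at h3
      have h4 := hPQz θ hθC k hk
      rw [hC, hC] at h4
      rw [map_sub, eval_sub, ← smul_eq_C_mul, map_smul, eval_smul, smul_eq_mul, sub_eq_zero]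
      exact_mod_cast h4
  have hQE : |(hasseDeriv l (Q.map φ)).eval t₁| ≤ B * 8 ^ D := by
    have := abs_eval_hasseDeriv_le_pow (M := 0) hQd hQc' hθ2 (by simp) hδ₁ l
    simpa using this
  have hB0 : 0 < B := by
    have : (0 : ℝ) < H := by exact_mod_cast hH1
    positivity
  have hEle : |E| ≤ 3 * B * 8 ^ D * δ₁ ^ (M - l) + 3 * B * 8 ^ D * δ₂ := by
    have h3 : E = (hasseDeriv l (P.map φ - C θ * Q.map φ)).eval t₁ -
        (t₂ - θ) * (hasseDeriv l (Q.map φ)).eval t₁ := by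
      rw [map_sub, eval_sub, ← smul_eq_C_mul, map_smul, eval_smul, smul_eq_mul, hE]
      ring
    rw [h3]
    refine (abs_sub _ _).trans (add_le_add hR ?_)
    rw [abs_mul]
    calc δ₂ * _ ≤ δ₂ * (B * 8 ^ D) := by gcongr
      _ ≤ 3 * B * 8 ^ D * δ₂ := by
        have : 0 ≤ B * 8 ^ D * δ₂ := by positivity
        linarith
  set Γ : ℝ := 6 * B * 8 ^ D with hΓ
  have hΓ0 : 0 < Γ := by positivity
  have haR : (1 : ℝ) ≤ a := by exact_mod_cast (by omega : 1 ≤ a)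
  have hbR : (1 : ℝ) ≤ b := by exact_mod_cast (by omega : 1 ≤ b)
  have hDle : D ≤ 25 * n ^ 2 * s := by rw [hD]; nlinarith [Nat.mul_le_mul_right s (show n ≤ n ^ 2 by nlinarith)]
  have hΓlt : Γ < (a : ℝ) ^ (n ^ 2 * s) := by
    rw [hΓ, hB]
    exact thue_constant_lt (by omega) hD0 hDle hH1 hY₁
  have haY : |(y₁ : ℝ)| = a := by rw [ha, Nat.cast_natAbs]; push_cast; rfl
  have hbY : |(y₂ : ℝ)| = b := by rw [hb, Nat.cast_natAbs]; push_cast; rfl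
  rw [haY] at h₁
  rw [hbY] at h₂
  have hbhi : (b : ℝ) ≤ (a : ℝ) ^ (18 * n ^ 2 * s) := by exact_mod_cast hs4.le
  have hblo : (a : ℝ) ^ (13 * n ^ 2 * s) ≤ b := by exact_mod_cast hs1
  have hcase : 1 ≤ Γ * δ₁ ^ (M - l) * ((a : ℝ) ^ D * b) ∨ 1 ≤ Γ * δ₂ * ((a : ℝ) ^ D * b) := by
    by_contra! hcon
    have h3 : |E| * ((a : ℝ) ^ D * b) ≤
        (3 * B * 8 ^ D * δ₁ ^ (M - l) + 3 * B * 8 ^ D * δ₂) * ((a : ℝ) ^ D * b) := by gcongr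
    have h4 : (3 * B * 8 ^ D * δ₁ ^ (M - l) + 3 * B * 8 ^ D * δ₂) * ((a : ℝ) ^ D * b) =
        (Γ * δ₁ ^ (M - l) * ((a : ℝ) ^ D * b) + Γ * δ₂ * ((a : ℝ) ^ D * b)) / 2 := by
      rw [hΓ]; ring
    linarith [hcon.1, hcon.2]
  have hMl : 44 * n * s ≤ M - l := by
    rw [hM]
    have : 2 * (24 * n) * s = 44 * n * s + 4 * n * s := by ring
    omega
  obtain ⟨h3, h4⟩ := thue_arith hn haR hbR hΓlt hDle hMl hblo hbhi (abs_nonneg _)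
    (abs_nonneg _) h₁ h₂
  rcases hcase with hc | hc
  · exact absurd h3 hc.not_gt
  · exact absurd h4 hc.not_gt

end Thue

/-! ### Basic facts about binary forms -/

section BinEval

open Polynomial

variable {n : ℕ}

theorem map_binEval {R S : Type*} [CommRing R] [CommRing S] (g : R →+* S) (c : Fin (n + 1) → R)
    (x y : R) : g (binEval c x y) = binEval (fun i => g (c i)) (g x) (g y) := by
  simp [binEval]

theorem intCast_binEval {R : Type*} [CommRing R] (c : Fin (n + 1) → ℤ) (x y : ℤ) :
    ((binEval c x y : ℤ) : R) = binEval (fun i => (c i : R)) x y :=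
  map_binEval (Int.castRingHom R) c x y

theorem binEval_smul {R : Type*} [CommRing R] (c : Fin (n + 1) → R) (t x y : R) :
    binEval c (t * x) (t * y) = t ^ n * binEval c x y := by
  rw [binEval, binEval, Finset.mul_sum]
  refine Finset.sum_congr rfl fun i _ => ?_
  have : t ^ n = t ^ (n - (i : ℕ)) * t ^ (i : ℕ) := by
    rw [← pow_add, Nat.sub_add_cancel (by omega)]
  rw [this]; ring

theorem eval_formPolyX {R : Type*} [CommRing R] (c : Fin (n + 1) → ℤ) (x : R) :
    (formPolyX R c).eval x = binEval (fun i => (c i : R)) x 1 := by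
  simp [formPolyX, binEval, eval_finsetSum]

theorem map_formPolyX {R S : Type*} [CommRing R] [CommRing S] (g : R →+* S)
    (c : Fin (n + 1) → ℤ) : (formPolyX R c).map g = formPolyX S c := by
  simp [formPolyX, Polynomial.map_sum]

theorem aeval_formPolyX {R : Type*} [CommRing R] (c : Fin (n + 1) → ℤ) (x : R) :
    aeval x (formPolyX ℤ c) = binEval (fun i => (c i : R)) x 1 := by
  rw [← eval_formPolyX, ← map_formPolyX (Int.castRingHom R), aeval_def, eval_map]
  rfl

theorem coeff_formPolyX {R : Type*} [CommRing R] (c : Fin (n + 1) → ℤ) (i : Fin (n + 1)) :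
    (formPolyX R c).coeff (n - i) = c i := by
  simp only [formPolyX, finsetSum_coeff, coeff_C_mul, coeff_X_pow, mul_ite, mul_one, mul_zero]
  rw [Finset.sum_eq_single i]
  · simp
  · intro j _ hj
    rw [if_neg]
    intro h
    exact hj (Fin.ext (by omega))
  · simp

theorem natDegree_formPolyX_le {R : Type*} [CommRing R] (c : Fin (n + 1) → ℤ) :
    (formPolyX R c).natDegree ≤ n :=
  natDegree_sum_le_of_forall_le _ _ fun _ _ =>
    (natDegree_C_mul_X_pow_le _ _).trans (Nat.sub_le _ _)

theorem natDegree_formPolyX {c : Fin (n + 1) → ℤ} (hc : c 0 ≠ 0) :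
    (formPolyX ℤ c).natDegree = n := by
  refine le_antisymm (natDegree_formPolyX_le c) (le_natDegree_of_ne_zero ?_)
  have := coeff_formPolyX (R := ℤ) c 0
  rw [Fin.val_zero, Nat.sub_zero] at this
  rw [this]
  exact_mod_cast hc

theorem binEval_eq_pow_mul {K : Type*} [Field K] (c : Fin (n + 1) → K) (x : K) {y : K}
    (hy : y ≠ 0) : binEval c x y = y ^ n * binEval c (x / y) 1 := by
  rw [← binEval_smul, mul_one, mul_div_cancel₀ _ hy]

/-- Euler's relation. -/
theorem natCast_mul_eval_sub_mul_eval_derivative {R : Type*} [CommRing R] (c : Fin (n + 1) → ℤ)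
    (z : R) : n * (formPolyX R c).eval z - z * (derivative (formPolyX R c)).eval z =
      ∑ i : Fin (n + 1), (i : ℕ) * (c i : R) * z ^ (n - (i : ℕ)) := by
  simp only [formPolyX, derivative_sum, eval_finsetSum, Finset.mul_sum, ← Finset.sum_sub_distrib]
  refine Finset.sum_congr rfl fun i _ => ?_
  rw [derivative_C_mul_X_pow]
  simp only [eval_mul, eval_C, eval_pow, eval_X]
  have h1 : (n : R) = ((n - (i : ℕ) : ℕ) : R) + (i : ℕ) := by
    rw [← Nat.cast_add, Nat.sub_add_cancel (by omega)]
  rcases Nat.eq_zero_or_pos (n - (i : ℕ)) with h0 | h0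
  · rw [h0] at h1 ⊢
    rw [h1]; push_cast; ring
  · obtain ⟨k, hk⟩ : ∃ k, n - (i : ℕ) = k + 1 := ⟨n - (i : ℕ) - 1, by omega⟩
    rw [hk] at h1 ⊢
    rw [h1, Nat.add_sub_cancel]; ring

end BinEval

/-! ### Forms close to `x ^ n ± y ^ n` -/

section NearDiagonal

variable {n : ℕ}

/-- The form `c` is close to `σ R (x ^ n + y ^ n)`. -/
structure NearDiagonal (c : Fin (n + 1) → ℤ) (R ε σ : ℝ) : Prop where
  first : |(c 0 : ℝ) - σ * R| ≤ ε * R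
  last : |(c (Fin.last n) : ℝ) - σ * R| ≤ ε * R
  mid : ∀ i, i ≠ 0 → i ≠ Fin.last n → |(c i : ℝ)| ≤ ε * R

theorem exists_sum_eq_first_add_last {E : Type*} [NormedAddCommGroup E] (hn : 1 ≤ n)
    (g : Fin (n + 1) → E) {b : ℝ} (hb : 0 ≤ b)
    (hg : ∀ i, i ≠ 0 → i ≠ Fin.last n → ‖g i‖ ≤ b) :
    ∃ m, ∑ i, g i = g 0 + g (Fin.last n) + m ∧ ‖m‖ ≤ n * b := by
  obtain ⟨k, rfl⟩ : ∃ k, n = k + 1 := ⟨n - 1, by omega⟩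
  refine ⟨∑ i : Fin k, g i.succ.castSucc, ?_, ?_⟩
  · rw [Fin.sum_univ_castSucc, Fin.sum_univ_succ, Fin.castSucc_zero]
    abel
  · refine (norm_sum_le _ _).trans ?_
    calc _ ≤ ∑ _i : Fin k, b := by
          refine Finset.sum_le_sum fun i _ => hg _ ?_ ?_
          · intro h
            have := congrArg Fin.val h
            simp at this
          · exact (Fin.castSucc_lt_last _).ne
      _ ≤ _ := by
          simp only [Finset.sum_const, Finset.card_univ, Fintype.card_fin, nsmul_eq_mul]
          push_cast
          nlinarith

variable {c : Fin (n + 1) → ℤ} {R ε σ : ℝ}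

theorem NearDiagonal.abs_coeff_le (hc : NearDiagonal c R ε σ) (hR : 0 ≤ R) (hε : ε ≤ 1)
    (hσ : |σ| = 1) (i : Fin (n + 1)) : |(c i : ℝ)| ≤ 2 * R := by
  have key : ∀ u : ℝ, |u - σ * R| ≤ ε * R → |u| ≤ 2 * R := by
    intro u hu
    have h1 : |σ * R| = R := by rw [abs_mul, hσ, one_mul, abs_of_nonneg hR]
    calc |u| = |(u - σ * R) + σ * R| := by ring_nf
      _ ≤ _ := abs_add_le _ _
      _ ≤ _ := by rw [h1]; nlinarith
  by_cases h0 : i = 0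
  · rw [h0]; exact key _ hc.first
  by_cases h1 : i = Fin.last n
  · rw [h1]; exact key _ hc.last
  · exact (hc.mid i h0 h1).trans (by nlinarith)

/-- Bounds shared by all evaluations: the middle coefficients contribute little. -/
theorem NearDiagonal.exists_eval {K : Type*} [RCLike K] (hc : NearDiagonal c R ε σ) (hn : 1 ≤ n)
    (hR : 0 ≤ R) (hε : 0 ≤ ε) (w : Fin (n + 1) → K) {b : ℝ} (hb : 0 ≤ b)
    (hw : ∀ i, i ≠ 0 → i ≠ Fin.last n → ‖w i‖ ≤ b) :
    ∃ m : K, ∑ i, (c i : K) * w i = (c 0 : K) * w 0 + (c (Fin.last n) : K) * w (Fin.last n) + m ∧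
      ‖m‖ ≤ n * (ε * R * b) := by
  refine exists_sum_eq_first_add_last hn (fun i => (c i : K) * w i) (by positivity) fun i h0 h1 => ?_
  rw [norm_mul, ← RCLike.ofReal_intCast, RCLike.norm_ofReal]
  have := hc.mid i h0 h1
  gcongr
  exact hw i h0 h1

end NearDiagonal

section NearDiagonal

open Polynomial

variable {n : ℕ} {c : Fin (n + 1) → ℤ} {R ε σ : ℝ}

theorem NearDiagonal.abs_ge (hR : 0 ≤ R) (hσ : |σ| = 1) {u : ℝ} (hu : |u - σ * R| ≤ ε * R) :
    (1 - ε) * R ≤ |u| ∧ |u| ≤ (1 + ε) * R := by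
  have h1 : |σ * R| = R := by rw [abs_mul, hσ, one_mul, abs_of_nonneg hR]
  have h2 := abs_sub_abs_le_abs_sub (σ * R) u
  have h3 := abs_sub_abs_le_abs_sub u (σ * R)
  rw [abs_sub_comm] at h2
  rw [h1] at h2 h3
  constructor <;> linarith

theorem NearDiagonal.small_bounds (hn : 3 ≤ n) (hε : 0 ≤ ε) (hε' : ε * (n ^ 2 * 2 ^ n) ≤ 1 / 8) :
    ε * (n * 2 ^ n) ≤ 1 / 8 ∧ ε * n ≤ 1 / 64 ∧ ε ≤ 1 / 64 := by
  have hn1 : (1 : ℝ) ≤ n := by exact_mod_cast (by omega : 1 ≤ n)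
  have h2 : (8 : ℝ) ≤ 2 ^ n := by
    calc (8 : ℝ) = 2 ^ 3 := by norm_num
      _ ≤ _ := pow_le_pow_right₀ (by norm_num) hn
  have h3 : ε * (n * 2 ^ n) ≤ 1 / 8 := by
    refine le_trans ?_ hε'
    gcongr
    nlinarith
  have h4 : ε * n ≤ 1 / 64 := by
    have : ε * n * 8 ≤ ε * n * 2 ^ n := by gcongr
    linarith
  refine ⟨h3, h4, ?_⟩
  have : ε * 1 ≤ ε * n := by gcongr
  linarith

theorem NearDiagonal.not_common_root (hc : NearDiagonal c R ε σ) (hn : 3 ≤ n) (hR : 0 < R)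
    (hσ : |σ| = 1) (hε : 0 ≤ ε) (hε' : ε * (n ^ 2 * 2 ^ n) ≤ 1 / 8) (z : ℂ)
    (h0 : (formPolyX ℂ c).eval z = 0) : (derivative (formPolyX ℂ c)).eval z ≠ 0 := by
  intro h1
  obtain ⟨hε1, hε2, hε3⟩ := NearDiagonal.small_bounds hn hε hε'
  obtain ⟨hc0, -⟩ := NearDiagonal.abs_ge hR.le hσ hc.first
  obtain ⟨hcn, hcn'⟩ := NearDiagonal.abs_ge hR.le hσ hc.last
  have hnorm : ∀ u : ℤ, ‖(u : ℂ)‖ = |(u : ℝ)| := fun u => by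
    rw [← Complex.ofReal_intCast, Complex.norm_real, Real.norm_eq_abs]
  have hz : ‖z‖ ≤ 2 := by
    by_contra! hz
    obtain ⟨m, hm, hmle⟩ := hc.exists_eval (by omega) hR.le hε (fun i => z ^ (n - (i : ℕ)))
      (b := ‖z‖ ^ n) (by positivity) (fun i _ _ => by
        rw [norm_pow]
        exact pow_le_pow_right₀ (by linarith) (Nat.sub_le _ _))
    have h2 : ∑ i, (c i : ℂ) * z ^ (n - (i : ℕ)) = 0 := by
      rw [eval_formPolyX] at h0
      simpa [binEval] using h0
    rw [h2] at hm
    simp only [Fin.val_zero, Nat.sub_zero, Fin.val_last, Nat.sub_self, pow_zero, mul_one] at hm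
    have h3 : (c 0 : ℂ) * z ^ n = - (c (Fin.last n) : ℂ) - m := by linear_combination -hm
    have h4 := congrArg norm h3
    rw [norm_mul, norm_pow, hnorm] at h4
    have h5 := norm_sub_le (-(c (Fin.last n) : ℂ)) m
    rw [norm_neg, hnorm] at h5
    have h6 : (8 : ℝ) ≤ ‖z‖ ^ n := by
      calc (8 : ℝ) = 2 ^ 3 := by norm_num
        _ ≤ ‖z‖ ^ 3 := by gcongr
        _ ≤ _ := pow_le_pow_right₀ (by linarith) hn
    have h7 : (1 - ε) * R * ‖z‖ ^ n ≤ (1 + ε) * R + n * (ε * R * ‖z‖ ^ n) := by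
      calc _ ≤ |(c 0 : ℝ)| * ‖z‖ ^ n := by gcongr
        _ ≤ _ := by rw [h4]; linarith
    have h8 : R * (8 * (1 - ε - n * ε) - (1 + ε)) ≤ 0 := by
      have h9 : 0 ≤ R * (1 - ε - n * ε) * (‖z‖ ^ n - 8) := by
        refine mul_nonneg (mul_nonneg hR.le ?_) (by linarith)
        nlinarith
      nlinarith
    nlinarith
  have h2 : ∑ i : Fin (n + 1), (c i : ℂ) * ((i : ℕ) * z ^ (n - (i : ℕ))) = 0 := by
    have := natCast_mul_eval_sub_mul_eval_derivative c z
    rw [h0, h1] at this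
    rw [mul_zero, mul_zero, sub_zero] at this
    rw [this]
    exact Finset.sum_congr rfl fun i _ => by ring
  obtain ⟨m, hm, hmle⟩ := hc.exists_eval (by omega) hR.le hε
    (fun i => ((i : ℕ) * z ^ (n - (i : ℕ)) : ℂ)) (b := n * 2 ^ n) (by positivity) (fun i _ _ => by
      rw [norm_mul, norm_pow, Complex.norm_natCast]
      have h3 : ((i : ℕ) : ℝ) ≤ n := by exact_mod_cast (by omega : (i : ℕ) ≤ n)
      have h4 : ‖z‖ ^ (n - (i : ℕ)) ≤ 2 ^ n :=
        (pow_le_pow_left₀ (norm_nonneg _) hz _).trans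
          (pow_le_pow_right₀ (by norm_num) (Nat.sub_le _ _))
      gcongr)
  rw [h2] at hm
  simp only [Fin.val_zero, Nat.cast_zero, zero_mul, mul_zero, Fin.val_last, Nat.sub_self,
    pow_zero, mul_one, zero_add] at hm
  have h3 := congrArg norm (eq_neg_of_add_eq_zero_left hm.symm)
  rw [norm_mul, norm_neg, hnorm, Complex.norm_natCast] at h3
  have hn0 : (0 : ℝ) < n := by exact_mod_cast (by omega : 0 < n)
  have h4 : (1 - ε) * R * n ≤ n * (ε * R * (n * 2 ^ n)) := by
    calc _ ≤ |(c (Fin.last n) : ℝ)| * n := by gcongr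
      _ ≤ _ := by rw [h3]; exact hmle
  have h5 : (n : ℝ) * (ε * R * (n * 2 ^ n)) ≤ n * R * (1 / 8) := by
    calc _ = n * R * (ε * (n * 2 ^ n)) := by ring
      _ ≤ _ := by gcongr
  have h6 : 0 < n * R := by positivity
  nlinarith

theorem NearDiagonal.first_ne_zero (hc : NearDiagonal c R ε σ) (hR : 0 < R) (hσ : |σ| = 1)
    (hε : ε < 1) : c 0 ≠ 0 := by
  intro h0
  obtain ⟨hc0, -⟩ := NearDiagonal.abs_ge hR.le hσ hc.first
  rw [h0, Int.cast_zero, abs_zero] at hc0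
  nlinarith

/-- A form close to `x ^ n ± y ^ n` has `n` distinct complex roots. -/
theorem NearDiagonal.card_roots (hc : NearDiagonal c R ε σ) (hn : 3 ≤ n) (hR : 0 < R)
    (hσ : |σ| = 1) (hε : 0 ≤ ε) (hε' : ε * (n ^ 2 * 2 ^ n) ≤ 1 / 8) :
    (formPolyX ℂ c).roots.toFinset.card = n := by
  classical
  have hc0 := hc.first_ne_zero hR hσ
    (by have := (NearDiagonal.small_bounds hn hε hε').2.2; linarith)
  have hdeg : (formPolyX ℂ c).natDegree = n := by
    rw [← map_formPolyX (Int.castRingHom ℂ), natDegree_map_eq_of_injective Int.cast_injective,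
      natDegree_formPolyX hc0]
  have hne : formPolyX ℂ c ≠ 0 := by
    rintro h
    rw [h, natDegree_zero] at hdeg
    omega
  have hnodup : (formPolyX ℂ c).roots.Nodup := by
    rw [Multiset.nodup_iff_count_le_one]
    intro z
    rw [count_roots]
    by_contra! h
    obtain ⟨h1, h2⟩ := (one_lt_rootMultiplicity_iff_isRoot hne).1 h
    exact hc.not_common_root hn hR hσ hε hε' z h1 h2
  rw [Multiset.toFinset_card_of_nodup hnodup]
  exact (splits_iff_card_roots.1 (IsAlgClosed.splits _)).trans hdeg

theorem NearDiagonal.exists_real_root (hc : NearDiagonal c R ε 1) (hn : 3 ≤ n) (hodd : Odd n)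
    (hR : 0 < R) (hε : 0 ≤ ε) (hε' : ε * (n ^ 2 * 2 ^ n) ≤ 1 / 8) :
    ∃ θ : ℝ, -2 ≤ θ ∧ θ ≤ -(1 / 2) ∧ binEval (fun i => (c i : ℝ)) θ 1 = 0 := by
  obtain ⟨hε1, hε2, hε3⟩ := NearDiagonal.small_bounds hn hε hε'
  have h0 := abs_le.1 hc.first
  have h1 := abs_le.1 hc.last
  rw [one_mul] at h0 h1
  have h2n : (8 : ℝ) ≤ 2 ^ n := by
    calc (8 : ℝ) = 2 ^ 3 := by norm_num
      _ ≤ _ := pow_le_pow_right₀ (by norm_num) hn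
  have hval : ∀ t : ℝ, (formPolyX ℝ c).eval t = ∑ i, (c i : ℝ) * t ^ (n - (i : ℕ)) := by
    intro t
    rw [eval_formPolyX]
    simp [binEval]
  have hneg : (formPolyX ℝ c).eval (-2) ≤ 0 := by
    obtain ⟨m, hm, hmle⟩ := hc.exists_eval (by omega) hR.le hε
      (fun i => (-2 : ℝ) ^ (n - (i : ℕ))) (b := 2 ^ n) (by positivity) (fun i _ _ => by
        rw [norm_pow, norm_neg, Real.norm_ofNat]
        exact pow_le_pow_right₀ (by norm_num) (Nat.sub_le _ _))
    simp only [Fin.val_zero, Nat.sub_zero, Fin.val_last, Nat.sub_self, pow_zero, mul_one] at hm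
    rw [hval]
    refine hm.trans_le ?_
    rw [hodd.neg_pow]
    have h3 := (abs_le.1 hmle).2
    have h4 : n * (ε * R * 2 ^ n) ≤ 1 / 8 * R := by
      calc _ = ε * (n * 2 ^ n) * R := by ring
        _ ≤ _ := by gcongr
    have h5 : R * (1 - ε) * 8 ≤ (c 0 : ℝ) * 2 ^ n := by
      have : 0 ≤ R * (1 - ε) := mul_nonneg hR.le (by linarith)
      have h6 : R * (1 - ε) ≤ c 0 := by linarith
      exact mul_le_mul h6 h2n (by norm_num) (this.trans h6)
    nlinarith
  have hpos : 0 ≤ (formPolyX ℝ c).eval (-(1 / 2)) := by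
    obtain ⟨m, hm, hmle⟩ := hc.exists_eval (by omega) hR.le hε
      (fun i => (-(1 / 2) : ℝ) ^ (n - (i : ℕ))) (b := 1) (by positivity) (fun i _ _ => by
        rw [norm_pow]
        refine pow_le_one₀ (norm_nonneg _) ?_
        norm_num)
    simp only [Fin.val_zero, Nat.sub_zero, Fin.val_last, Nat.sub_self, pow_zero, mul_one] at hm
    rw [hval]
    refine le_of_le_of_eq ?_ hm.symm
    rw [hodd.neg_pow]
    have h3 := (abs_le.1 hmle).1
    have h4 : n * (ε * R) ≤ 1 / 64 * R := by
      calc _ = ε * n * R := by ring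
        _ ≤ _ := by gcongr
    have h5 : (c 0 : ℝ) * (1 / 2) ^ n ≤ (R * (1 + ε)) * (1 / 8) := by
      have h6 : ((1 : ℝ) / 2) ^ n ≤ 1 / 8 := by
        rw [div_pow, one_pow]
        exact one_div_le_one_div_of_le (by norm_num) h2n
      have : 0 ≤ R * (1 + ε) := by positivity
      gcongr
      linarith
    nlinarith
  obtain ⟨θ, hθ, hθ0⟩ := intermediate_value_Icc (by norm_num : (-2 : ℝ) ≤ -(1 / 2))
    (formPolyX ℝ c).continuous.continuousOn ⟨hneg, hpos⟩
  exact ⟨θ, hθ.1, hθ.2, by rw [← eval_formPolyX]; exact hθ0⟩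

end NearDiagonal

section NearDiagonal

open Polynomial

variable {n : ℕ} {c : Fin (n + 1) → ℤ} {R ε σ : ℝ}

theorem Odd.pow_max_mul_sub_le (hn : Odd n) {x u : ℝ} (h : u ≤ x) :
    max |x| |u| ^ (n - 1) * (x - u) ≤ 2 * (x ^ n - u ^ n) := by
  have key : ∀ a b : ℝ, 0 ≤ b → b ≤ a → a ^ (n - 1) * (a - b) ≤ 2 * (a ^ n - b ^ n) := by
    intro a b hb hab
    have h1 : ∀ t : ℝ, t ^ n = t ^ (n - 1) * t := fun t => (pow_sub_one_mul hn.pos.ne' t).symm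
    have h2 : b ^ (n - 1) ≤ a ^ (n - 1) := pow_le_pow_left₀ hb hab _
    have h3 : 0 ≤ b ^ (n - 1) := pow_nonneg hb _
    rw [h1 a, h1 b]
    nlinarith
  rcases le_or_gt 0 u with hu | hu
  · rw [abs_of_nonneg hu, abs_of_nonneg (hu.trans h), max_eq_left h]
    exact key x u hu h
  rcases le_or_gt x 0 with hx | hx
  · rw [abs_of_neg hu, abs_of_nonpos hx, max_eq_right (by linarith)]
    have := key (-u) (-x) (by linarith) (by linarith)
    rw [hn.neg_pow, hn.neg_pow] at this
    linarith
  · rw [abs_of_neg hu, abs_of_pos hx]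
    have h1 : max x (-u) ^ n ≤ x ^ n - u ^ n := by
      have h2 : 0 ≤ x ^ n := by positivity
      have h3 : 0 ≤ (-u) ^ n := pow_nonneg (by linarith) _
      have h4 : (-u) ^ n = -u ^ n := hn.neg_pow u
      rcases max_cases x (-u) with ⟨h5, -⟩ | ⟨h5, -⟩ <;> rw [h5] <;> linarith
    have h2 : x - u ≤ 2 * max x (-u) := by linarith [le_max_left x (-u), le_max_right x (-u)]
    have h3 : 0 ≤ max x (-u) ^ (n - 1) := pow_nonneg (hx.le.trans (le_max_left _ _)) _
    calc _ ≤ max x (-u) ^ (n - 1) * (2 * max x (-u)) := by gcongr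
      _ = 2 * max x (-u) ^ n := by rw [← pow_sub_one_mul hn.pos.ne' (max x (-u))]; ring
      _ ≤ _ := by gcongr

/-- A form of odd degree close to `x ^ n + y ^ n` is small only close to its real root. -/
theorem NearDiagonal.mul_abs_sub_le (hc : NearDiagonal c R ε 1) (hn : 3 ≤ n) (hodd : Odd n)
    (hR : 0 < R) (hε : 0 ≤ ε) (hε' : ε * (n ^ 2 * 2 ^ n) ≤ 1 / 8) {θ : ℝ} (hθ : θ ≤ -(1 / 2))
    (hθ0 : binEval (fun i => (c i : ℝ)) θ 1 = 0) (x y : ℝ) :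
    R * |x - θ * y| * |y| ^ (n - 1) ≤ 2 ^ (n + 1) * |binEval (fun i => (c i : ℝ)) x y| := by
  obtain ⟨hε1, hε2, hε3⟩ := NearDiagonal.small_bounds hn hε hε'
  set u := θ * y with hu
  set m := max |x| |u| with hm
  have hm0 : 0 ≤ m := (abs_nonneg x).trans (le_max_left _ _)
  have hym : |y| ≤ 2 * m := by
    have h1 : |u| ≤ m := le_max_right _ _
    rw [hu, abs_mul, abs_of_nonpos (by linarith)] at h1
    nlinarith [abs_nonneg y]
  have hFu : binEval (fun i => (c i : ℝ)) u y = 0 := by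
    have := binEval_smul (fun i => (c i : ℝ)) y θ 1
    rw [hθ0, mul_zero, mul_one, mul_comm] at this
    exact this
  have hF : binEval (fun i => (c i : ℝ)) x y =
      ∑ i : Fin (n + 1), (c i : ℝ) * ((x ^ (n - (i : ℕ)) - u ^ (n - (i : ℕ))) * y ^ (i : ℕ)) := by
    rw [← sub_zero (binEval _ x y), ← hFu, binEval, binEval, ← Finset.sum_sub_distrib]
    exact Finset.sum_congr rfl fun i _ => by ring
  obtain ⟨t, ht, htle⟩ := hc.exists_eval (by omega) hR.le hε
    (fun i : Fin (n + 1) => (x ^ (n - (i : ℕ)) - u ^ (n - (i : ℕ))) * y ^ (i : ℕ))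
    (b := |x - u| * n * 2 ^ n * m ^ (n - 1)) (by positivity) (fun i _ hi => by
      have hi' : (i : ℕ) < n := by
        have h1 : (i : ℕ) ≠ n := fun h => hi (Fin.ext h)
        omega
      rw [norm_mul, norm_pow, Real.norm_eq_abs, Real.norm_eq_abs]
      calc _ ≤ (|x - u| * (n - (i : ℕ) : ℕ) * m ^ (n - (i : ℕ) - 1)) * (2 * m) ^ (i : ℕ) := by
            gcongr
            exact abs_pow_sub_pow_le _ _ _
        _ ≤ (|x - u| * n * m ^ (n - (i : ℕ) - 1)) * (2 ^ n * m ^ (i : ℕ)) := by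
            rw [mul_pow]
            gcongr
            · exact Nat.sub_le _ _
            · norm_num
        _ = |x - u| * n * 2 ^ n * (m ^ (n - (i : ℕ) - 1) * m ^ (i : ℕ)) := by ring
        _ = _ := by rw [← pow_add]; congr 2; omega)
  rw [← hF] at ht
  simp only [Fin.val_zero, Nat.sub_zero, Fin.val_last, Nat.sub_self, pow_zero, mul_one, sub_self,
    zero_mul, mul_zero, add_zero] at ht
  obtain ⟨hc0, -⟩ := NearDiagonal.abs_ge hR.le (by norm_num) hc.first
  have h1 : m ^ (n - 1) * |x - u| ≤ 2 * |x ^ n - u ^ n| := by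
    rcases le_total u x with h | h
    · rw [abs_of_nonneg (sub_nonneg.2 h)]
      exact (hodd.pow_max_mul_sub_le h).trans (by gcongr; exact le_abs_self _)
    · rw [abs_sub_comm, abs_of_nonneg (sub_nonneg.2 h), hm, max_comm, abs_sub_comm]
      exact (hodd.pow_max_mul_sub_le h).trans (by gcongr; exact le_abs_self _)
  have h2 : (1 - ε) * R * |x ^ n - u ^ n| ≤ |(c 0 : ℝ)| * |x ^ n - u ^ n| := by gcongr
  have h3 : |(c 0 : ℝ)| * |x ^ n - u ^ n| ≤ |binEval (fun i => (c i : ℝ)) x y| + |t| := by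
    rw [← abs_mul, show (c 0 : ℝ) * (x ^ n - u ^ n) = binEval (fun i => (c i : ℝ)) x y - t by
      rw [ht]; ring]
    exact abs_sub _ _
  set P := m ^ (n - 1) * |x - u| with hP
  have hP0 : 0 ≤ P := by positivity
  have h4 : |t| ≤ 1 / 8 * (R * P) := by
    refine htle.trans ?_
    calc _ = ε * (n ^ 2 * 2 ^ n) * (R * P) := by rw [hP]; ring
      _ ≤ _ := by gcongr
  have h5 : R * P ≤ 4 * |binEval (fun i => (c i : ℝ)) x y| := by
    have h6 : (1 - ε) * R * P ≤ (1 - ε) * R * (2 * |x ^ n - u ^ n|) :=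
      mul_le_mul_of_nonneg_left h1 (mul_nonneg (by linarith) hR.le)
    have h7 : ε * (R * P) ≤ 1 / 64 * (R * P) := by gcongr
    have h8 : 0 ≤ R * P := by positivity
    linarith
  have h9 : |y| ^ (n - 1) ≤ 2 ^ (n - 1) * m ^ (n - 1) := by
    rw [← mul_pow]
    gcongr
  calc _ ≤ R * |x - u| * (2 ^ (n - 1) * m ^ (n - 1)) := by gcongr
    _ = 2 ^ (n - 1) * (R * P) := by rw [hP]; ring
    _ ≤ 2 ^ (n - 1) * (4 * |binEval (fun i => (c i : ℝ)) x y|) := by gcongr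
    _ = _ := by
      obtain ⟨k, rfl⟩ : ∃ k, n = k + 1 := ⟨n - 1, by omega⟩
      rw [Nat.add_sub_cancel]; ring

/-- A form of even degree close to `x ^ n + y ^ n` or to `-(x ^ n + y ^ n)` is definite. -/
theorem NearDiagonal.le_abs_binEval (hc : NearDiagonal c R ε σ) (hn : 3 ≤ n) (heven : Even n)
    (hR : 0 < R) (hσ : |σ| = 1) (hε : 0 ≤ ε) (hε' : ε * (n ^ 2 * 2 ^ n) ≤ 1 / 8) (x y : ℝ) :
    R / 2 * max |x| |y| ^ n ≤ |binEval (fun i => (c i : ℝ)) x y| := by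
  obtain ⟨hε1, hε2, hε3⟩ := NearDiagonal.small_bounds hn hε hε'
  set m := max |x| |y| with hm
  have hm0 : 0 ≤ m := (abs_nonneg x).trans (le_max_left _ _)
  have hF : binEval (fun i => (c i : ℝ)) x y =
      ∑ i : Fin (n + 1), (c i : ℝ) * (x ^ (n - (i : ℕ)) * y ^ (i : ℕ)) := by
    rw [binEval]
    exact Finset.sum_congr rfl fun i _ => by ring
  obtain ⟨t, ht, htle⟩ := hc.exists_eval (by omega) hR.le hε
    (fun i : Fin (n + 1) => x ^ (n - (i : ℕ)) * y ^ (i : ℕ))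
    (b := m ^ n) (by positivity) (fun i _ hi => by
      rw [norm_mul, norm_pow, norm_pow, Real.norm_eq_abs, Real.norm_eq_abs]
      calc _ ≤ m ^ (n - (i : ℕ)) * m ^ (i : ℕ) := by
            gcongr
            · exact le_max_left _ _
            · exact le_max_right _ _
        _ = _ := by rw [← pow_add]; congr 1; omega)
  rw [← hF] at ht
  simp only [Fin.val_zero, Nat.sub_zero, Fin.val_last, Nat.sub_self, pow_zero, mul_one,
    one_mul] at ht
  have h0 := abs_le.1 hc.first
  have h1 := abs_le.1 hc.last
  have hx : 0 ≤ x ^ n := heven.pow_nonneg x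
  have hy : 0 ≤ y ^ n := heven.pow_nonneg y
  have hmn : m ^ n ≤ x ^ n + y ^ n := by
    rcases max_cases |x| |y| with ⟨h5, -⟩ | ⟨h5, -⟩ <;> rw [hm, h5, heven.pow_abs] <;> linarith
  have h4 : |t| ≤ 1 / 8 * (R * m ^ n) := by
    refine htle.trans ?_
    calc _ = ε * n * (R * m ^ n) := by ring
      _ ≤ _ := by gcongr; linarith
  have h4' := abs_le.1 h4
  have hs : 0 ≤ R * (x ^ n + y ^ n) := by positivity
  have h6 : R * m ^ n ≤ R * (x ^ n + y ^ n) := by gcongr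
  have h7 : ε * (R * (x ^ n + y ^ n)) ≤ 1 / 64 * (R * (x ^ n + y ^ n)) := by gcongr
  have h8 := mul_le_mul_of_nonneg_right h0.1 hx
  have h9 := mul_le_mul_of_nonneg_right h0.2 hx
  have h10 := mul_le_mul_of_nonneg_right h1.1 hy
  have h11 := mul_le_mul_of_nonneg_right h1.2 hy
  rcases (abs_eq (by norm_num : (0 : ℝ) ≤ 1)).1 hσ with rfl | rfl
  · refine le_trans ?_ (le_abs_self _)
    rw [ht]
    linarith
  · refine le_trans ?_ (neg_le_abs _)
    rw [ht]
    linarith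

end NearDiagonal

section SolutionCount

open Polynomial

theorem Finset.card_le_of_gap {A : Finset ℕ} {r K J : ℕ} (hr : 2 ≤ r) (hpos : ∀ a ∈ A, 1 ≤ a)
    (hgap : ∀ a ∈ A, ∀ b ∈ A, a < b → r * a ^ 2 ≤ b)
    (hJ : ∀ a ∈ A, ∀ b ∈ A, r ^ K < a → b < a ^ J) : A.card ≤ K + J + 1 := by
  by_contra! hcard
  set e := A.orderEmbOfFin rfl with he
  have hmem : ∀ i, e i ∈ A := fun i => A.orderEmbOfFin_mem rfl i
  have hstep : ∀ k (hk : k + 1 < A.card), r * e ⟨k, by omega⟩ ^ 2 ≤ e ⟨k + 1, hk⟩ := fun k hk =>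
    hgap _ (hmem _) _ (hmem _) (e.strictMono (Fin.mk_lt_mk.2 (Nat.lt_succ_self k)))
  have h1 : ∀ k (hk : k < A.card), r ^ k ≤ e ⟨k, hk⟩ := by
    intro k
    induction k with
    | zero => intro hk; simpa using hpos _ (hmem _)
    | succ k ih =>
      intro hk
      have h2 := hstep k hk
      have h3 := ih (by omega)
      have h4 := hpos _ (hmem ⟨k, by omega⟩)
      calc r ^ (k + 1) = r * r ^ k := pow_succ' _ _
        _ ≤ r * e ⟨k, by omega⟩ := by gcongr
        _ ≤ r * e ⟨k, by omega⟩ ^ 2 := by gcongr; exact Nat.le_self_pow two_ne_zero _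
        _ ≤ _ := h2
  set a := e ⟨K + 1, by omega⟩ with ha
  have h2 : ∀ j (hj : K + 1 + j < A.card), a ^ (j + 1) ≤ e ⟨K + 1 + j, hj⟩ := by
    intro j
    induction j with
    | zero => intro hj; simp [ha]
    | succ j ih =>
      intro hj
      have h3 := hstep (K + 1 + j) hj
      have h4 := ih (by omega)
      have h5 : a ≤ e ⟨K + 1 + j, by omega⟩ :=
        e.monotone (Fin.mk_le_mk.2 (Nat.le_add_right _ _))
      calc a ^ (j + 1 + 1) = a ^ (j + 1) * a := pow_succ _ _
        _ ≤ e ⟨K + 1 + j, by omega⟩ * e ⟨K + 1 + j, by omega⟩ := Nat.mul_le_mul h4 h5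
        _ = 1 * e ⟨K + 1 + j, by omega⟩ ^ 2 := by ring
        _ ≤ r * e ⟨K + 1 + j, by omega⟩ ^ 2 := by gcongr; omega
        _ ≤ _ := h3
  have h3 : r ^ K < a :=
    (Nat.pow_lt_pow_right (by omega) (Nat.lt_succ_self K)).trans_le (h1 (K + 1) (by omega))
  have h4 := h2 J (by omega)
  have h5 := hJ a (hmem _) _ (hmem ⟨K + 1 + J, by omega⟩) h3
  have h6 : a ^ J ≤ a ^ (J + 1) := Nat.pow_le_pow_right (by omega) (Nat.le_succ J)
  omega

/-- Two approximations to the same number by distinct fractions are far apart. -/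
theorem sq_le_mul_of_abs_sub_le {n : ℕ} (hn : 3 ≤ n) {θ η : ℝ} {x₁ y₁ x₂ y₂ : ℤ} (hη : 0 ≤ η)
    (hy₁ : y₁ ≠ 0) (hy : |y₁| ≤ |y₂|) (hne : x₁ * y₂ ≠ x₂ * y₁)
    (h₁ : |(x₁ : ℝ) - θ * y₁| * |(y₁ : ℝ)| ^ (n - 1) ≤ η)
    (h₂ : |(x₂ : ℝ) - θ * y₂| * |(y₂ : ℝ)| ^ (n - 1) ≤ η) :
    |(y₁ : ℝ)| ^ 2 ≤ 2 * η * |(y₂ : ℝ)| := by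
  have h1 : (1 : ℝ) ≤ |(y₁ : ℝ)| := by exact_mod_cast Int.one_le_abs hy₁
  have h12 : |(y₁ : ℝ)| ≤ |(y₂ : ℝ)| := by exact_mod_cast hy
  have hsq : ∀ (x y : ℤ), 1 ≤ |(y : ℝ)| → |(x : ℝ) - θ * y| * |(y : ℝ)| ^ (n - 1) ≤ η →
      |(x : ℝ) - θ * y| * |(y : ℝ)| ^ 2 ≤ η := fun x y hy h =>
    (mul_le_mul_of_nonneg_left (pow_le_pow_right₀ hy (by omega)) (abs_nonneg _)).trans h
  have h3 := hsq _ _ h1 h₁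
  have h4 := hsq _ _ (h1.trans h12) h₂
  have h5 : (1 : ℝ) ≤ |(x₁ * y₂ - x₂ * y₁ : ℝ)| := by
    exact_mod_cast Int.one_le_abs (sub_ne_zero.2 hne)
  have h6 : |(x₁ * y₂ - x₂ * y₁ : ℝ)| ≤
      |(x₁ : ℝ) - θ * y₁| * |(y₂ : ℝ)| + |(x₂ : ℝ) - θ * y₂| * |(y₁ : ℝ)| := by
    rw [← abs_mul, ← abs_mul]
    refine le_trans (le_of_eq ?_) (abs_sub _ _)
    congr 1; ring
  set a := |(y₁ : ℝ)|
  set b := |(y₂ : ℝ)|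
  set u := |(x₁ : ℝ) - θ * y₁|
  set v := |(x₂ : ℝ) - θ * y₂|
  have hu : 0 ≤ u := abs_nonneg _
  have hv : 0 ≤ v := abs_nonneg _
  have h7 : v * a ^ 2 ≤ η :=
    (mul_le_mul_of_nonneg_left (pow_le_pow_left₀ (by linarith) h12 2) hv).trans h4
  have h8 : 1 * a ^ 2 ≤ (u * b + v * a) * a ^ 2 := by
    gcongr
    linarith
  have h9 : u * a ^ 2 * b ≤ η * b := by gcongr
  have h10 : v * a ^ 2 * a ≤ η * b := mul_le_mul h7 h12 (by linarith) hη
  linarith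

/-- A Thue inequality for forms close to `x ^ n ± y ^ n`: the number of solutions of
`F(x, y) = N` is bounded in terms of the degree only, once the coefficients are large. -/
theorem NearDiagonal.exists_card_le {n : ℕ} (hn : 3 ≤ n) {ε : ℝ} (hε : 0 ≤ ε)
    (hε' : ε * (n ^ 2 * 2 ^ n) ≤ 1 / 8) {N : ℤ} (hN : N ≠ 0) :
    ∃ R₀ : ℝ, ∀ R ≥ R₀, ∀ (c : Fin (n + 1) → ℤ) (σ : ℝ), |σ| = 1 → (Odd n → σ = 1) →
      NearDiagonal c R ε σ → ∀ T : Finset (ℤ × ℤ), (∀ p ∈ T, binEval c p.1 p.2 = N) →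
        T.card ≤ 1200 * n + 39 * n ^ 2 + 1 := by
  set B : ℝ := 2 ^ (n + 2) * |(N : ℝ)| with hB
  have hN1 : (1 : ℝ) ≤ |(N : ℝ)| := by exact_mod_cast Int.one_le_abs hN
  have hB4 : 4 * |(N : ℝ)| ≤ B := by
    have : (4 : ℝ) ≤ 2 ^ (n + 2) := by
      calc (4 : ℝ) = 2 ^ 2 := by norm_num
        _ ≤ _ := pow_le_pow_right₀ (by norm_num) (by omega)
    rw [hB]; gcongr
  have hB1 : 4 ≤ B := by linarith
  refine ⟨6144 * B ^ 2, fun R hR c σ hσ hσ1 hc T hT => ?_⟩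
  have hRB : 4 * B ≤ R := by nlinarith
  have hR0 : 0 < R := by linarith
  have hε3 := (NearDiagonal.small_bounds hn hε hε').2.2
  have hTR : ∀ p ∈ T, binEval (fun i => (c i : ℝ)) p.1 p.2 = N := fun p hp => by
    rw [← intCast_binEval, hT p hp]
  rcases Nat.even_or_odd n with heven | hodd
  · have : T = ∅ := by
      refine Finset.eq_empty_of_forall_notMem fun p hp => ?_
      have h1 := hc.le_abs_binEval hn heven hR0 hσ hε hε' p.1 p.2
      rw [hTR p hp] at h1
      have h2 : (1 : ℝ) ≤ max |(p.1 : ℝ)| |(p.2 : ℝ)| := by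
        rw [le_max_iff]
        by_contra! h3
        have h4 : p.1 = 0 := by
          have : |p.1| < 1 := by exact_mod_cast h3.1
          exact Int.abs_lt_one_iff.1 this
        have h5 : p.2 = 0 := by
          have : |p.2| < 1 := by exact_mod_cast h3.2
          exact Int.abs_lt_one_iff.1 this
        have h6 := hT p hp
        have h7 := binEval_smul c 0 0 0
        rw [mul_zero, zero_pow (by omega), zero_mul] at h7
        rw [h4, h5, h7] at h6
        exact hN h6.symm
      have h3 : R / 2 * 1 ≤ R / 2 * max |(p.1 : ℝ)| |(p.2 : ℝ)| ^ n := by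
        gcongr
        exact one_le_pow₀ h2
      linarith
    simp [this]
  obtain rfl := hσ1 hodd
  obtain ⟨θ, hθ1, hθ2, hθ0⟩ := hc.exists_real_root hn hodd hR0 hε hε'
  have hc0 := hc.first_ne_zero hR0 hσ (by linarith)
  have hc0R := (NearDiagonal.abs_ge hR0.le hσ hc.first).1
  set η : ℝ := B / (2 * R) with hη
  have hη0 : 0 ≤ η := by positivity
  have hη1 : η ≤ 1 := by
    rw [hη, div_le_one (by linarith)]
    linarith
  have happ : ∀ p ∈ T, |(p.1 : ℝ) - θ * p.2| * |(p.2 : ℝ)| ^ (n - 1) ≤ η := fun p hp => by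
    have h1 := hc.mul_abs_sub_le hn hodd hR0 hε hε' hθ2 hθ0 p.1 p.2
    rw [hTR p hp] at h1
    rw [hη, le_div_iff₀ (by linarith), hB]
    calc _ = 2 * (R * |(p.1 : ℝ) - θ * p.2| * |(p.2 : ℝ)| ^ (n - 1)) := by ring
      _ ≤ 2 * (2 ^ (n + 1) * |(N : ℝ)|) := by gcongr
      _ = _ := by ring
  have hy : ∀ p ∈ T, p.2 ≠ 0 := fun p hp h0 => by
    have h1 := hTR p hp
    rw [h0, binEval, Finset.sum_eq_single 0 (fun i _ hi => by
      rw [Int.cast_zero, zero_pow (fun h => hi (Fin.ext h)), mul_zero]) (by simp)] at h1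
    simp only [Fin.val_zero, Nat.sub_zero, pow_zero, mul_one] at h1
    have h2 : p.1 ≠ 0 := by
      intro h3
      rw [h3, Int.cast_zero, zero_pow (by omega), mul_zero] at h1
      exact hN (by exact_mod_cast h1.symm)
    have h3 : (1 : ℝ) ≤ |(p.1 : ℝ)| ^ n := one_le_pow₀ (by exact_mod_cast Int.one_le_abs h2)
    have h4 : |(c 0 : ℝ)| * |(p.1 : ℝ)| ^ n = |(N : ℝ)| := by rw [← h1, abs_mul, abs_pow]
    nlinarith [abs_nonneg (c 0 : ℝ)]
  have hprop : ∀ p ∈ T, ∀ q ∈ T, p.1 * q.2 = q.1 * p.2 → p = q := fun p hp q hq h => by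
    have h1 := binEval_smul c q.2 p.1 p.2
    have h2 := binEval_smul c p.2 q.1 q.2
    rw [hT p hp] at h1
    rw [hT q hq, mul_comm p.2 q.1, ← h, mul_comm p.1, mul_comm p.2, h1] at h2
    have h3 : q.2 = p.2 := hodd.strictMono_pow.injective (mul_right_cancel₀ hN h2)
    rw [h3] at h
    exact Prod.ext (mul_right_cancel₀ (hy p hp) h) h3.symm
  have hgap : ∀ p ∈ T, ∀ q ∈ T, p ≠ q → |p.2| ≤ |q.2| → R / B * |(p.2 : ℝ)| ^ 2 ≤ |(q.2 : ℝ)| := by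
    intro p hp q hq hpq hle
    have h1 := sq_le_mul_of_abs_sub_le hn hη0 (hy p hp) hle (fun h => hpq (hprop p hp q hq h))
      (happ p hp) (happ q hq)
    rw [div_mul_eq_mul_div, div_le_iff₀ (by linarith)]
    calc R * |(p.2 : ℝ)| ^ 2 ≤ R * (2 * η * |(q.2 : ℝ)|) := by gcongr
      _ = _ := by rw [hη]; field_simp
  have hRB4 : 4 ≤ R / B := by rw [le_div_iff₀ (by linarith)]; linarith
  set A : Finset ℕ := T.image (fun p => p.2.natAbs) with hA
  have hcast : ∀ z : ℤ, ((z.natAbs : ℕ) : ℝ) = |(z : ℝ)| := fun z => by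
    rw [Nat.cast_natAbs, Int.cast_abs]
  have hcardA : A.card = T.card := by
    refine Finset.card_image_of_injOn fun p hp q hq hpq => ?_
    by_contra hne
    have h1 := hgap p hp q hq hne (by rw [Int.abs_eq_natAbs, Int.abs_eq_natAbs, hpq])
    rw [← hcast, ← hcast, ← hpq, hcast] at h1
    have h2 : (1 : ℝ) ≤ |(p.2 : ℝ)| := by exact_mod_cast Int.one_le_abs (hy p hp)
    nlinarith
  set r : ℕ := ⌊R / B⌋₊ with hr
  have hr4 : 4 ≤ r := Nat.le_floor (by exact_mod_cast hRB4)
  have hrle : (r : ℝ) ≤ R / B := Nat.floor_le (by linarith)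
  have hrlt : R / B < r + 1 := Nat.lt_floor_add_one _
  rw [← hcardA]
  refine Finset.card_le_of_gap (r := r) (by omega) ?_ ?_ ?_
  · intro a ha
    obtain ⟨p, hp, rfl⟩ := Finset.mem_image.1 ha
    exact Int.natAbs_pos.2 (hy p hp)
  · intro a ha b hb hab
    obtain ⟨p, hp, rfl⟩ := Finset.mem_image.1 ha
    obtain ⟨q, hq, rfl⟩ := Finset.mem_image.1 hb
    have h1 := hgap p hp q hq (by rintro rfl; exact hab.ne rfl)
      (by rw [Int.abs_eq_natAbs, Int.abs_eq_natAbs]; exact_mod_cast hab.le)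
    rw [← hcast, ← hcast] at h1
    have h2 : (r : ℝ) * (p.2.natAbs : ℝ) ^ 2 ≤ q.2.natAbs := le_trans (by gcongr) h1
    exact_mod_cast h2
  · intro a ha b hb hab
    obtain ⟨p, hp, rfl⟩ := Finset.mem_image.1 ha
    obtain ⟨q, hq, rfl⟩ := Finset.mem_image.1 hb
    set H : ℕ := ⌊2 * R⌋₊ with hH
    have hHr : 768 * H ≤ r ^ 2 := by
      have h1 : (H : ℝ) ≤ 2 * R := Nat.floor_le (by linarith)
      have h2 : R / B / 2 ≤ r := by linarith
      have h3 : (R / B / 2) ^ 2 ≤ (r : ℝ) ^ 2 := by gcongr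
      have h4 : 1536 * R ≤ (R / B / 2) ^ 2 := by
        rw [div_div, div_pow, le_div_iff₀ (by positivity)]
        nlinarith
      have h5 : (768 * H : ℝ) ≤ (r : ℝ) ^ 2 := by linarith
      exact_mod_cast h5
    have hdiv : ∀ s ∈ T, |(s.1 : ℝ) / s.2 - θ| * |(s.2 : ℝ)| ^ n ≤ 1 := fun s hs => by
      have h0 : (s.2 : ℝ) ≠ 0 := by exact_mod_cast hy s hs
      refine le_trans (le_of_eq ?_) ((happ s hs).trans hη1)
      rw [← pow_sub_one_mul (by omega : n ≠ 0), mul_comm (_ ^ (n - 1)), ← mul_assoc, ← abs_mul,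
        sub_mul, div_mul_cancel₀ _ h0]
    refine thue_principle (f := formPolyX ℤ c) (n := n) (H := H) hn (natDegree_formPolyX hc0)
      (Nat.le_floor (by push_cast; linarith)) ?_ (hc.card_roots hn hR0 hσ hε hε') ?_ (θ := θ)
      ?_ ?_ (x₁ := p.1) (x₂ := q.1) ?_ (hy p hp) (hy q hq) (hdiv p hp) (hdiv q hq) ?_
    · intro i
      rcases lt_or_ge n i with hi | hi
      · rw [coeff_eq_zero_of_natDegree_lt ((natDegree_formPolyX_le c).trans_lt hi)]
        simp
      · have h1 := coeff_formPolyX (R := ℤ) c ⟨n - i, by omega⟩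
        simp only [Nat.sub_sub_self hi] at h1
        rw [h1, Int.cast_id, Int.abs_eq_natAbs]
        refine Int.ofNat_le.2 (Nat.le_floor ?_)
        rw [hcast]
        exact hc.abs_coeff_le hR0.le (by linarith) hσ _
    · intro z hz
      rw [aeval_formPolyX, ← eval_formPolyX]
      exact (mem_roots'.1 (Multiset.mem_toFinset.1 hz)).2
    · rw [aeval_formPolyX, hθ0]
    · rw [abs_le]; constructor <;> linarith
    · rw [aeval_formPolyX]
      intro h0
      have h1 := binEval_eq_pow_mul (fun i => (c i : ℝ)) (p.1 : ℝ) (y := p.2)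
        (by exact_mod_cast hy p hp)
      rw [h0, mul_zero, hTR p hp] at h1
      exact hN (by exact_mod_cast h1)
    · refine lt_of_le_of_lt ?_ hab
      calc (768 * H) ^ (600 * n) ≤ (r ^ 2) ^ (600 * n) := Nat.pow_le_pow_left hHr _
        _ = _ := by rw [← pow_mul]; congr 1; ring

end SolutionCount

/-! ### Counting pairs in a box divisible by a large prime -/

section PairSieve

theorem Nat.eq_of_modEq_of_div_eq {q u v : ℕ} (h : u ≡ v [MOD q]) (hd : u / q = v / q) : u = v := by
  rw [← Nat.div_add_mod u q, ← Nat.div_add_mod v q, hd, h]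

theorem Nat.modEq_of_dvd_linear {q : ℕ} (hq : q.Prime) {α β : ℤ} (hα : ¬ (q : ℤ) ∣ α) {u v : ℕ}
    (hu : (q : ℤ) ∣ α * u + β) (hv : (q : ℤ) ∣ α * v + β) : u ≡ v [MOD q] := by
  have h1 : (q : ℤ) ∣ α * (v - u) := by
    have := _root_.dvd_sub hv hu
    rwa [show α * v + β - (α * u + β) = α * ((v : ℤ) - u) by ring] at this
  have h2 := ((Nat.prime_iff_prime_int.1 hq).dvd_or_dvd h1).resolve_left hα
  exact (Nat.modEq_iff_dvd).2 h2

/-- A nonzero integer has few large prime divisors. -/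
theorem Int.card_large_prime_divisors_le {N K : ℕ} (hN : 1 ≤ N) {A : ℤ} (hA : A ≠ 0)
    (hAN : |A| < (N : ℤ) ^ (K + 1)) (Q : Finset ℕ)
    (hQ : ∀ q ∈ Q, q.Prime ∧ N < q ∧ (q : ℤ) ∣ A) : Q.card ≤ K := by
  have h1 : (∏ q ∈ Q, q) ∣ A.natAbs :=
    Finset.prod_primes_dvd _ (fun q hq => (hQ q hq).1.prime)
      fun q hq => Int.natCast_dvd.1 (hQ q hq).2.2
  have h2 : ∏ q ∈ Q, q ≤ A.natAbs := Nat.le_of_dvd (Int.natAbs_pos.2 hA) h1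
  have h3 : N ^ Q.card ≤ ∏ q ∈ Q, q := by
    rw [← Finset.prod_const]
    exact Finset.prod_le_prod' fun q hq => (hQ q hq).2.1.le
  have h4 : A.natAbs < N ^ (K + 1) := by
    rw [Int.abs_eq_natAbs] at hAN
    exact_mod_cast hAN
  by_contra! h
  have h5 : N ^ (K + 1) ≤ N ^ Q.card := Nat.pow_le_pow_right hN h
  omega

theorem card_pairs_dvd_small_prime_le {N q : ℕ} (hq : q.Prime) {α β γ : ℤ} {δ : ℕ → ℤ}
    (hα : ¬ (q : ℤ) ∣ α) (hγ : ¬ (q : ℤ) ∣ γ) (S : Finset (ℕ × ℕ))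
    (hS : ∀ p ∈ S, p.1 < N ∧ p.2 < N ∧ (q : ℤ) ∣ α * p.1 + β ∧ (q : ℤ) ∣ γ * p.2 + δ p.1) :
    S.card ≤ (N / q + 1) ^ 2 := by
  have h1 : S.card ≤ (range (N / q + 1) ×ˢ range (N / q + 1)).card := by
    refine Finset.card_le_card_of_injOn (fun p => (p.1 / q, p.2 / q)) ?_ ?_
    · intro p hp
      obtain ⟨h1, h2, -⟩ := hS p hp
      simp only [coe_product, coe_range, Set.mem_prod, Set.mem_Iio, Nat.lt_succ_iff]
      exact ⟨Nat.div_le_div_right h1.le, Nat.div_le_div_right h2.le⟩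
    · intro p hp p' hp' h
      obtain ⟨-, -, h1, h2⟩ := hS p hp
      obtain ⟨-, -, h1', h2'⟩ := hS p' hp'
      rw [Prod.mk.injEq] at h
      have h3 : p.1 = p'.1 := Nat.eq_of_modEq_of_div_eq (Nat.modEq_of_dvd_linear hq hα h1 h1') h.1
      rw [← h3] at h2'
      exact Prod.ext h3 (Nat.eq_of_modEq_of_div_eq (Nat.modEq_of_dvd_linear hq hγ h2 h2') h.2)
  rwa [card_product, card_range, ← sq] at h1

theorem card_pairs_dvd_large_prime_le {N K : ℕ} (hN : 1 ≤ N) {α β γ : ℤ} {δ : ℕ → ℤ}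
    (hA : ∀ u < N, |α * u + β| < (N : ℤ) ^ (K + 1)) (S : Finset (ℕ × ℕ))
    (hS : ∀ p ∈ S, p.1 < N ∧ p.2 < N ∧ ∃ q : ℕ, q.Prime ∧ N < q ∧ ¬ (q : ℤ) ∣ α ∧ ¬ (q : ℤ) ∣ γ ∧
      (q : ℤ) ∣ α * p.1 + β ∧ (q : ℤ) ∣ γ * p.2 + δ p.1) :
    S.card ≤ (K + 1) * N := by
  classical
  rw [← Finset.card_filter_add_card_filter_not (s := S) (fun p => α * (p.1 : ℤ) + β = 0)]
  have hzero : #{p ∈ S | α * (p.1 : ℤ) + β = 0} ≤ N := by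
    rw [← card_range N]
    refine Finset.card_le_card_of_injOn (fun p => p.2) ?_ ?_
    · intro p hp
      simpa using (hS p (mem_filter.1 hp).1).2.1
    · intro p hp p' hp' h
      obtain ⟨hp, h1⟩ := mem_filter.1 hp
      obtain ⟨hp', h1'⟩ := mem_filter.1 hp'
      obtain ⟨-, -, q, -, -, hα, -⟩ := hS p hp
      have hα0 : α ≠ 0 := by rintro rfl; exact hα (dvd_zero _)
      have h2 : α * (p.1 : ℤ) = α * p'.1 := by linarith
      exact Prod.ext (by exact_mod_cast mul_left_cancel₀ hα0 h2) h
  have hnonzero : #{p ∈ S | ¬ α * (p.1 : ℤ) + β = 0} ≤ N * K := by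
    have hch : ∀ p : ℕ × ℕ, ∃ q : ℕ, p ∈ S → q.Prime ∧ N < q ∧ ¬ (q : ℤ) ∣ α ∧ ¬ (q : ℤ) ∣ γ ∧
        (q : ℤ) ∣ α * p.1 + β ∧ (q : ℤ) ∣ γ * p.2 + δ p.1 := fun p => by
      by_cases hp : p ∈ S
      · obtain ⟨-, -, q, hq⟩ := hS p hp
        exact ⟨q, fun _ => hq⟩
      · exact ⟨0, fun h => absurd h hp⟩
    choose Q hQ using hch
    set S' := {p ∈ S | ¬ α * (p.1 : ℤ) + β = 0} with hS'
    set T : Finset (ℕ × ℕ) := S'.image fun p => (p.1, Q p) with hT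
    have h1 : T.card = S'.card := by
      refine Finset.card_image_of_injOn fun p hp p' hp' h => ?_
      rw [Prod.mk.injEq] at h
      have hp := (mem_filter.1 hp).1
      have hp' := (mem_filter.1 hp').1
      obtain ⟨hq, hNq, -, hγ, -, h2⟩ := hQ p hp
      obtain ⟨-, -, -, -, -, h2'⟩ := hQ p' hp'
      rw [← h.1, ← h.2] at h2'
      refine Prod.ext h.1 ?_
      exact (Nat.modEq_of_dvd_linear hq hγ h2 h2').eq_of_lt_of_lt
        ((hS p hp).2.1.trans hNq) ((hS p' hp').2.1.trans hNq)
    rw [← h1]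
    have h2 : T.card ≤ K * (range N).card := by
      refine Finset.card_le_mul_card_image_of_maps_to (f := Prod.fst) ?_ K ?_
      · intro x hx
        obtain ⟨p, hp, rfl⟩ := mem_image.1 hx
        exact mem_range.2 (hS p (mem_filter.1 hp).1).1
      · intro u hu
        by_cases h0 : α * (u : ℤ) + β = 0
        · have : {x ∈ T | x.1 = u} = ∅ := by
            refine Finset.eq_empty_of_forall_notMem fun x hx => ?_
            obtain ⟨hxT, rfl⟩ := mem_filter.1 hx
            obtain ⟨p, hp, rfl⟩ := mem_image.1 hxT
            exact (mem_filter.1 hp).2 h0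
          simp [this]
        · have h3 : #{x ∈ T | x.1 = u} = #({x ∈ T | x.1 = u}.image Prod.snd) := by
            refine (Finset.card_image_of_injOn fun x hx y hy h => ?_).symm
            exact Prod.ext ((mem_filter.1 hx).2.trans (mem_filter.1 hy).2.symm) h
          rw [h3]
          refine Int.card_large_prime_divisors_le hN h0 (hA u (mem_range.1 hu)) _ fun q hq => ?_
          obtain ⟨x, hx, rfl⟩ := mem_image.1 hq
          obtain ⟨hxT, rfl⟩ := mem_filter.1 hx
          obtain ⟨p, hp, rfl⟩ := mem_image.1 hxT
          obtain ⟨h4, h5, -, -, h6, -⟩ := hQ p (mem_filter.1 hp).1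
          exact ⟨h4, h5, h6⟩
    rwa [card_range, mul_comm] at h2
  linarith

theorem card_pairs_dvd_prime_mul_le {N M K : ℕ} (hM : 1 ≤ M) (hN : (K + 1) * M ≤ N) {α β γ : ℤ}
    {δ : ℕ → ℤ} (hA : ∀ u < N, |α * u + β| < (N : ℤ) ^ (K + 1)) (S : Finset (ℕ × ℕ))
    (hS : ∀ p ∈ S, p.1 < N ∧ p.2 < N ∧ ∃ q : ℕ, q.Prime ∧ M < q ∧ ¬ (q : ℤ) ∣ α ∧ ¬ (q : ℤ) ∣ γ ∧
      (q : ℤ) ∣ α * p.1 + β ∧ (q : ℤ) ∣ γ * p.2 + δ p.1) :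
    S.card * M ≤ 5 * N ^ 2 := by
  classical
  have hMN : M ≤ N := le_trans (Nat.le_mul_of_pos_left M (Nat.succ_pos K)) hN
  let G : ℕ → ℕ × ℕ → Prop := fun q p => q.Prime ∧ ¬ (q : ℤ) ∣ α ∧ ¬ (q : ℤ) ∣ γ ∧
    (q : ℤ) ∣ α * p.1 + β ∧ (q : ℤ) ∣ γ * p.2 + δ p.1
  set S₁ := (Ioc M N).biUnion fun q => {p ∈ S | G q p} with hS₁
  set S₂ := {p ∈ S | ∃ q, N < q ∧ G q p} with hS₂
  have hsub : S ⊆ S₁ ∪ S₂ := by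
    intro p hp
    obtain ⟨-, -, q, h1, h2, h3⟩ := hS p hp
    rw [mem_union]
    rcases le_or_gt q N with h | h
    · exact Or.inl (mem_biUnion.2 ⟨q, mem_Ioc.2 ⟨h2, h⟩, mem_filter.2 ⟨hp, h1, h3⟩⟩)
    · exact Or.inr (mem_filter.2 ⟨hp, q, h, h1, h3⟩)
  have hc2 : S₂.card ≤ (K + 1) * N := by
    refine card_pairs_dvd_large_prime_le (γ := γ) (δ := δ) (by omega) hA S₂ fun p hp => ?_
    obtain ⟨hp, q, h1, h2, h3⟩ := mem_filter.1 hp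
    exact ⟨(hS p hp).1, (hS p hp).2.1, q, h2, h1, h3⟩
  have hc1 : (S₁.card : ℝ) * M ≤ 4 * N ^ 2 := by
    have hMpos : (0 : ℝ) < M := by exact_mod_cast hM
    have h1 : (S₁.card : ℝ) ≤ ∑ q ∈ Ioc M N, 4 * (N : ℝ) ^ 2 * ((q : ℝ) ^ 2)⁻¹ := by
      have : S₁.card ≤ ∑ q ∈ Ioc M N, #{p ∈ S | G q p} := card_biUnion_le
      refine (Nat.cast_le.2 this).trans ?_
      rw [Nat.cast_sum]
      refine Finset.sum_le_sum fun q hq => ?_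
      rw [mem_Ioc] at hq
      have hq0 : (0 : ℝ) < q := by exact_mod_cast (by omega : 0 < q)
      have hle : #{p ∈ S | G q p} ≤ (N / q + 1) ^ 2 := by
        rcases Finset.eq_empty_or_nonempty {p ∈ S | G q p} with h | ⟨p₀, hp₀⟩
        · simp [h]
        · obtain ⟨-, h2, h3, h4, -⟩ := mem_filter.1 hp₀
          refine card_pairs_dvd_small_prime_le (β := β) (δ := δ) h2 h3 h4 _ fun p hp => ?_
          obtain ⟨hp, -, -, -, h5⟩ := mem_filter.1 hp
          exact ⟨(hS p hp).1, (hS p hp).2.1, h5⟩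
      have hr : ((N / q + 1 : ℕ) : ℝ) ≤ 2 * (N / q) := by
        push_cast
        have h2 : ((N / q : ℕ) : ℝ) ≤ N / q := Nat.cast_div_le
        have h3 : (1 : ℝ) ≤ N / q := by
          rw [le_div_iff₀ hq0, one_mul]
          exact_mod_cast hq.2
        linarith
      calc (#{p ∈ S | G q p} : ℝ) ≤ ((N / q + 1 : ℕ) : ℝ) ^ 2 := by exact_mod_cast hle
        _ ≤ (2 * (N / q)) ^ 2 := by gcongr
        _ = _ := by field_simp; ring
    have h2 : ∑ q ∈ Ioc M N, 4 * (N : ℝ) ^ 2 * ((q : ℝ) ^ 2)⁻¹ ≤ 4 * (N : ℝ) ^ 2 * (M : ℝ)⁻¹ := by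
      rw [← Finset.mul_sum]
      gcongr
      refine (sum_Ioc_inv_sq_le_sub (by omega) hMN).trans ?_
      have : (0 : ℝ) ≤ (N : ℝ)⁻¹ := by positivity
      linarith
    calc (S₁.card : ℝ) * M ≤ 4 * (N : ℝ) ^ 2 * (M : ℝ)⁻¹ * M := by gcongr; exact h1.trans h2
      _ = _ := by field_simp
  have hc1' : S₁.card * M ≤ 4 * N ^ 2 := by exact_mod_cast hc1
  calc S.card * M ≤ (S₁.card + S₂.card) * M := by
        gcongr
        exact (card_le_card hsub).trans (card_union_le _ _)
    _ ≤ 4 * N ^ 2 + (K + 1) * N * M := by rw [add_mul]; gcongr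
    _ = 4 * N ^ 2 + (K + 1) * M * N := by ring
    _ ≤ 4 * N ^ 2 + N * N := by gcongr
    _ = _ := by ring

end PairSieve

/-! ### Congruence conditions for forms without simple roots -/

section SquareQuotient

open PowerSeries

variable {R S : Type*} [CommRing R] [CommRing S]

/-- The power series `u` with `g (a₀ X) = a₀ u` for `g = ∑ aᵢ Xⁱ`. -/
noncomputable def unitSeries (a : ℕ → R) : R⟦X⟧ :=
  PowerSeries.mk fun i => if i = 0 then 1 else a i * a 0 ^ (i - 1)

/-- The power series `n u - X u'` for `u = unitSeries a`. -/
noncomputable def eulerSeries (n : ℕ) (a : ℕ → R) : R⟦X⟧ :=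
  PowerSeries.mk fun i => ((n : R) - i) * coeff i (unitSeries a)

/-- The power series `(n u - X u') ^ 2 / u` for `u = unitSeries a`. -/
noncomputable def quotSeries (n : ℕ) (a : ℕ → R) : R⟦X⟧ :=
  eulerSeries n a ^ 2 * invOfUnit (unitSeries a) 1

theorem coeff_unitSeries_zero (a : ℕ → R) : coeff 0 (unitSeries a) = 1 := by
  simp [unitSeries]

theorem coeff_unitSeries {i : ℕ} (hi : i ≠ 0) (a : ℕ → R) :
    coeff i (unitSeries a) = a i * a 0 ^ (i - 1) := by
  simp [unitSeries, hi]

theorem coeff_eulerSeries (n i : ℕ) (a : ℕ → R) :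
    coeff i (eulerSeries n a) = ((n : R) - i) * coeff i (unitSeries a) := by
  simp [eulerSeries]

theorem unitSeries_mul_inv (a : ℕ → R) : unitSeries a * invOfUnit (unitSeries a) 1 = 1 :=
  mul_invOfUnit _ _ (by rw [← coeff_zero_eq_constantCoeff_apply, coeff_unitSeries_zero]; rfl)

theorem quotSeries_mul (n : ℕ) (a : ℕ → R) :
    quotSeries n a * unitSeries a = eulerSeries n a ^ 2 := by
  rw [quotSeries, mul_assoc, mul_comm (invOfUnit _ _), unitSeries_mul_inv, mul_one]

theorem eq_quotSeries {n : ℕ} {a : ℕ → R} {P : R⟦X⟧} (h : P * unitSeries a = eulerSeries n a ^ 2) :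
    P = quotSeries n a := by
  rw [quotSeries, ← h, mul_assoc, unitSeries_mul_inv, mul_one]

theorem map_quotSeries (φ : R →+* S) (n : ℕ) (a : ℕ → R) :
    PowerSeries.map φ (quotSeries n a) = quotSeries n fun i => φ (a i) := by
  have hu : PowerSeries.map φ (unitSeries a) = unitSeries fun i => φ (a i) := by
    ext i
    rcases eq_or_ne i 0 with rfl | hi
    · rw [PowerSeries.coeff_map, coeff_unitSeries_zero, coeff_unitSeries_zero, map_one]
    · rw [PowerSeries.coeff_map, coeff_unitSeries hi, coeff_unitSeries hi, map_mul, map_pow]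
  refine eq_quotSeries ?_
  rw [← hu, ← map_mul, quotSeries_mul, map_pow]
  congr 1
  ext i
  rw [PowerSeries.coeff_map, coeff_eulerSeries, coeff_eulerSeries, ← hu, PowerSeries.coeff_map]
  simp

theorem coeff_quotSeries_sub (n : ℕ) {k : ℕ} (hk : 1 ≤ k) {a b : ℕ → R}
    (hab : ∀ i < k, a i = b i) :
    coeff k (quotSeries n a) - coeff k (quotSeries n b) =
      n * (n - 2 * k) * a 0 ^ (k - 1) * (a k - b k) := by
  have hu0 : ∀ i < k, coeff i (unitSeries a) = coeff i (unitSeries b) := by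
    intro i hi
    rcases eq_or_ne i 0 with rfl | hi0
    · rw [coeff_unitSeries_zero, coeff_unitSeries_zero]
    · rw [coeff_unitSeries hi0, coeff_unitSeries hi0, hab i hi, hab 0 (by omega)]
  have huk : coeff k (unitSeries a) - coeff k (unitSeries b) = a 0 ^ (k - 1) * (a k - b k) := by
    rw [coeff_unitSeries (by omega), coeff_unitSeries (by omega), hab 0 (by omega)]
    ring
  obtain ⟨e, he⟩ : (X : R⟦X⟧) ^ k ∣ unitSeries a - unitSeries b :=
    X_pow_dvd_iff.2 fun i hi => by rw [map_sub, hu0 i hi, sub_self]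
  obtain ⟨f, hf⟩ : (X : R⟦X⟧) ^ k ∣ eulerSeries n a - eulerSeries n b :=
    X_pow_dvd_iff.2 fun i hi => by
      rw [map_sub, coeff_eulerSeries, coeff_eulerSeries, hu0 i hi, sub_self]
  have hcoeff : ∀ φ : R⟦X⟧, coeff k (X ^ k * φ) = constantCoeff φ := fun φ => by
    have := coeff_X_pow_mul φ k 0
    rwa [zero_add, coeff_zero_eq_constantCoeff_apply] at this
  have he0 : constantCoeff e = a 0 ^ (k - 1) * (a k - b k) := by
    rw [← hcoeff, ← he, map_sub, huk]
  have hf0 : constantCoeff f = (n - k) * (a 0 ^ (k - 1) * (a k - b k)) := by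
    rw [← hcoeff, ← hf, map_sub, coeff_eulerSeries, coeff_eulerSeries, ← mul_sub, huk]
  have hv0 : ∀ d : ℕ → R, constantCoeff (eulerSeries n d) = n := fun d => by
    rw [← coeff_zero_eq_constantCoeff_apply, coeff_eulerSeries, coeff_unitSeries_zero]
    simp
  have hw0 : ∀ d : ℕ → R, constantCoeff (invOfUnit (unitSeries d) 1) = 1 := fun d => by
    rw [constantCoeff_invOfUnit]; simp
  have key : quotSeries n a - quotSeries n b =
      X ^ k * ((f * (eulerSeries n a + eulerSeries n b) - quotSeries n b * e) *
        invOfUnit (unitSeries a) 1) := by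
    have h1 := unitSeries_mul_inv a
    have h2 := quotSeries_mul n a
    have h3 := quotSeries_mul n b
    calc _ = (quotSeries n a * unitSeries a - quotSeries n b * unitSeries b -
          quotSeries n b * (unitSeries a - unitSeries b)) * invOfUnit (unitSeries a) 1 := by
          linear_combination (quotSeries n b - quotSeries n a) * h1
      _ = ((eulerSeries n a - eulerSeries n b) * (eulerSeries n a + eulerSeries n b) -
          quotSeries n b * (unitSeries a - unitSeries b)) * invOfUnit (unitSeries a) 1 := by
          rw [h2, h3]; ring
      _ = _ := by rw [he, hf]; ring
  rw [← map_sub, key, hcoeff]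
  simp only [map_mul, map_sub, map_add, map_pow, hv0, hw0, quotSeries, he0, hf0]
  ring

theorem coeff_quotSeries_eq_zero {K : Type*} [Field K] {n m : ℕ} {g G : Polynomial K}
    (h0 : g.coeff 0 ≠ 0)
    (hG : ((n : Polynomial K) * g - Polynomial.X * Polynomial.derivative g) ^ 2 = g * G)
    (hm : G.natDegree < m) : coeff m (quotSeries n g.coeff) = 0 := by
  set a := g.coeff with ha
  have hu : rescale (a 0) (g : K⟦X⟧) = C (a 0) * unitSeries a := by
    ext i
    rw [coeff_rescale, Polynomial.coeff_coe, coeff_C_mul]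
    rcases eq_or_ne i 0 with rfl | hi
    · rw [coeff_unitSeries_zero]; ring
    · rw [coeff_unitSeries hi, ← pow_sub_one_mul hi]; ring
  have hv : rescale (a 0)
      (((n : Polynomial K) * g - Polynomial.X * Polynomial.derivative g : Polynomial K) : K⟦X⟧) =
      C (a 0) * eulerSeries n a := by
    ext i
    rw [coeff_rescale, Polynomial.coeff_coe, coeff_C_mul, coeff_eulerSeries, Polynomial.coeff_sub,
      ← Polynomial.C_eq_natCast, Polynomial.coeff_C_mul]
    rcases eq_or_ne i 0 with rfl | hi
    · rw [coeff_unitSeries_zero, Polynomial.coeff_X_mul_zero]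
      push_cast
      ring
    · obtain ⟨j, rfl⟩ : ∃ j, i = j + 1 := ⟨i - 1, by omega⟩
      rw [coeff_unitSeries hi, Polynomial.coeff_X_mul, Polynomial.coeff_derivative,
        Nat.add_sub_cancel, ← ha]
      push_cast
      ring
  have hP : C (a 0)⁻¹ * rescale (a 0) (G : K⟦X⟧) = quotSeries n a := by
    refine eq_quotSeries ?_
    have h1 := congrArg (fun p : Polynomial K => rescale (a 0) (p : K⟦X⟧)) hG
    simp only [Polynomial.coe_pow, Polynomial.coe_mul, map_pow, map_mul, hu, hv] at h1
    have h2 : C (a 0)⁻¹ * C (a 0) = (1 : K⟦X⟧) := by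
      rw [← map_mul, inv_mul_cancel₀ h0, map_one]
    have h3 : C (a 0)⁻¹ ^ 2 * (C (a 0) * eulerSeries n a) ^ 2 = eulerSeries n a ^ 2 := by
      rw [mul_pow, ← mul_assoc, ← mul_pow, h2]; ring
    rw [← h3, h1]
    linear_combination (-(C (a 0)⁻¹ * rescale (a 0) (G : K⟦X⟧) * unitSeries a)) * h2
  rw [← hP, coeff_C_mul, coeff_rescale, Polynomial.coeff_coe,
    Polynomial.coeff_eq_zero_of_natDegree_lt hm, mul_zero, mul_zero]

theorem abs_coeff_mul_le {φ ψ : ℤ⟦X⟧} {k : ℕ} {A B Z : ℤ} (hA : 0 ≤ A)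
    (hZ : 0 ≤ Z) (hφ : ∀ i ≤ k, |coeff i φ| ≤ A * Z ^ i) (hψ : ∀ i ≤ k, |coeff i ψ| ≤ B * Z ^ i) :
    |coeff k (φ * ψ)| ≤ (k + 1) * A * B * Z ^ k := by
  rw [PowerSeries.coeff_mul]
  refine (Finset.abs_sum_le_sum_abs _ _).trans ?_
  have h1 : ∀ p ∈ antidiagonal k, |coeff p.1 φ * coeff p.2 ψ| ≤ A * B * Z ^ k := by
    intro p hp
    rw [HasAntidiagonal.mem_antidiagonal] at hp
    rw [abs_mul]
    calc _ ≤ A * Z ^ p.1 * (B * Z ^ p.2) :=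
          mul_le_mul (hφ _ (by omega)) (hψ _ (by omega)) (abs_nonneg _) (by positivity)
      _ = A * B * (Z ^ p.1 * Z ^ p.2) := by ring
      _ = _ := by rw [← pow_add, hp]
  refine (Finset.sum_le_card_nsmul _ _ _ h1).trans (le_of_eq ?_)
  rw [Nat.card_antidiagonal, nsmul_eq_mul]
  push_cast
  ring

theorem abs_coeff_quotSeries_le {n k : ℕ} (hk : k ≤ n) {a : ℕ → ℤ} {Y : ℤ} (hY : 1 ≤ Y)
    (ha : ∀ i, |a i| ≤ Y) : |coeff k (quotSeries n a)| ≤ (n + 1) ^ 4 * (2 * Y) ^ k := by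
  have hu : ∀ i, |coeff i (unitSeries a)| ≤ Y ^ i := by
    intro i
    rcases eq_or_ne i 0 with rfl | hi
    · rw [coeff_unitSeries_zero]; simp
    · rw [coeff_unitSeries hi, abs_mul, abs_pow, ← mul_pow_sub_one hi Y]
      gcongr
      · exact ha i
      · exact ha 0
  have hw : ∀ i, |coeff i (invOfUnit (unitSeries a) 1)| ≤ 1 * (2 * Y) ^ i := by
    intro i
    rw [one_mul]
    induction i using Nat.strong_induction_on with
    | _ i ih =>
      rcases eq_or_ne i 0 with rfl | hi
      · simp
      obtain ⟨j, rfl⟩ : ∃ j, i = j + 1 := ⟨i - 1, by omega⟩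
      have h1 := congrArg (coeff (j + 1)) (unitSeries_mul_inv a)
      rw [PowerSeries.coeff_mul, Finset.Nat.sum_antidiagonal_succ, coeff_unitSeries_zero, one_mul,
        coeff_one, if_neg hi] at h1
      rw [eq_neg_of_add_eq_zero_left h1, abs_neg, Finset.Nat.sum_antidiagonal_eq_sum_range_succ
        (fun p q => coeff (p + 1) (unitSeries a) * coeff q (invOfUnit (unitSeries a) 1))]
      refine (Finset.abs_sum_le_sum_abs _ _).trans ?_
      calc _ ≤ ∑ p ∈ range j.succ, Y ^ (j + 1) * 2 ^ (j - p) := by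
            refine Finset.sum_le_sum fun p hp => ?_
            rw [mem_range] at hp
            rw [abs_mul]
            calc _ ≤ Y ^ (p + 1) * (2 * Y) ^ (j - p) := by
                  gcongr
                  · exact hu _
                  · exact ih _ (by omega)
              _ = Y ^ (p + 1 + (j - p)) * 2 ^ (j - p) := by rw [mul_pow, pow_add]; ring
              _ = _ := by rw [show p + 1 + (j - p) = j + 1 by omega]
        _ = Y ^ (j + 1) * ∑ p ∈ range (j + 1), 2 ^ p := by
            rw [← Finset.mul_sum, ← Finset.sum_range_reflect (fun p => (2 : ℤ) ^ p) (j + 1)]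
            rfl
        _ ≤ Y ^ (j + 1) * 2 ^ (j + 1) := by
            gcongr
            have h2 := mul_geom_sum (2 : ℤ) (j + 1)
            linarith
        _ = _ := by rw [mul_pow]; ring
  have hv : ∀ i ≤ n, |coeff i (eulerSeries n a)| ≤ n * (2 * Y) ^ i := by
    intro i hi
    rw [coeff_eulerSeries, abs_mul]
    have h1 : |(n : ℤ) - i| ≤ n := by rw [abs_le]; constructor <;> omega
    have h2 : Y ^ i ≤ (2 * Y) ^ i := by gcongr; linarith
    gcongr
    exact (hu i).trans h2
  have hv2 : ∀ i ≤ n, |coeff i (eulerSeries n a ^ 2)| ≤ (n + 1) ^ 3 * (2 * Y) ^ i := by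
    intro i hi
    rw [sq]
    refine (abs_coeff_mul_le (by positivity) (by positivity) (fun j hj => hv j (hj.trans hi))
      (fun j hj => hv j (hj.trans hi))).trans ?_
    gcongr
    have : (i : ℤ) ≤ n := by exact_mod_cast hi
    have hn : (0 : ℤ) ≤ n := by positivity
    calc ((i : ℤ) + 1) * n * n ≤ (n + 1) * (n + 1) * (n + 1) := by gcongr <;> linarith
      _ = _ := by ring
  refine (abs_coeff_mul_le (by positivity) (by positivity) (fun j hj => hv2 j (hj.trans hk))
    (fun j _ => hw j)).trans ?_
  rw [mul_one]
  gcongr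
  have : (k : ℤ) ≤ n := by exact_mod_cast hk
  calc ((k : ℤ) + 1) * (n + 1) ^ 3 ≤ (n + 1) * (n + 1) ^ 3 := by gcongr
    _ = _ := by ring

end SquareQuotient

section SimpleRoot

open Polynomial

variable {n : ℕ}

/-- `F(1, X)` over `R`, for the binary form with integer coefficient vector `c`. -/
noncomputable def formPolyY (R : Type*) [CommRing R] (c : Fin (n + 1) → ℤ) : R[X] :=
  formPolyX R fun i => c (Fin.rev i)

theorem coeff_formPolyY {R : Type*} [CommRing R] (c : Fin (n + 1) → ℤ) (i : Fin (n + 1)) :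
    (formPolyY R c).coeff i = c i := by
  have := coeff_formPolyX (R := R) (fun i => c (Fin.rev i)) (Fin.rev i)
  rw [Fin.rev_rev, Fin.val_rev] at this
  rw [formPolyY, ← this]
  congr 1
  omega

theorem coeff_formPolyY_of_lt {R : Type*} [CommRing R] (c : Fin (n + 1) → ℤ) {i : ℕ} (hi : n < i) :
    (formPolyY R c).coeff i = 0 :=
  coeff_eq_zero_of_natDegree_lt ((natDegree_formPolyX_le _).trans_lt hi)

theorem coeff_formPolyX_zero {R : Type*} [CommRing R] (c : Fin (n + 1) → ℤ) :
    (formPolyX R c).coeff 0 = c (Fin.last n) := by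
  rw [← coeff_formPolyX, Fin.val_last, Nat.sub_self]

theorem coeff_formPolyX_one {R : Type*} [CommRing R] (hn : 1 ≤ n) (c : Fin (n + 1) → ℤ) :
    (formPolyX R c).coeff 1 = c ⟨n - 1, by omega⟩ := by
  rw [← coeff_formPolyX]
  congr 1
  simp only
  omega

theorem hasSimpleRoot_of_coeff {p : ℕ} [Fact p.Prime] {f : (ZMod p)[X]} (h0 : f.coeff 0 = 0)
    (h1 : f.coeff 1 ≠ 0) : HasSimpleRoot f := by
  refine ⟨0, ?_, ?_⟩
  · rw [← map_zero (algebraMap (ZMod p) _), aeval_algebraMap_apply, ← coeff_zero_eq_aeval_zero, h0,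
      map_zero]
  · rw [← map_zero (algebraMap (ZMod p) _), aeval_algebraMap_apply, ← coeff_zero_eq_aeval_zero,
      coeff_derivative]
    simpa using h1

theorem Polynomial.dvd_derivative_sq {K : Type*} [Field K] [IsAlgClosed K] {f : K[X]}
    (h : ∀ z, f.eval z = 0 → (derivative f).eval z = 0) : f ∣ derivative f ^ 2 := by
  classical
  rcases eq_or_ne (derivative f) 0 with h0 | h0
  · rw [h0]; simp
  have hf : f ≠ 0 := by rintro rfl; simp at h0
  refine (IsAlgClosed.splits f).dvd_of_roots_le_roots hf ?_
  rw [roots_pow, Multiset.le_iff_count]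
  intro z
  rw [Multiset.count_nsmul, count_roots, count_roots]
  rcases Nat.eq_zero_or_pos (rootMultiplicity z f) with h1 | h1
  · omega
  have h2 : f.IsRoot z := (rootMultiplicity_pos hf).1 h1
  have h3 := (one_lt_rootMultiplicity_iff_isRoot hf).2 ⟨h2, h z h2⟩
  have h4 := rootMultiplicity_sub_one_le_derivative_rootMultiplicity_of_ne_zero f z h0
  omega

theorem dvd_derivative_sq_of_not_hasSimpleRoot {p : ℕ} [Fact p.Prime] {f : (ZMod p)[X]}
    (h : ¬ HasSimpleRoot f) : f ∣ derivative f ^ 2 := by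
  rw [← map_dvd_map' (algebraMap (ZMod p) (AlgebraicClosure (ZMod p))), Polynomial.map_pow,
    ← derivative_map]
  refine Polynomial.dvd_derivative_sq fun z hz => ?_
  by_contra h1
  rw [derivative_map, eval_map_algebraMap] at h1
  rw [eval_map_algebraMap] at hz
  exact h ⟨z, hz, h1⟩

theorem dvd_of_not_hasSimpleRoot {p : ℕ} [Fact p.Prime] (hn : 3 ≤ n) {c : Fin (n + 1) → ℤ}
    (hX : ¬ HasSimpleRoot (formPolyX (ZMod p) c)) (hY : ¬ HasSimpleRoot (formPolyY (ZMod p) c)) :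
    ((p : ℤ) ∣ c 0 ∧ (p : ℤ) ∣ c ⟨1, by omega⟩) ∨ (¬ (p : ℤ) ∣ c 0 ∧
      (p : ℤ) ∣ PowerSeries.coeff (n - 1) (quotSeries n (formPolyY ℤ c).coeff) ∧
      (p : ℤ) ∣ PowerSeries.coeff n (quotSeries n (formPolyY ℤ c).coeff)) := by
  set g := formPolyY (ZMod p) c with hg
  have hg0 : g.coeff 0 = c 0 := coeff_formPolyY c 0
  by_cases h0 : (p : ℤ) ∣ c 0
  · left
    refine ⟨h0, ?_⟩
    by_contra h1
    refine hY (hasSimpleRoot_of_coeff ?_ ?_)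
    · rw [hg0]; exact (ZMod.intCast_zmod_eq_zero_iff_dvd _ _).2 h0
    · rw [coeff_formPolyY c ⟨1, by omega⟩]
      exact fun h => h1 ((ZMod.intCast_zmod_eq_zero_iff_dvd _ _).1 h)
  right
  refine ⟨h0, ?_⟩
  have hg0' : g.coeff 0 ≠ 0 := by
    rw [hg0]; exact fun h => h0 ((ZMod.intCast_zmod_eq_zero_iff_dvd _ _).1 h)
  have hgne : g ≠ 0 := by
    rintro h
    rw [h] at hg0'
    simp at hg0'
  obtain ⟨e, he⟩ := dvd_derivative_sq_of_not_hasSimpleRoot hY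
  set G := (n : (ZMod p)[X]) ^ 2 * g - 2 * (n : (ZMod p)[X]) * X * derivative g + X ^ 2 * e with hG
  have hGg : ((n : (ZMod p)[X]) * g - X * derivative g) ^ 2 = g * G := by
    linear_combination X ^ 2 * he
  set v := (n : (ZMod p)[X]) * g - X * derivative g with hv
  have hvcoeff : ∀ i, v.coeff i = ((n : ZMod p) - i) * g.coeff i := by
    intro i
    rw [hv, coeff_sub, ← C_eq_natCast, coeff_C_mul]
    rcases eq_or_ne i 0 with rfl | hi
    · rw [coeff_X_mul_zero]; push_cast; ring
    · obtain ⟨j, rfl⟩ : ∃ j, i = j + 1 := ⟨i - 1, by omega⟩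
      rw [coeff_X_mul, coeff_derivative]
      push_cast
      ring
  have hd : g.natDegree ≤ n := natDegree_formPolyX_le _
  have hd1 : g.natDegree ≠ n - 1 := by
    intro hd1
    have h1 : g.coeff n = 0 := coeff_eq_zero_of_natDegree_lt (by omega)
    have h2 : g.coeff (n - 1) ≠ 0 := by
      rw [← hd1]; exact leadingCoeff_ne_zero.2 hgne
    refine hX (hasSimpleRoot_of_coeff ?_ ?_)
    · rw [coeff_formPolyX_zero, ← h1]
      exact (coeff_formPolyY c (Fin.last n)).symm
    · rw [coeff_formPolyX_one (by omega)]
      rwa [hg, coeff_formPolyY c ⟨n - 1, by omega⟩] at h2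
  have hGdeg : G.natDegree ≤ n - 2 := by
    rcases eq_or_ne G 0 with h | hG0
    · rw [h]; simp
    have h1 := congrArg natDegree hGg
    rw [natDegree_mul hgne hG0, natDegree_pow] at h1
    have hvle : ∀ m, (∀ i, m < i → v.coeff i = 0) → v.natDegree ≤ m := fun m hm =>
      natDegree_le_iff_coeff_eq_zero.2 hm
    rcases hd.eq_or_lt with h2 | h2
    · have h3 : v.natDegree ≤ n - 1 := hvle _ fun i hi => by
        rw [hvcoeff]
        rcases eq_or_ne i n with hin | hin
        · rw [hin, sub_self, zero_mul]
        · rw [coeff_eq_zero_of_natDegree_lt (by omega), mul_zero]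
      omega
    · have h3 : v.natDegree ≤ g.natDegree := hvle _ fun i hi => by
        rw [hvcoeff, coeff_eq_zero_of_natDegree_lt hi, mul_zero]
      omega
  have hmap : ∀ m, ((PowerSeries.coeff m (quotSeries n (formPolyY ℤ c).coeff) : ℤ) : ZMod p) =
      PowerSeries.coeff m (quotSeries n g.coeff) := fun m => by
    have h1 := congrArg (PowerSeries.coeff m)
      (map_quotSeries (Int.castRingHom (ZMod p)) n (formPolyY ℤ c).coeff)
    rw [PowerSeries.coeff_map] at h1
    refine h1.trans ?_
    congr 2
    ext i
    rw [hg, formPolyY, formPolyY, ← map_formPolyX (Int.castRingHom (ZMod p)), coeff_map]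
  constructor <;>
  · rw [← ZMod.intCast_zmod_eq_zero_iff_dvd, hmap]
    exact coeff_quotSeries_eq_zero hg0' hGg (by omega)

end SimpleRoot

section BadCount

open Function

variable {n : ℕ}

theorem card_mul_le_of_card_pairs_mul_le {N M L : ℕ} (hN : 0 < N) (B : Finset (Fin (n + 1) → ℕ))
    (hB : ∀ t ∈ B, ∀ k, t k < N) {i j : Fin (n + 1)} (hij : i ≠ j)
    (h : ∀ t : Fin (n + 1) → ℕ, (∀ k, t k < N) →
      #{p ∈ range N ×ˢ range N | update (update t i p.1) j p.2 ∈ B} * M ≤ L) :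
    #B * M ≤ L * N ^ (n - 1) := by
  rcases Nat.eq_zero_or_pos M with rfl | hM
  · simp
  set T := Fintype.piFinset fun k => if k = i ∨ k = j then ({0} : Finset ℕ) else range N with hT
  have hTcard : #T = N ^ (n - 1) := by
    have h1 : ∀ k, #(if k = i ∨ k = j then ({0} : Finset ℕ) else range N) =
        if k ∈ ({i, j} : Finset (Fin (n + 1))) then 1 else N := fun k => by
      simp only [Finset.mem_insert, Finset.mem_singleton]
      split_ifs <;> simp
    rw [hT, Fintype.card_piFinset, prod_congr rfl fun k _ => h1 k, prod_ite, prod_const_one,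
      one_mul, prod_const]
    congr 1
    rw [Finset.filter_not, Finset.filter_mem_eq_inter, Finset.univ_inter,
      ← Finset.compl_eq_univ_sdiff, Finset.card_compl, Finset.card_pair hij, Fintype.card_fin]
    omega
  have hmem : ∀ t, t ∈ T ↔ ∀ k, t k ∈ if k = i ∨ k = j then ({0} : Finset ℕ) else range N :=
    fun t => Fintype.mem_piFinset
  have hcard : #B ≤ L / M * #T := by
    refine Finset.card_le_mul_card_image_of_maps_to
      (f := fun t => update (update t i 0) j 0) ?_ _ ?_
    · intro t ht
      rw [hmem]
      intro k
      by_cases hk : k = i ∨ k = j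
      · rw [if_pos hk, Finset.mem_singleton]
        by_cases hkj : k = j
        · rw [hkj, update_self]
        · rw [update_of_ne hkj, hk.resolve_right hkj, update_self]
      · rw [if_neg hk]
        push Not at hk
        rw [update_of_ne hk.2, update_of_ne hk.1]
        exact Finset.mem_range.2 (hB t ht k)
    · intro s hs
      have hsN : ∀ k, s k < N := by
        intro k
        have := (hmem s).1 hs k
        split_ifs at this
        · rw [Finset.mem_singleton.1 this]; exact hN
        · exact Finset.mem_range.1 this
      refine le_trans ?_ ((Nat.le_div_iff_mul_le hM).2 (h s hsN))
      have key : ∀ t, update (update t i 0) j 0 = s → update (update s i (t i)) j (t j) = t := by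
        rintro t rfl
        ext k
        by_cases hkj : k = j
        · rw [hkj, update_self]
        rw [update_of_ne hkj]
        by_cases hki : k = i
        · rw [hki, update_self]
        rw [update_of_ne hki, update_of_ne hkj, update_of_ne hki]
      refine Finset.card_le_card_of_injOn (fun t => (t i, t j)) ?_ ?_
      · intro t ht
        simp only [coe_filter, Set.mem_ofPred_eq] at ht
        simp only [coe_filter, Set.mem_ofPred_eq, mem_product, mem_range]
        rw [key t ht.2]
        exact ⟨⟨hB t ht.1 i, hB t ht.1 j⟩, ht.1⟩
      · intro t ht t' ht' htt
        simp only [coe_filter, Set.mem_ofPred_eq] at ht ht'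
        simp only [Prod.mk.injEq] at htt
        rw [← key t ht.2, ← key t' ht'.2, htt.1, htt.2]
  rw [← hTcard]
  calc #B * M ≤ L / M * #T * M := Nat.mul_le_mul_right _ hcard
    _ = L / M * M * #T := by ring
    _ ≤ L * #T := Nat.mul_le_mul_right _ (Nat.div_mul_le_self _ _)

theorem coeff_formPolyY_update {c : Fin (n + 1) → ℤ} {k : ℕ} (hk : k ≤ n) {m : Fin (n + 1)}
    (hm : (m : ℕ) ≠ k) (x : ℤ) :
    (formPolyY ℤ (update c m x)).coeff k = (formPolyY ℤ c).coeff k := by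
  have h1 := coeff_formPolyY (R := ℤ) (update c m x) ⟨k, by omega⟩
  have h2 := coeff_formPolyY (R := ℤ) c ⟨k, by omega⟩
  rw [update_of_ne (by rintro rfl; exact hm rfl)] at h1
  exact h1.trans h2.symm

theorem coeff_formPolyY_update_self {c : Fin (n + 1) → ℤ} (m : Fin (n + 1)) (x : ℤ) :
    (formPolyY ℤ (update c m x)).coeff m = x := by
  rw [coeff_formPolyY, update_self, Int.cast_id]

theorem abs_coeff_formPolyY_le {c : Fin (n + 1) → ℤ} {Y : ℤ} (hY : ∀ i, |c i| ≤ Y) (k : ℕ) :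
    |(formPolyY ℤ c).coeff k| ≤ Y := by
  rcases lt_or_ge n k with hk | hk
  · rw [coeff_formPolyY_of_lt c hk, abs_zero]
    exact (abs_nonneg _).trans (hY 0)
  · rw [coeff_formPolyY c ⟨k, by omega⟩]
    exact hY _

theorem update_affine (b : Fin (n + 1) → ℤ) (W : ℤ) (t : Fin (n + 1) → ℕ) (i : Fin (n + 1))
    (u : ℕ) : (fun k => b k + W * (update t i u k : ℕ)) =
      update (fun k => b k + W * (t k : ℕ)) i (b i + W * u) := by
  ext k
  by_cases hk : k = i
  · rw [hk, update_self, update_self]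
  · rw [update_of_ne hk, update_of_ne hk]

theorem card_not_hasSimpleRoot_mul_le (hn : 3 ≤ n) {N M : ℕ} (hM : 2 * n ≤ M)
    (hN : (n + 1) * M ≤ N) {b : Fin (n + 1) → ℤ} {W Y : ℤ} (hY : 1 ≤ Y)
    (hbY : ∀ t : Fin (n + 1) → ℕ, (∀ i, t i < N) → ∀ i, |b i + W * t i| ≤ Y)
    (hYN : (n + 1) ^ 4 * (2 * Y) ^ n < (N : ℤ) ^ (n + 1)) (B : Finset (Fin (n + 1) → ℕ))
    (hB : ∀ t ∈ B, (∀ i, t i < N) ∧ ∃ q : ℕ, ∃ _ : Fact q.Prime, M < q ∧ ¬ (q : ℤ) ∣ W ∧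
      ¬ HasSimpleRoot (formPolyX (ZMod q) fun i => b i + W * t i) ∧
      ¬ HasSimpleRoot (formPolyY (ZMod q) fun i => b i + W * t i)) :
    #B * M ≤ 10 * N ^ (n + 1) := by
  classical
  have hM0 : 1 ≤ M := by omega
  have hN0 : 0 < N := by nlinarith
  set c : (Fin (n + 1) → ℕ) → Fin (n + 1) → ℤ := fun t i => b i + W * t i with hc
  set P : ℕ → (Fin (n + 1) → ℤ) → ℤ := fun k c =>
    PowerSeries.coeff k (quotSeries n (formPolyY ℤ c).coeff) with hP
  have hYn : Y ≤ (n + 1) ^ 4 * (2 * Y) ^ n := by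
    have h1 : 2 * Y ≤ (2 * Y) ^ n := le_self_pow₀ (by omega) (by omega)
    have h2 : (1 : ℤ) ≤ (n + 1) ^ 4 := one_le_pow₀ (by omega)
    nlinarith
  let i₁ : Fin (n + 1) := ⟨1, by omega⟩
  let i₂ : Fin (n + 1) := ⟨n - 1, by omega⟩
  set B₁ := {t ∈ B | ∃ q : ℕ, q.Prime ∧ M < q ∧ ¬ (q : ℤ) ∣ W ∧
    (q : ℤ) ∣ c t 0 ∧ (q : ℤ) ∣ c t i₁} with hB₁
  set B₂ := {t ∈ B | ∃ q : ℕ, q.Prime ∧ M < q ∧ ¬ (q : ℤ) ∣ W ∧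
    ¬ (q : ℤ) ∣ c t 0 ∧ (q : ℤ) ∣ P (n - 1) (c t) ∧ (q : ℤ) ∣ P n (c t)} with hB₂
  have hB12 : #B ≤ #B₁ + #B₂ := by
    refine (Finset.card_le_card fun t ht => ?_).trans (Finset.card_union_le _ _)
    obtain ⟨-, q, hq, hqM, hqW, hX, hY⟩ := hB t ht
    rcases dvd_of_not_hasSimpleRoot hn hX hY with h | h
    · exact Finset.mem_union_left _ (Finset.mem_filter.2 ⟨ht, q, hq.out, hqM, hqW, h.1, h.2⟩)
    · exact Finset.mem_union_right _
        (Finset.mem_filter.2 ⟨ht, q, hq.out, hqM, hqW, h.1, h.2.1, h.2.2⟩)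
  have hNn : 5 * N ^ 2 * N ^ (n - 1) = 5 * N ^ (n + 1) := by
    rw [mul_assoc, ← pow_add]; congr 2; omega
  have hne : (0 : Fin (n + 1)) ≠ i₁ := by simp [Fin.ext_iff, i₁]
  have hne2 : i₂ ≠ Fin.last n := by simp only [ne_eq, Fin.ext_iff, i₂, Fin.val_last]; omega
  have hN12 : ∀ B' ⊆ B, ∀ t ∈ B', ∀ k, t k < N := fun B' hB' t ht => (hB t (hB' ht)).1
  have hcard₁ : #B₁ * M ≤ 5 * N ^ 2 * N ^ (n - 1) := by
    refine card_mul_le_of_card_pairs_mul_le hN0 B₁ (hN12 _ (Finset.filter_subset _ _)) hne ?_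
    intro t ht
    refine card_pairs_dvd_prime_mul_le hM0 hN (α := W) (β := b 0) (γ := W)
      (δ := fun _ => b i₁) ?_ _ ?_
    · intro u hu
      rw [add_comm]
      exact ((hbY (fun _ => u) (fun _ => hu) 0).trans hYn).trans_lt hYN
    · intro p hp
      simp only [mem_filter, mem_product, mem_range, hB₁] at hp
      obtain ⟨⟨hp1, hp2⟩, -, q, hq, hqM, hqW, h0, h1⟩ := hp
      refine ⟨hp1, hp2, q, hq, hqM, hqW, hqW, ?_, ?_⟩
      · simp only [hc, update_of_ne hne, update_self] at h0
        rwa [add_comm]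
      · simp only [hc, update_self] at h1
        rwa [add_comm]
  have hcard₂ : #B₂ * M ≤ 5 * N ^ 2 * N ^ (n - 1) := by
    refine card_mul_le_of_card_pairs_mul_le hN0 B₂ (hN12 _ (Finset.filter_subset _ _)) hne2 ?_
    intro t ht
    have hcu : ∀ u v : ℕ, c (update (update t i₂ u) (Fin.last n) v) =
        update (update (c t) i₂ (b i₂ + W * u)) (Fin.last n) (b (Fin.last n) + W * v) := by
      intro u v
      rw [hc]
      simp only
      rw [update_affine, update_affine]
    have hc0 : ∀ u v : ℕ, c (update (update t i₂ u) (Fin.last n) v) 0 = c t 0 := by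
      intro u v
      rw [hcu, update_of_ne, update_of_ne]
      · simp only [ne_eq, Fin.ext_iff, i₂, Fin.val_zero]; omega
      · simp only [ne_eq, Fin.ext_iff, Fin.val_last, Fin.val_zero]; omega
    have hcoef0 : ∀ u v : ℕ,
        (formPolyY ℤ (c (update (update t i₂ u) (Fin.last n) v))).coeff 0 = c t 0 := by
      intro u v
      rw [← hc0 u v]
      exact coeff_formPolyY _ 0
    have hPn1 : ∀ u v : ℕ, P (n - 1) (c (update (update t i₂ u) (Fin.last n) v)) =
        n * (n - 2 * (n - 1 : ℕ)) * c t 0 ^ (n - 1 - 1) * W * u +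
          P (n - 1) (c (update (update t i₂ 0) (Fin.last n) 0)) := by
      intro u v
      have := coeff_quotSeries_sub n (k := n - 1) (by omega)
        (a := (formPolyY ℤ (c (update (update t i₂ u) (Fin.last n) v))).coeff)
        (b := (formPolyY ℤ (c (update (update t i₂ 0) (Fin.last n) 0))).coeff) ?_
      · have hk1 : ((Fin.last n : Fin (n + 1)) : ℕ) ≠ n - 1 := by rw [Fin.val_last]; omega
        rw [hcoef0, hcu, hcu, coeff_formPolyY_update (by omega) hk1,
          coeff_formPolyY_update (by omega) hk1] at this
        have h1 := fun x => coeff_formPolyY_update_self (c := c t) i₂ x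
        simp only [i₂] at h1
        rw [h1, h1] at this
        rw [hcu, hcu]
        simp only [hP]
        linear_combination this
      · intro k hk
        rw [hcu, hcu]
        have hk1 : ((Fin.last n : Fin (n + 1)) : ℕ) ≠ k := by rw [Fin.val_last]; omega
        have hk2 : (i₂ : ℕ) ≠ k := by simp only [i₂]; omega
        rw [coeff_formPolyY_update (by omega) hk1, coeff_formPolyY_update (by omega) hk1,
          coeff_formPolyY_update (by omega) hk2, coeff_formPolyY_update (by omega) hk2]
    have hPn : ∀ u v : ℕ, P n (c (update (update t i₂ u) (Fin.last n) v)) =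
        n * (n - 2 * n) * c t 0 ^ (n - 1) * W * v +
          P n (c (update (update t i₂ u) (Fin.last n) 0)) := by
      intro u v
      have := coeff_quotSeries_sub n (k := n) (by omega)
        (a := (formPolyY ℤ (c (update (update t i₂ u) (Fin.last n) v))).coeff)
        (b := (formPolyY ℤ (c (update (update t i₂ u) (Fin.last n) 0))).coeff) ?_
      · have h1 := fun (c : Fin (n + 1) → ℤ) x => coeff_formPolyY_update_self (c := c) (Fin.last n) x
        simp only [Fin.val_last] at h1
        rw [hcoef0, hcu, hcu, h1, h1] at this
        rw [hcu, hcu]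
        simp only [hP]
        linear_combination this
      · intro k hk
        rw [hcu, hcu]
        have hk1 : ((Fin.last n : Fin (n + 1)) : ℕ) ≠ k := by rw [Fin.val_last]; omega
        rw [coeff_formPolyY_update (by omega) hk1, coeff_formPolyY_update (by omega) hk1]
    refine card_pairs_dvd_prime_mul_le hM0 hN
      (α := n * (n - 2 * (n - 1 : ℕ)) * c t 0 ^ (n - 1 - 1) * W)
      (β := P (n - 1) (c (update (update t i₂ 0) (Fin.last n) 0)))
      (γ := n * (n - 2 * n) * c t 0 ^ (n - 1) * W)
      (δ := fun u => P n (c (update (update t i₂ u) (Fin.last n) 0))) ?_ _ ?_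
    · intro u hu
      rw [← hPn1 u 0]
      refine lt_of_le_of_lt (abs_coeff_quotSeries_le (by omega) hY fun k =>
        abs_coeff_formPolyY_le (fun i => hbY _ (fun k => ?_) i) k) (lt_of_le_of_lt ?_ hYN)
      · by_cases hk : k = Fin.last n
        · rw [hk, update_self]; exact hN0
        rw [update_of_ne hk]
        by_cases hk : k = i₂
        · rw [hk, update_self]; exact hu
        · rw [update_of_ne hk]; exact ht k
      · gcongr
        · omega
        · omega
    · intro p hp
      simp only [mem_filter, mem_product, mem_range, hB₂] at hp
      obtain ⟨⟨hp1, hp2⟩, -, q, hq, hqM, hqW, h0, h1, h2⟩ := hp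
      rw [hc0] at h0
      rw [hPn1] at h1
      rw [hPn] at h2
      have hqp := Nat.prime_iff_prime_int.1 hq
      have hsmall : ∀ z : ℤ, z ≠ 0 → |z| < q → ¬ (q : ℤ) ∣ z := fun z hz hzq hdvd =>
        hz (Int.eq_zero_of_abs_lt_dvd hdvd hzq)
      have hqn : ¬ (q : ℤ) ∣ n := hsmall _ (by omega) (by rw [abs_lt]; omega)
      refine ⟨hp1, hp2, q, hq, hqM, ?_, ?_, h1, h2⟩
      · rw [hqp.dvd_mul, hqp.dvd_mul, hqp.dvd_mul]
        push Not
        refine ⟨⟨⟨hqn, hsmall _ (by omega) (by rw [abs_lt]; omega)⟩,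
          fun h => h0 (hqp.dvd_of_dvd_pow h)⟩, hqW⟩
      · rw [hqp.dvd_mul, hqp.dvd_mul, hqp.dvd_mul]
        push Not
        refine ⟨⟨⟨hqn, hsmall _ (by omega) (by rw [abs_lt]; omega)⟩,
          fun h => h0 (hqp.dvd_of_dvd_pow h)⟩, hqW⟩
  nlinarith

end BadCount

section Local

open Polynomial

variable {n : ℕ}

theorem binEval_rev {R : Type*} [CommRing R] (c : Fin (n + 1) → R) (x y : R) :
    binEval (fun i => c (Fin.rev i)) x y = binEval c y x := by
  refine Fintype.sum_equiv Fin.revPerm _ _ fun i => ?_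
  rw [Fin.revPerm_apply, Fin.val_rev, mul_right_comm,
    show n - (n + 1 - ((i : ℕ) + 1)) = i by omega, show n + 1 - ((i : ℕ) + 1) = n - i by omega]

theorem formPolyY_rev (R : Type*) [CommRing R] (c : Fin (n + 1) → ℤ) :
    formPolyY R (fun i => c (Fin.rev i)) = formPolyX R c := by
  simp only [formPolyY, Fin.rev_rev]

theorem exists_eq_mul_of_det_eq_zero {K : Type*} [Field K] {a b c d : K} (h : a * d - b * c = 0) :
    ∃ u v s t : K, a = s * u ∧ b = s * v ∧ c = t * u ∧ d = t * v := by
  by_cases ha : a = 0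
  · by_cases hb : b = 0
    · exact ⟨c, d, 0, 1, by simp [ha], by simp [hb], by simp, by simp⟩
    · refine ⟨a, b, 1, d / b, by simp, by simp, ?_, by field_simp⟩
      field_simp
      linear_combination -h
  · refine ⟨a, b, 1, c / a, by simp, by simp, by field_simp, ?_⟩
    field_simp
    linear_combination h

theorem not_hasSimpleRoot_of_subform {p : ℕ} [Fact p.Prime] (hn : 2 ≤ n)
    {F G : Fin (n + 1) → ℤ} {a b c d : ℤ} (hdet : (p : ℤ) ∣ a * d - b * c)
    (h : ∀ x y : ℤ, binEval G x y = binEval F (a * x + b * y) (c * x + d * y)) :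
    ¬ HasSimpleRoot (formPolyX (ZMod p) G) := by
  rintro ⟨α, h0, h1⟩
  set K := AlgebraicClosure (ZMod p)
  have hpoly : formPolyX ℤ G = binEval (fun i => (F i : ℤ[X]))
      ((a : ℤ[X]) * X + (b : ℤ[X])) ((c : ℤ[X]) * X + (d : ℤ[X])) := by
    refine Polynomial.funext fun x => ?_
    have h2 := map_binEval (evalRingHom x) (fun i => (F i : ℤ[X]))
      ((a : ℤ[X]) * X + (b : ℤ[X])) ((c : ℤ[X]) * X + (d : ℤ[X]))
    simp only [coe_evalRingHom, eval_add, eval_mul, eval_intCast, eval_X] at h2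
    rw [h2, eval_formPolyX]
    simpa using h x 1
  have hK := congrArg (mapRingHom (Int.castRingHom K)) hpoly
  rw [map_binEval, coe_mapRingHom, map_formPolyX] at hK
  simp only [Polynomial.map_add, Polynomial.map_mul, Polynomial.map_intCast, map_X] at hK
  have hdetK : (a : K) * d - b * c = 0 := by
    obtain ⟨e, he⟩ := hdet
    have := congrArg (Int.cast : ℤ → K) he
    rw [Int.cast_sub, Int.cast_mul, Int.cast_mul, Int.cast_mul, Int.cast_natCast] at this
    rw [this, CharP.cast_eq_zero K p, zero_mul]
  obtain ⟨u, v, s, t, ha, hb, hc, hd⟩ := exists_eq_mul_of_det_eq_zero hdetK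
  obtain ⟨k, hk⟩ : ∃ k : K, formPolyX K G = (C u * X + C v) ^ n * C k := by
    refine ⟨binEval (fun i => (F i : K)) s t, ?_⟩
    rw [hK, map_binEval, ← binEval_smul]
    have h3 : ∀ z : ℤ, ((z : ℤ) : K[X]) = C (z : K) := fun z => (map_intCast (C : K →+* K[X]) z).symm
    simp only [h3, ha, hb, hc, hd, C_mul]
    congr 1 <;> ring
  rw [← eval_map_algebraMap, map_formPolyX] at h0
  rw [← eval_map_algebraMap, ← derivative_map, map_formPolyX] at h1
  rw [hk, eval_mul, eval_pow, eval_C] at h0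
  rw [hk, derivative_mul, derivative_C, mul_zero, add_zero, derivative_pow] at h1
  simp only [eval_mul, eval_pow, eval_C] at h1
  rcases mul_eq_zero.1 h0 with h4 | h4
  · rw [pow_eq_zero_iff (by omega)] at h4
    apply h1
    rw [h4, zero_pow (by omega)]
    ring
  · exact h1 (by rw [h4, mul_zero])

theorem isMaximalForm_of_hasSimpleRoot (hn : 2 ≤ n) {G : Fin (n + 1) → ℤ}
    (hG : ∀ (p : ℕ) [Fact p.Prime],
      HasSimpleRoot (formPolyX (ZMod p) G) ∨ HasSimpleRoot (formPolyY (ZMod p) G)) :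
    IsMaximalForm G := by
  rintro ⟨F, a, b, c, d, hdet, h⟩
  obtain ⟨p, hp, hpd⟩ := Nat.exists_prime_and_dvd (n := (a * d - b * c).natAbs) 
    (by rw [Int.abs_eq_natAbs] at hdet; omega)
  have : Fact p.Prime := ⟨hp⟩
  have hpd' : (p : ℤ) ∣ a * d - b * c := Int.natCast_dvd.2 hpd
  rcases hG p with h1 | h1
  · exact not_hasSimpleRoot_of_subform hn hpd' h h1
  · refine not_hasSimpleRoot_of_subform hn (F := F) (a := b) (b := a) (c := d) (d := c) ?_ ?_ h1
    · rw [← dvd_neg]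
      rwa [neg_sub]
    · intro x y
      rw [binEval_rev, h, add_comm (a * y), add_comm (c * y)]

theorem PadicInt.toZMod_eq_zero_iff_norm_lt_one {p : ℕ} [Fact p.Prime] (x : ℤ_[p]) :
    PadicInt.toZMod x = 0 ↔ ‖x‖ < 1 := by
  rw [← RingHom.mem_ker, PadicInt.ker_toZMod, IsLocalRing.mem_maximalIdeal, PadicInt.mem_nonunits]

/-- **Hensel's lemma** for a simple root modulo `p`. -/
theorem PadicInt.exists_aeval_eq_zero {p : ℕ} [Fact p.Prime] {f : ℤ[X]} {a : ZMod p}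
    (h0 : aeval a f = 0) (h1 : aeval a (derivative f) ≠ 0) : ∃ z : ℤ_[p], aeval z f = 0 := by
  obtain ⟨b, rfl⟩ := ZMod.ringHom_surjective (PadicInt.toZMod (p := p)) a
  have h2 : ∀ g : ℤ[X], aeval (PadicInt.toZMod b) g = PadicInt.toZMod (aeval b g) := fun g => by
    simp only [aeval_def, hom_eval₂]
    congr 1
    exact RingHom.ext_int _ _
  rw [h2, PadicInt.toZMod_eq_zero_iff_norm_lt_one] at h0
  rw [h2, Ne, PadicInt.toZMod_eq_zero_iff_norm_lt_one, not_lt] at h1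
  obtain ⟨z, hz, -⟩ := hensels_lemma (F := f) (a := b)
    (h0.trans_le (one_le_pow₀ h1))
  exact ⟨z, hz⟩

section

variable {p : ℕ} [Fact p.Prime] {c : Fin (n + 1) → ℤ}

theorem formPolyY_eq_of_dvd (hn : 1 ≤ n)
    (h2 : ∀ i : Fin (n + 1), 2 ≤ (i : ℕ) → (p : ℤ) ∣ c i) :
    formPolyY (ZMod p) c = C (c 0 : ZMod p) + C (c ⟨1, by omega⟩ : ZMod p) * X := by
  ext i
  rw [coeff_add, coeff_C, coeff_C_mul, coeff_X]
  rcases lt_or_ge n i with hi | hi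
  · rw [coeff_formPolyY_of_lt c hi, if_neg (by omega), if_neg (by omega), mul_zero, add_zero]
  · rw [coeff_formPolyY c ⟨i, by omega⟩]
    rcases (by omega : i = 0 ∨ i = 1 ∨ 2 ≤ i) with rfl | rfl | hi2
    · simp
    · simp
    · rw [if_neg (by omega), if_neg (by omega), mul_zero, add_zero]
      exact (ZMod.intCast_zmod_eq_zero_iff_dvd _ _).2 (h2 _ hi2)

theorem hasSimpleRoot_formPolyY_of_dvd (hn : 1 ≤ n) (h1 : ¬ (p : ℤ) ∣ c ⟨1, by omega⟩)
    (h2 : ∀ i : Fin (n + 1), 2 ≤ (i : ℕ) → (p : ℤ) ∣ c i) :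
    HasSimpleRoot (formPolyY (ZMod p) c) := by
  have h3 : ((c ⟨1, by omega⟩ : ℤ) : ZMod p) ≠ 0 := fun h =>
    h1 ((ZMod.intCast_zmod_eq_zero_iff_dvd _ _).1 h)
  refine ⟨algebraMap (ZMod p) _ (-(c 0 : ZMod p) / (c ⟨1, by omega⟩ : ZMod p)), ?_, ?_⟩
  · rw [formPolyY_eq_of_dvd hn h2, aeval_algebraMap_apply, coe_aeval_eq_eval]
    simp only [eval_add, eval_mul, eval_C, eval_X]
    rw [mul_div_cancel₀ _ h3, add_neg_cancel, map_zero]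
  · rw [formPolyY_eq_of_dvd hn h2, aeval_algebraMap_apply, coe_aeval_eq_eval, Ne,
      map_eq_zero]
    simpa using h3

theorem exists_binEval_padic_eq_of_dvd (hn : 1 ≤ n) (h1 : ¬ (p : ℤ) ∣ c ⟨1, by omega⟩)
    (h2 : ∀ i : Fin (n + 1), 2 ≤ (i : ℕ) → (p : ℤ) ∣ c i) (h : ℤ) :
    ∃ x y : ℤ_[p], binEval (fun i => (c i : ℤ_[p])) x y = h := by
  have h3 : ((c ⟨1, by omega⟩ : ℤ) : ZMod p) ≠ 0 := fun h =>
    h1 ((ZMod.intCast_zmod_eq_zero_iff_dvd _ _).1 h)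
  have hmap : ∀ (g : ℤ[X]) (a : ZMod p), aeval a g = (g.map (Int.castRingHom (ZMod p))).eval a :=
    fun g a => by rw [aeval_def, eval_map]; rfl
  have hY : (formPolyY ℤ c).map (Int.castRingHom (ZMod p)) = formPolyY (ZMod p) c :=
    map_formPolyX _ _
  obtain ⟨z, hz⟩ := PadicInt.exists_aeval_eq_zero (p := p) (f := formPolyY ℤ c - C h)
    (a := ((h : ZMod p) - c 0) / (c ⟨1, by omega⟩ : ZMod p))
    (by
      rw [hmap, Polynomial.map_sub, hY, formPolyY_eq_of_dvd hn h2]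
      simp only [eval_add, eval_mul, eval_C, eval_X, eval_sub, map_C]
      rw [mul_div_cancel₀ _ h3, eq_intCast]
      ring)
    (by
      rw [hmap, ← derivative_map, Polynomial.map_sub, hY, formPolyY_eq_of_dvd hn h2]
      simpa using h3)
  refine ⟨1, z, ?_⟩
  rw [map_sub, aeval_C, formPolyY, aeval_formPolyX, binEval_rev (fun i => (c i : ℤ_[p])),
    sub_eq_zero] at hz
  exact hz

theorem exists_binEval_padic_eq_of_eval (hpn : ¬ p ∣ n) {b : ℤ} (hb : ¬ (p : ℤ) ∣ b)
    {t w : ZMod p} (hw : w ≠ 0) (h : (formPolyX (ZMod p) c).eval t = b * w ^ n) :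
    ∃ x y : ℤ_[p], binEval (fun i => (c i : ℤ_[p])) x y = b := by
  have hb' : (b : ZMod p) ≠ 0 := fun h => hb ((ZMod.intCast_zmod_eq_zero_iff_dvd _ _).1 h)
  have hn' : (n : ZMod p) ≠ 0 := fun h => hpn ((ZMod.natCast_eq_zero_iff _ _).1 h)
  obtain ⟨x, rfl⟩ := ZMod.intCast_surjective t
  have hv : ((binEval c x 1 : ℤ) : ZMod p) = b * w ^ n := by
    rw [← h, eval_formPolyX, intCast_binEval, Int.cast_one]
  obtain ⟨z, hz⟩ := PadicInt.exists_aeval_eq_zero (p := p) (f := C (binEval c x 1) * X ^ n - C b)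
    (a := w⁻¹)
    (by
      simp only [map_sub, map_mul, aeval_C, map_pow, aeval_X, algebraMap_int_eq,
        Int.coe_castRingHom, hv]
      rw [mul_assoc, ← mul_pow, mul_inv_cancel₀ hw, one_pow, mul_one, sub_self])
    (by
      simp only [derivative_sub, derivative_C_mul, derivative_C, sub_zero, derivative_X_pow,
        map_mul, aeval_C, map_pow, aeval_X, algebraMap_int_eq, Int.coe_castRingHom, hv]
      simp [hb', hn', hw])
  refine ⟨z * x, z * 1, ?_⟩
  simp only [map_sub, map_mul, aeval_C, map_pow, aeval_X, algebraMap_int_eq, Int.coe_castRingHom,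
    sub_eq_zero] at hz
  rw [binEval_smul, ← hz, mul_comm, intCast_binEval, Int.cast_one]

end

end Local

section Twist

open Polynomial

variable {n : ℕ}

/-- The binary form `F(d x, e y) / (d e)`, where `F` has coefficient vector `c`. -/
def twist (d e : ℤ) (c : Fin (n + 1) → ℤ) (i : Fin (n + 1)) : ℤ :=
  c i * d ^ (n - (i : ℕ)) * e ^ (i : ℕ) / (d * e)

theorem twist_rev (d e : ℤ) (c : Fin (n + 1) → ℤ) :
    twist e d (fun i => c (Fin.rev i)) = fun i => twist d e c (Fin.rev i) := by
  ext i
  have hi : n + 1 - ((i : ℕ) + 1) = n - i := by omega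
  have hi' : n - (n - (i : ℕ)) = i := by omega
  rw [twist, twist, Fin.val_rev, hi, hi', mul_right_comm, mul_comm e]

variable {d e : ℤ} {c : Fin (n + 1) → ℤ}

theorem mul_twist (h0 : d * e ∣ c 0) (hn : d * e ∣ c (Fin.last n)) (i : Fin (n + 1)) :
    d * e * twist d e c i = c i * d ^ (n - (i : ℕ)) * e ^ (i : ℕ) := by
  refine Int.mul_ediv_cancel' ?_
  by_cases hi0 : i = 0
  · rw [hi0, mul_assoc]; exact h0.mul_right _
  by_cases hin : i = Fin.last n
  · rw [hin, mul_assoc]; exact hn.mul_right _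
  have h1 : (i : ℕ) ≠ 0 := fun h => hi0 (Fin.ext h)
  have h2 : (i : ℕ) ≠ n := fun h => hin (Fin.ext h)
  rw [mul_assoc]
  exact (mul_dvd_mul (dvd_pow_self _ (by omega)) (dvd_pow_self _ h1)).mul_left _

theorem mul_binEval_twist (h0 : d * e ∣ c 0) (hn : d * e ∣ c (Fin.last n)) {R : Type*}
    [CommRing R] (x y : R) :
    (d : R) * e * binEval (fun i => (twist d e c i : R)) x y =
      binEval (fun i => (c i : R)) (d * x) (e * y) := by
  rw [binEval, binEval, Finset.mul_sum]
  refine Finset.sum_congr rfl fun i _ => ?_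
  have h1 := congrArg (Int.cast : ℤ → R) (mul_twist h0 hn i)
  push_cast at h1
  rw [mul_pow, mul_pow]
  linear_combination x ^ (n - (i : ℕ)) * y ^ (i : ℕ) * h1

theorem twist_one (hn : 2 ≤ n) (hd : d ≠ 0) (he : e ≠ 0) :
    twist d e c ⟨1, by omega⟩ = c ⟨1, by omega⟩ * d ^ (n - 2) := by
  refine Int.ediv_eq_of_eq_mul_right (mul_ne_zero hd he) ?_
  simp only
  rw [show n - 1 = n - 2 + 1 by omega]
  ring

theorem dvd_twist (hd : d ≠ 0) (he : e ≠ 0) (hn : d * e ∣ c (Fin.last n)) {i : Fin (n + 1)}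
    (hi : 2 ≤ (i : ℕ)) : e ∣ twist d e c i := by
  by_cases hin : i = Fin.last n
  · obtain ⟨k, hk⟩ := hn
    rw [twist, hin, hk, Fin.val_last, Nat.sub_self, pow_zero, mul_one, mul_assoc,
      Int.mul_ediv_cancel_left _ (mul_ne_zero hd he)]
    refine (dvd_pow_self _ ?_).mul_left _
    rw [hin, Fin.val_last] at hi
    omega
  · have h2 : (i : ℕ) ≠ n := fun h => hin (Fin.ext h)
    refine ⟨c i * d ^ (n - i - 1) * e ^ (i - 2 : ℕ), ?_⟩
    refine Int.ediv_eq_of_eq_mul_right (mul_ne_zero hd he) ?_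
    obtain ⟨a, ha⟩ : ∃ a, n - (i : ℕ) = a + 1 := ⟨n - i - 1, by omega⟩
    obtain ⟨b, hb⟩ : ∃ b, (i : ℕ) = b + 2 := ⟨i - 2, by omega⟩
    rw [ha, hb, Nat.add_sub_cancel, Nat.add_sub_cancel]
    ring

theorem abs_twist_le (hd : d ≠ 0) (he : e ≠ 0) (h0 : d * e ∣ c 0) (hn : d * e ∣ c (Fin.last n))
    (i : Fin (n + 1)) : |twist d e c i| ≤ |c i| * |d * e| ^ n := by
  have h1 := congrArg abs (mul_twist h0 hn i)
  rw [abs_mul, abs_mul, abs_mul, abs_mul, abs_pow, abs_pow] at h1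
  have hd1 : 1 ≤ |d| := Int.one_le_abs hd
  have he1 : 1 ≤ |e| := Int.one_le_abs he
  have h2 : |d| ^ (n - (i : ℕ)) ≤ |d| ^ n := pow_le_pow_right₀ hd1 (by omega)
  have h3 : |e| ^ (i : ℕ) ≤ |e| ^ n := pow_le_pow_right₀ he1 (by omega)
  calc |twist d e c i| ≤ |d| * |e| * |twist d e c i| :=
        le_mul_of_one_le_left (abs_nonneg _) (one_le_mul_of_one_le_of_one_le hd1 he1)
    _ = |c i| * (|d| ^ (n - (i : ℕ)) * |e| ^ (i : ℕ)) := by rw [h1, mul_assoc]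
    _ ≤ |c i| * (|d| ^ n * |e| ^ n) := by gcongr
    _ = |c i| * |d * e| ^ n := by rw [abs_mul, mul_pow]

theorem twist_injective {c' : Fin (n + 1) → ℤ} (hd : d ≠ 0) (he : e ≠ 0) (h0 : d * e ∣ c 0)
    (hn : d * e ∣ c (Fin.last n)) (h0' : d * e ∣ c' 0) (hn' : d * e ∣ c' (Fin.last n))
    (h : twist d e c = twist d e c') : c = c' := by
  ext i
  have h1 := mul_twist h0 hn i
  rw [h, mul_twist h0' hn' i, mul_assoc, mul_assoc] at h1
  exact (mul_right_cancel₀ (mul_ne_zero (pow_ne_zero _ hd) (pow_ne_zero _ he)) h1).symm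

variable {p : ℕ} [Fact p.Prime]

theorem HasSimpleRoot.twist_X (h0 : d * e ∣ c 0) (hn : d * e ∣ c (Fin.last n))
    (hd : ¬ (p : ℤ) ∣ d) (he : ¬ (p : ℤ) ∣ e) (h : HasSimpleRoot (formPolyX (ZMod p) c)) :
    HasSimpleRoot (formPolyX (ZMod p) (twist d e c)) := by
  obtain ⟨α, h1, h2⟩ := h
  have hcast : ∀ z : ℤ, ¬ (p : ℤ) ∣ z → (z : AlgebraicClosure (ZMod p)) ≠ 0 := fun z hz h =>
    hz ((CharP.intCast_eq_zero_iff _ p z).1 h)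
  have hd' := hcast d hd
  have he' := hcast e he
  rw [← eval_map_algebraMap, map_formPolyX] at h1
  rw [← eval_map_algebraMap, ← derivative_map, map_formPolyX] at h2
  have hpoly : C ((d : AlgebraicClosure (ZMod p)) * e) * formPolyX (AlgebraicClosure (ZMod p))
      (twist d e c) = C ((e : AlgebraicClosure (ZMod p)) ^ n) *
        (formPolyX (AlgebraicClosure (ZMod p)) c).comp (C ((d : AlgebraicClosure (ZMod p)) / e) * X) := by
    refine Polynomial.funext fun t => ?_
    rw [eval_mul, eval_C, eval_mul, eval_C, eval_comp, eval_formPolyX, eval_formPolyX,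
      mul_binEval_twist h0 hn, ← binEval_smul, eval_mul, eval_C, eval_X]
    congr 1
    field_simp
  have hα : (d : AlgebraicClosure (ZMod p)) / e * (α * e / d) = α := by field_simp
  refine ⟨α * e / d, ?_, ?_⟩
  · rw [← eval_map_algebraMap, map_formPolyX]
    have h3 := congrArg (eval (α * e / d)) hpoly
    rw [eval_mul, eval_C, eval_mul, eval_C, eval_comp, eval_mul, eval_C, eval_X, hα, h1,
      mul_zero] at h3
    exact (mul_eq_zero.1 h3).resolve_left (mul_ne_zero hd' he')
  · rw [← eval_map_algebraMap, ← derivative_map, map_formPolyX]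
    intro h4
    have h3 := congrArg (fun f => eval (α * e / d) (derivative f)) hpoly
    simp only [derivative_C_mul, derivative_comp, eval_mul, eval_C, h4, mul_zero, eval_comp,
      eval_X, hα, derivative_X, mul_one] at h3
    exact mul_ne_zero (pow_ne_zero _ he') (mul_ne_zero (div_ne_zero hd' he') h2) h3.symm

theorem HasSimpleRoot.twist_Y (h0 : d * e ∣ c 0) (hn : d * e ∣ c (Fin.last n))
    (hd : ¬ (p : ℤ) ∣ d) (he : ¬ (p : ℤ) ∣ e) (h : HasSimpleRoot (formPolyY (ZMod p) c)) :
    HasSimpleRoot (formPolyY (ZMod p) (twist d e c)) := by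
  rw [formPolyY, ← twist_rev]
  refine HasSimpleRoot.twist_X ?_ ?_ he hd h
  · rwa [Fin.rev_zero, mul_comm]
  · rwa [Fin.rev_last, mul_comm]

theorem exists_binEval_twist_padic_eq (h0 : d * e ∣ c 0) (hn : d * e ∣ c (Fin.last n))
    (hd : ¬ (p : ℤ) ∣ d) (he : ¬ (p : ℤ) ∣ e) {h : ℤ} {x y : ℤ_[p]}
    (hxy : binEval (fun i => (c i : ℤ_[p])) x y = (d * e * h : ℤ)) :
    ∃ x y : ℤ_[p], binEval (fun i => (twist d e c i : ℤ_[p])) x y = h := by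
  have hunit : ∀ z : ℤ, ¬ (p : ℤ) ∣ z → ∃ w : ℤ_[p], z * w = 1 := fun z hz => by
    refine IsUnit.exists_right_inv (PadicInt.isUnit_iff.2 ?_)
    refine le_antisymm (PadicInt.norm_le_one _) (not_lt.1 fun h => hz ?_)
    exact (PadicInt.norm_int_lt_one_iff_dvd z).1 h
  obtain ⟨u, hu⟩ := hunit d hd
  obtain ⟨v, hv⟩ := hunit e he
  refine ⟨u * x, v * y, ?_⟩
  have h1 := mul_binEval_twist h0 hn (u * x) (v * y)
  rw [← mul_assoc, hu, ← mul_assoc, hv, one_mul, one_mul, hxy] at h1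
  push_cast at h1
  have h2 : (d : ℤ_[p]) * e ≠ 0 :=
    mul_ne_zero (left_ne_zero_of_mul (hu.trans_ne one_ne_zero))
      (left_ne_zero_of_mul (hv.trans_ne one_ne_zero))
  exact mul_left_cancel₀ h2 h1

end Twist

section LocalConditions

variable {n : ℕ}

/-- Congruence conditions on a binary form `F` which make every `F(d x, e y) / (d e)`, with `d e`
the product of the primes in `S`, a maximal form that is solvable over every `ℤ_p`. -/
structure LocalConditions (S : Finset ℕ) (M : ℕ) (c : Fin (n + 1) → ℤ) : Prop where
  first : ∏ p ∈ S, (p : ℤ) ∣ c 0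
  last : ∏ p ∈ S, (p : ℤ) ∣ c (Fin.last n)
  second : ∀ p : ℕ, p.Prime → p ≤ M ∨ p ∈ S → ∀ i : Fin (n + 1), (i : ℕ) = 1 → ¬ (p : ℤ) ∣ c i
  penultimate : ∀ p ∈ S, ∀ i : Fin (n + 1), (i : ℕ) + 1 = n → ¬ (p : ℤ) ∣ c i
  small : ∀ p : ℕ, p.Prime → p ≤ M → ∀ i : Fin (n + 1), (i : ℕ) ≠ 1 → (p : ℤ) ∣ c i
  large : ∀ (p : ℕ) [Fact p.Prime], M < p → p ∉ S →
    HasSimpleRoot (formPolyX (ZMod p) c) ∨ HasSimpleRoot (formPolyY (ZMod p) c)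

theorem Int.not_dvd_prod_primes {p : ℕ} (hp : p.Prime) {T : Finset ℕ} (hT : ∀ q ∈ T, q.Prime)
    (hpT : p ∉ T) : ¬ (p : ℤ) ∣ ∏ q ∈ T, (q : ℤ) := by
  rw [(Nat.prime_iff_prime_int.1 hp).dvd_finsetProd_iff]
  rintro ⟨q, hq, h⟩
  rw [Int.natCast_dvd_natCast, Nat.prime_dvd_prime_iff_eq hp (hT q hq)] at h
  exact hpT (h ▸ hq)

theorem hasSimpleRoot_and_padic_twist_of_dvd {p : ℕ} [Fact p.Prime] (hn : 3 ≤ n) {d e : ℤ}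
    (hd : ¬ (p : ℤ) ∣ d) (he0 : e ≠ 0) {c : Fin (n + 1) → ℤ}
    (h1 : ¬ (p : ℤ) ∣ c ⟨1, by omega⟩)
    (h2 : ∀ i : Fin (n + 1), 2 ≤ (i : ℕ) → (p : ℤ) ∣ twist d e c i) (h : ℤ) :
    HasSimpleRoot (formPolyY (ZMod p) (twist d e c)) ∧
      ∃ x y : ℤ_[p], binEval (fun i => (twist d e c i : ℤ_[p])) x y = h := by
  have hd0 : d ≠ 0 := by rintro rfl; exact hd (dvd_zero _)
  have hp : Prime (p : ℤ) := Nat.prime_iff_prime_int.1 Fact.out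
  have h3 : ¬ (p : ℤ) ∣ twist d e c ⟨1, by omega⟩ := by
    rw [twist_one (by omega) hd0 he0, hp.dvd_mul, not_or]
    exact ⟨h1, fun h => hd (hp.dvd_of_dvd_pow h)⟩
  exact ⟨hasSimpleRoot_formPolyY_of_dvd (by omega) h3 h2,
    exists_binEval_padic_eq_of_dvd (by omega) h3 h2 h⟩

theorem LocalConditions.hasSimpleRoot_and_padic (hn : 3 ≤ n) {M : ℕ} (hM : n ≤ M)
    (hpow : ∀ p [Fact p.Prime], M < p → ∀ f : Polynomial (ZMod p), f.natDegree ≤ n →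
      HasSimpleRoot f → ∀ b : ZMod p, b ≠ 0 → ∃ t w : ZMod p, w ≠ 0 ∧ f.eval t = b * w ^ n)
    {h : ℤ} (hh : h ≠ 0) (hhM : |h| ≤ M) {S : Finset ℕ} (hS : ∀ p ∈ S, p.Prime ∧ M < p)
    {c : Fin (n + 1) → ℤ} (hc : LocalConditions S M c) {D : Finset ℕ} (hD : D ⊆ S)
    (p : ℕ) [hp : Fact p.Prime] :
    (HasSimpleRoot (formPolyX (ZMod p) (twist (∏ q ∈ D, (q : ℤ)) (∏ q ∈ S \ D, (q : ℤ)) c)) ∨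
      HasSimpleRoot (formPolyY (ZMod p) (twist (∏ q ∈ D, (q : ℤ)) (∏ q ∈ S \ D, (q : ℤ)) c))) ∧
    ∃ x y : ℤ_[p], binEval
      (fun i => (twist (∏ q ∈ D, (q : ℤ)) (∏ q ∈ S \ D, (q : ℤ)) c i : ℤ_[p])) x y = h := by
  have hde : (∏ q ∈ D, (q : ℤ)) * ∏ q ∈ S \ D, (q : ℤ) = ∏ q ∈ S, (q : ℤ) := by
    rw [mul_comm, Finset.prod_sdiff hD]
  have hSp : ∀ q ∈ S, q.Prime := fun q hq => (hS q hq).1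
  have hndvd : ∀ T ⊆ S, p ∉ T → ¬ (p : ℤ) ∣ ∏ q ∈ T, (q : ℤ) := fun T hT =>
    Int.not_dvd_prod_primes hp.out fun q hq => hSp q (hT hq)
  have hne : ∀ T ⊆ S, ∏ q ∈ T, (q : ℤ) ≠ 0 := fun T hT =>
    Finset.prod_ne_zero_iff.2 fun q hq => by exact_mod_cast (hSp q (hT hq)).ne_zero
  have hd0 := hne D hD
  have he0 := hne (S \ D) sdiff_subset
  have h0 := hc.first
  have hl := hc.last
  rw [← hde] at h0 hl
  have hp' : Prime (p : ℤ) := Nat.prime_iff_prime_int.1 hp.out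
  by_cases hpS : p ∈ S
  · by_cases hpD : p ∈ D
    · obtain ⟨h1, x, y, hxy⟩ := hasSimpleRoot_and_padic_twist_of_dvd (p := p) hn
        (d := ∏ q ∈ S \ D, (q : ℤ)) (e := ∏ q ∈ D, (q : ℤ)) (c := fun i => c (Fin.rev i))
        (hndvd _ sdiff_subset fun h => (mem_sdiff.1 h).2 hpD) hd0
        (hc.penultimate p hpS _ (by rw [Fin.val_rev]; simp only; omega))
        (fun i hi => (dvd_prod_of_mem _ hpD).trans (dvd_twist he0 hd0
          (by rwa [Fin.rev_last, mul_comm]) hi)) h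
      rw [twist_rev] at h1 hxy
      rw [formPolyY_rev] at h1
      rw [binEval_rev fun i => (twist (∏ q ∈ D, (q : ℤ)) (∏ q ∈ S \ D, (q : ℤ)) c i : ℤ_[p])] at hxy
      exact ⟨Or.inl h1, y, x, hxy⟩
    · have h1 := hasSimpleRoot_and_padic_twist_of_dvd (p := p) hn
        (d := ∏ q ∈ D, (q : ℤ)) (e := ∏ q ∈ S \ D, (q : ℤ)) (c := c) (hndvd _ hD hpD) he0
        (hc.second p hp.out (Or.inr hpS) _ rfl)
        (fun i hi => (dvd_prod_of_mem _ (mem_sdiff.2 ⟨hpS, hpD⟩)).trans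
          (dvd_twist hd0 he0 hl hi)) h
      exact ⟨Or.inr h1.1, h1.2⟩
  have hpd := hndvd D hD fun h => hpS (hD h)
  have hpe := hndvd (S \ D) sdiff_subset fun h => hpS (mem_sdiff.1 h).1
  rcases le_or_gt p M with hpM | hpM
  · have h1 := hasSimpleRoot_and_padic_twist_of_dvd (p := p) hn
      (d := ∏ q ∈ D, (q : ℤ)) (e := ∏ q ∈ S \ D, (q : ℤ)) (c := c) hpd he0
      (hc.second p hp.out (Or.inl hpM) _ rfl) (fun i hi => by
        have h2 := mul_twist h0 hl i
        have h3 : (p : ℤ) ∣ c i := hc.small p hp.out hpM i (by omega)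
        have h4 := (h3.mul_right (_ * _)).trans (dvd_of_eq ((mul_assoc _ _ _).symm.trans h2.symm))
        refine (hp'.dvd_or_dvd h4).resolve_left ?_
        rw [hp'.dvd_mul, not_or]
        exact ⟨hpd, hpe⟩) h
    exact ⟨Or.inr h1.1, h1.2⟩
  · have hpn : ¬ p ∣ n := fun h => by
      have := Nat.le_of_dvd (by omega) h
      omega
    have hph : ¬ (p : ℤ) ∣ h := fun hd => by
      have := Int.le_of_dvd (abs_pos.2 hh) ((dvd_abs _ _).2 hd)
      omega
    have hb : ¬ (p : ℤ) ∣ (∏ q ∈ D, (q : ℤ)) * (∏ q ∈ S \ D, (q : ℤ)) * h := by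
      rw [hp'.dvd_mul, hp'.dvd_mul, not_or, not_or]
      exact ⟨⟨hpd, hpe⟩, hph⟩
    have hb' : (((∏ q ∈ D, (q : ℤ)) * (∏ q ∈ S \ D, (q : ℤ)) * h : ℤ) : ZMod p) ≠ 0 := fun h =>
      hb ((ZMod.intCast_zmod_eq_zero_iff_dvd _ _).1 h)
    rcases hc.large p hpM hpS with h1 | h1
    · refine ⟨Or.inl (h1.twist_X h0 hl hpd hpe), ?_⟩
      obtain ⟨t, w, hw, htw⟩ := hpow p hpM _ (natDegree_formPolyX_le _) h1 _ hb'
      obtain ⟨x, y, hxy⟩ := exists_binEval_padic_eq_of_eval hpn hb hw htw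
      exact exists_binEval_twist_padic_eq h0 hl hpd hpe hxy
    · refine ⟨Or.inr (h1.twist_Y h0 hl hpd hpe), ?_⟩
      obtain ⟨t, w, hw, htw⟩ := hpow p hpM _ (natDegree_formPolyX_le _) h1 _ hb'
      obtain ⟨x, y, hxy⟩ := exists_binEval_padic_eq_of_eval hpn hb hw htw
      rw [binEval_rev fun i => (c i : ℤ_[p])] at hxy
      exact exists_binEval_twist_padic_eq h0 hl hpd hpe hxy

theorem exists_pow_eq_of_odd_or_nonneg {a : ℝ} (hn : n ≠ 0) (ha : Odd n ∨ 0 ≤ a) :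
    ∃ x : ℝ, x ^ n = a := by
  rcases le_total 0 a with h | h
  · exact ⟨a ^ (n : ℝ)⁻¹, Real.rpow_inv_natCast_pow h hn⟩
  · rcases ha with hodd | h'
    · refine ⟨-(-a) ^ (n : ℝ)⁻¹, ?_⟩
      rw [hodd.neg_pow, Real.rpow_inv_natCast_pow (by linarith) hn, neg_neg]
    · exact ⟨0, by rw [zero_pow hn]; linarith⟩

theorem exists_binEval_twist_real_eq (hn : n ≠ 0) {d e : ℤ} (hd : 0 < d) (he : 0 < e)
    {c : Fin (n + 1) → ℤ} (h0 : d * e ∣ c 0) (hl : d * e ∣ c (Fin.last n)) {h : ℤ}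
    (hc0 : c 0 ≠ 0) (hodd : Odd n ∨ 0 ≤ c 0 * h) :
    ∃ x y : ℝ, binEval (fun i => (twist d e c i : ℝ)) x y = h := by
  have hd' : (0 : ℝ) < d := by exact_mod_cast hd
  have he' : (0 : ℝ) < e := by exact_mod_cast he
  have hc0' : (c 0 : ℝ) ≠ 0 := by exact_mod_cast hc0
  obtain ⟨x, hx⟩ := exists_pow_eq_of_odd_or_nonneg (a := d * e * h / c 0) hn (hodd.imp_right
    fun h1 => by
      have h2 : (0 : ℝ) ≤ c 0 * h := by exact_mod_cast h1
      have h3 : (d : ℝ) * e * h / c 0 = d * e * (c 0 * h) / (c 0) ^ 2 := by field_simp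
      rw [h3]
      positivity)
  refine ⟨x / d, 0, ?_⟩
  have h1 := mul_binEval_twist h0 hl (x / d : ℝ) 0
  rw [mul_div_cancel₀ _ hd'.ne', mul_zero] at h1
  have h2 : binEval (fun i => (c i : ℝ)) x 0 = c 0 * x ^ n := by
    rw [binEval, Finset.sum_eq_single 0]
    · simp
    · intro i _ hi
      rw [zero_pow (fun h => hi (Fin.ext h)), mul_zero]
    · simp
  rw [h2, hx, mul_div_cancel₀ _ hc0'] at h1
  exact mul_left_cancel₀ (mul_ne_zero hd'.ne' he'.ne') h1

end LocalConditions

section Distinct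

variable {n : ℕ}

theorem not_sq_dvd_prod_primes_mul {S : Finset ℕ} (hS : ∀ p ∈ S, p.Prime) {p : ℕ} (hp : p ∈ S)
    {h : ℤ} (hph : ¬ (p : ℤ) ∣ h) : ¬ (p : ℤ) ^ 2 ∣ (∏ q ∈ S, (q : ℤ)) * h := by
  rw [← Finset.mul_prod_erase S _ hp, sq, mul_assoc]
  intro hd
  have hp0 : (p : ℤ) ≠ 0 := by exact_mod_cast (hS p hp).ne_zero
  rcases (Nat.prime_iff_prime_int.1 (hS p hp)).dvd_or_dvd ((mul_dvd_mul_iff_left hp0).1 hd) with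
    h1 | h1
  · exact Int.not_dvd_prod_primes (hS p hp) (fun q hq => hS q (mem_of_mem_erase hq))
      (notMem_erase p S) h1
  · exact hph h1

theorem sq_dvd_binEval {p : ℤ} (hn : 2 ≤ n) (c : Fin (n + 1) → ℤ) {x y : ℤ} (hx : p ∣ x)
    (hy : p ∣ y) : p ^ 2 ∣ binEval c x y := by
  obtain ⟨a, rfl⟩ := hx
  obtain ⟨b, rfl⟩ := hy
  rw [binEval_smul]
  exact (pow_dvd_pow p hn).mul_right _

theorem exists_subset_twist_ne (hn : 2 ≤ n) {S : Finset ℕ} (hS : ∀ p ∈ S, p.Prime) {h : ℤ}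
    (hh : ∀ p ∈ S, ¬ (p : ℤ) ∣ h) {c : Fin (n + 1) → ℤ} (h0 : ∏ p ∈ S, (p : ℤ) ∣ c 0)
    (hl : ∏ p ∈ S, (p : ℤ) ∣ c (Fin.last n)) {C : ℕ} (hC : C < 2 ^ #S)
    (hT : ∀ T : Finset (ℤ × ℤ), (∀ z ∈ T, binEval c z.1 z.2 = (∏ p ∈ S, (p : ℤ)) * h) → #T ≤ C) :
    ∃ D ⊆ S, ∀ x y : ℤ, binEval (twist (∏ p ∈ D, (p : ℤ)) (∏ p ∈ S \ D, (p : ℤ)) c) x y ≠ h := by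
  classical
  by_contra! hcon
  choose! x y hxy using hcon
  have hsol : ∀ D ⊆ S, binEval c ((∏ p ∈ D, (p : ℤ)) * x D) ((∏ p ∈ S \ D, (p : ℤ)) * y D) =
      (∏ p ∈ S, (p : ℤ)) * h := by
    intro D hD
    have hde : (∏ q ∈ D, (q : ℤ)) * ∏ q ∈ S \ D, (q : ℤ) = ∏ q ∈ S, (q : ℤ) := by
      rw [mul_comm, Finset.prod_sdiff hD]
    have := mul_binEval_twist (hde ▸ h0) (hde ▸ hl) (x D) (y D)
    simp only [Int.cast_id] at this
    rw [← this, hde, hxy D hD]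
  have hinj : ∀ D ⊆ S, ∀ D' ⊆ S, (∏ p ∈ D, (p : ℤ)) * x D = (∏ p ∈ D', (p : ℤ)) * x D' →
      (∏ p ∈ S \ D, (p : ℤ)) * y D = (∏ p ∈ S \ D', (p : ℤ)) * y D' → D ⊆ D' := by
    intro D hD D' hD' h1 h2 p hp
    by_contra hp'
    refine not_sq_dvd_prod_primes_mul hS (hD hp) (hh p (hD hp)) ?_
    rw [← hsol D hD]
    refine sq_dvd_binEval hn c ((dvd_prod_of_mem _ hp).mul_right _) ?_
    rw [h2]
    exact (dvd_prod_of_mem _ (mem_sdiff.2 ⟨hD hp, hp'⟩)).mul_right _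
  have hcard := hT (S.powerset.image fun D : Finset ℕ =>
    ((∏ p ∈ D, (p : ℤ)) * x D, (∏ p ∈ S \ D, (p : ℤ)) * y D)) (by
      intro z hz
      obtain ⟨D, hD, rfl⟩ := mem_image.1 hz
      exact hsol D (mem_powerset.1 hD))
  rw [card_image_of_injOn, card_powerset] at hcard
  · omega
  · intro D hD D' hD' heq
    rw [mem_coe, mem_powerset] at hD hD'
    simp only [Prod.mk.injEq] at heq
    exact (hinj D hD D' hD' heq.1 heq.2).antisymm (hinj D' hD' D hD heq.1.symm heq.2.symm)

/-- A set of forms `F`, each with a suitable `F(d x, e y) / (d e)` in `T`, is not much larger than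
`T`. -/
theorem card_le_of_twist_mem {S : Finset ℕ} (hS : ∀ p ∈ S, p.Prime)
    (A T : Finset (Fin (n + 1) → ℤ))
    (hA : ∀ c ∈ A, ∏ p ∈ S, (p : ℤ) ∣ c 0 ∧ ∏ p ∈ S, (p : ℤ) ∣ c (Fin.last n) ∧
      ∃ D ⊆ S, twist (∏ p ∈ D, (p : ℤ)) (∏ p ∈ S \ D, (p : ℤ)) c ∈ T) :
    #A ≤ 2 ^ #S * #T := by
  classical
  choose! h0 hl D hDS hDT using hA
  refine Finset.card_le_mul_card_image_of_maps_to
    (f := fun c => twist (∏ p ∈ D c, (p : ℤ)) (∏ p ∈ S \ D c, (p : ℤ)) c) hDT _ fun b _ => ?_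
  rw [← card_powerset]
  refine Finset.card_le_card_of_injOn D (fun c hc => ?_) fun c hc c' hc' heq => ?_
  · simp only [coe_filter, Set.mem_ofPred_eq] at hc
    exact mem_powerset.2 (hDS c hc.1)
  · simp only [coe_filter, Set.mem_ofPred_eq] at hc hc'
    have hne : ∀ T ⊆ S, ∏ q ∈ T, (q : ℤ) ≠ 0 := fun T hT =>
      Finset.prod_ne_zero_iff.2 fun q hq => by exact_mod_cast (hS q (hT hq)).ne_zero
    have hde : (∏ q ∈ D c, (q : ℤ)) * ∏ q ∈ S \ D c, (q : ℤ) = ∏ q ∈ S, (q : ℤ) := by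
      rw [mul_comm, Finset.prod_sdiff (hDS c hc.1)]
    refine twist_injective (hne _ (hDS c hc.1)) (hne (S \ D c) sdiff_subset) (hde ▸ h0 c hc.1)
      (hde ▸ hl c hc.1) (hde ▸ h0 c' hc'.1) (hde ▸ hl c' hc'.1) ?_
    rw [hc.2, ← hc'.2, heq]

end Distinct

section Construction

variable {n : ℕ}

theorem exists_maximal_locallyRep_twist (hn : 3 ≤ n) {M : ℕ} (hM : n ≤ M)
    (hpow : ∀ p [Fact p.Prime], M < p → ∀ f : Polynomial (ZMod p), f.natDegree ≤ n →
      HasSimpleRoot f → ∀ b : ZMod p, b ≠ 0 → ∃ t w : ZMod p, w ≠ 0 ∧ f.eval t = b * w ^ n)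
    {h : ℤ} (hh : h ≠ 0) (hhM : |h| ≤ M) {S : Finset ℕ} (hS : ∀ p ∈ S, p.Prime ∧ M < p)
    {c : Fin (n + 1) → ℤ} (hc : LocalConditions S M c) (hc0 : c 0 ≠ 0)
    (hodd : Odd n ∨ 0 ≤ c 0 * h) {C : ℕ} (hC : C < 2 ^ #S)
    (hT : ∀ T : Finset (ℤ × ℤ), (∀ z ∈ T, binEval c z.1 z.2 = (∏ p ∈ S, (p : ℤ)) * h) → #T ≤ C) :
    ∃ D ⊆ S, ∃ G, twist (∏ p ∈ D, (p : ℤ)) (∏ p ∈ S \ D, (p : ℤ)) c = G ∧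
      (∀ i, |G i| ≤ |c i| * (∏ p ∈ S, (p : ℤ)) ^ n) ∧ IsMaximalForm G ∧ LocallyRep G h ∧
      ¬ ∃ x y : ℤ, binEval G x y = h := by
  have hSp : ∀ p ∈ S, p.Prime := fun p hp => (hS p hp).1
  have hh' : ∀ p ∈ S, ¬ (p : ℤ) ∣ h := fun p hp hd => by
    have h1 := Int.le_of_dvd (abs_pos.2 hh) ((dvd_abs _ _).2 hd)
    have h2 := (hS p hp).2
    omega
  obtain ⟨D, hD, hDh⟩ := exists_subset_twist_ne (by omega) hSp hh' hc.first hc.last hC hT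
  have hde : (∏ q ∈ D, (q : ℤ)) * ∏ q ∈ S \ D, (q : ℤ) = ∏ q ∈ S, (q : ℤ) := by
    rw [mul_comm, Finset.prod_sdiff hD]
  have hpos : ∀ T ⊆ S, 0 < ∏ q ∈ T, (q : ℤ) := fun T hT =>
    Finset.prod_pos fun q hq => by exact_mod_cast (hSp q (hT hq)).pos
  have hd := hpos D hD
  have he := hpos (S \ D) sdiff_subset
  have h0 := hde ▸ hc.first
  have hl := hde ▸ hc.last
  refine ⟨D, hD, _, rfl, fun i => ?_, ?_, ⟨?_, fun p hp => ?_⟩, fun ⟨x, y, hxy⟩ => hDh x y hxy⟩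
  · have := abs_twist_le hd.ne' he.ne' h0 hl i
    rwa [hde, abs_of_pos (hpos S subset_rfl)] at this
  · exact isMaximalForm_of_hasSimpleRoot (by omega) fun p _ =>
      (hc.hasSimpleRoot_and_padic hn hM hpow hh hhM hS hD p).1
  · exact exists_binEval_twist_real_eq (by omega) hd he h0 hl hc0 hodd
  · have : Fact p.Prime := ⟨hp⟩
    exact (hc.hasSimpleRoot_and_padic hn hM hpow hh hhM hS hD p).2

/-- Residues modulo the primes in `S` and `T` of the coefficients of the forms we consider. -/
def residue (T : Finset ℕ) (i : Fin (n + 1)) : ℤ :=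
  if (i : ℕ) = 1 then 1 else if (i : ℕ) + 1 = n then ∏ p ∈ T, (p : ℤ) else 0

theorem residue_nonneg (T : Finset ℕ) (i : Fin (n + 1)) : 0 ≤ residue T i := by
  unfold residue
  split_ifs
  · exact zero_le_one
  · positivity
  · exact le_rfl

theorem residue_le {T P : Finset ℕ} (hP : ∀ p ∈ P, p.Prime) (hTP : T ⊆ P) (i : Fin (n + 1)) :
    residue T i ≤ ∏ p ∈ P, (p : ℤ) := by
  have hpos : 0 < ∏ p ∈ P, (p : ℤ) := Finset.prod_pos fun q hq => by exact_mod_cast (hP q hq).pos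
  unfold residue
  split_ifs
  · omega
  · exact Int.le_of_dvd hpos (Finset.prod_dvd_prod_of_subset _ _ _ hTP)
  · exact hpos.le

theorem localConditions_of_residue (hn : 3 ≤ n) {M : ℕ} {S T : Finset ℕ}
    (hS : ∀ p ∈ S, p.Prime ∧ M < p) (hT : ∀ p, p ∈ T ↔ p.Prime ∧ p ≤ M)
    {c : Fin (n + 1) → ℤ} (hc : ∀ i, ∏ p ∈ S ∪ T, (p : ℤ) ∣ c i - residue T i)
    (hlarge : ∀ (p : ℕ) [Fact p.Prime], M < p → p ∉ S →
      HasSimpleRoot (formPolyX (ZMod p) c) ∨ HasSimpleRoot (formPolyY (ZMod p) c)) :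
    LocalConditions S M c := by
  have hp : ∀ p ∈ S ∪ T, ∀ i, (p : ℤ) ∣ c i ↔ (p : ℤ) ∣ residue T i := fun p hp i =>
    (dvd_iff_dvd_of_dvd_sub ((dvd_prod_of_mem _ hp).trans (hc i)))
  have hone : ∀ p : ℕ, p.Prime → ¬ (p : ℤ) ∣ 1 := fun p hp =>
    (Nat.prime_iff_prime_int.1 hp).not_dvd_one
  have hSdvd : ∀ i, residue T i = 0 → ∏ p ∈ S, (p : ℤ) ∣ c i := fun i hi => by
    have h1 := hc i
    rw [hi, sub_zero] at h1
    exact (Finset.prod_dvd_prod_of_subset _ _ _ subset_union_left).trans h1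
  refine ⟨hSdvd 0 ?_, hSdvd (Fin.last n) ?_, ?_, ?_, ?_, hlarge⟩
  · rw [residue, if_neg (by simp), if_neg (by simp; omega)]
  · rw [residue, if_neg (by rw [Fin.val_last]; omega), if_neg (by rw [Fin.val_last]; omega)]
  · intro p hpp hpM i hi
    have hmem : p ∈ S ∪ T := by
      rw [mem_union, hT]
      tauto
    rw [hp p hmem, residue, if_pos hi]
    exact hone p hpp
  · intro p hpS i hi
    rw [hp p (mem_union_left _ hpS), residue, if_neg (by omega), if_pos hi]
    refine Int.not_dvd_prod_primes (hS p hpS).1 (fun q hq => ((hT q).1 hq).1) fun hpT => ?_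
    have := (hS p hpS).2
    have := ((hT p).1 hpT).2
    omega
  · intro p hpp hpM i hi
    have hmem : p ∈ T := (hT p).2 ⟨hpp, hpM⟩
    rw [hp p (mem_union_right _ hmem), residue, if_neg hi]
    split_ifs
    · exact dvd_prod_of_mem _ hmem
    · exact dvd_zero _

/-- The forms near `σ κ N W (xⁿ + yⁿ)` with prescribed residues modulo `W`. -/
def boxForm (T : Finset ℕ) (W s : ℤ) (t : Fin (n + 1) → ℕ) (i : Fin (n + 1)) : ℤ :=
  residue T i + W * (if i = 0 ∨ i = Fin.last n then s else 0) + W * t i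

theorem boxForm_injective (T : Finset ℕ) {W : ℤ} (hW : W ≠ 0) (s : ℤ) :
    Function.Injective (boxForm (n := n) T W s) := by
  intro t t' h
  ext i
  have h1 := congrFun h i
  simp only [boxForm, add_right_inj, mul_eq_mul_left_iff, hW, or_false] at h1
  exact_mod_cast h1

theorem abs_boxForm_sub_le {T : Finset ℕ} {W : ℤ} (hres : ∀ i : Fin (n + 1), residue T i ≤ W)
    (s : ℤ) {N : ℕ} {t : Fin (n + 1) → ℕ} (ht : ∀ i, t i < N) (i : Fin (n + 1)) :
    |boxForm T W s t i - W * (if i = 0 ∨ i = Fin.last n then s else 0)| ≤ W * N := by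
  have h1 := hres i
  have h2 := residue_nonneg T i
  have h3 : (0 : ℤ) ≤ t i := by positivity
  have h4 : (t i : ℤ) + 1 ≤ N := by exact_mod_cast ht i
  have h5 : 0 ≤ W := h2.trans h1
  rw [boxForm, add_right_comm, add_sub_cancel_right, abs_of_nonneg (by positivity)]
  nlinarith

theorem abs_boxForm_le {T : Finset ℕ} {W : ℤ} (hres : ∀ i : Fin (n + 1), residue T i ≤ W)
    {s K : ℤ} (hs : |s| ≤ K) {N : ℕ} {t : Fin (n + 1) → ℕ} (ht : ∀ i, t i < N)
    (i : Fin (n + 1)) : |boxForm T W s t i| ≤ W * (K + N) := by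
  have h1 := abs_boxForm_sub_le hres s ht i
  have h5 : 0 ≤ W := (residue_nonneg T i).trans (hres i)
  have h6 : |W * (if i = 0 ∨ i = Fin.last n then s else 0)| ≤ W * K := by
    rw [abs_mul, abs_of_nonneg h5]
    refine mul_le_mul_of_nonneg_left ?_ h5
    split_ifs
    · exact hs
    · rw [abs_zero]; exact (abs_nonneg s).trans hs
  have h7 := abs_add_le (boxForm T W s t i - W * (if i = 0 ∨ i = Fin.last n then s else 0))
    (W * (if i = 0 ∨ i = Fin.last n then s else 0))
  rw [sub_add_cancel] at h7
  linarith

theorem nearDiagonal_boxForm {T : Finset ℕ} {W : ℤ}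
    (hres : ∀ i : Fin (n + 1), residue T i ≤ W) {κ : ℕ} (hκ : 0 < κ) (σ : ℤ) {N : ℕ}
    {t : Fin (n + 1) → ℕ} (ht : ∀ i, t i < N) :
    NearDiagonal (boxForm T W (σ * (κ * N)) t) (W * (κ * N)) (1 / κ) σ := by
  have hκ' : (0 : ℝ) < κ := by exact_mod_cast hκ
  have hR : (1 / κ : ℝ) * (W * (κ * N)) = W * N := by field_simp
  have key : ∀ i, |(boxForm T W (σ * (κ * N)) t i : ℝ) -
      W * (if i = 0 ∨ i = Fin.last n then (σ : ℝ) * (κ * N) else 0)| ≤ W * N := fun i => by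
    have := abs_boxForm_sub_le hres (σ * (κ * N)) ht i
    have h1 := (Int.cast_le (R := ℝ)).2 this
    push_cast at h1
    exact h1
  refine ⟨?_, ?_, fun i h0 hl => ?_⟩ <;> rw [hR]
  · have := key 0
    rw [if_pos (Or.inl rfl)] at this
    rwa [mul_left_comm (σ : ℝ)]
  · have := key (Fin.last n)
    rw [if_pos (Or.inr rfl)] at this
    rwa [mul_left_comm (σ : ℝ)]
  · have := key i
    rw [if_neg (by tauto), mul_zero, sub_zero] at this
    exact this

end Construction

section Count

variable {n : ℕ}

theorem NearDiagonal.mul_pos {c : Fin (n + 1) → ℤ} {R ε : ℝ} {σ : ℤ} (hc : NearDiagonal c R ε σ)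
    (hR : 0 < R) (hε : ε < 1) (hσ : |σ| = 1) : 0 < c 0 * σ := by
  have h1 := abs_le.1 hc.first
  have h2 : ε * R < R := by nlinarith
  rcases eq_or_eq_neg_of_abs_eq hσ with rfl | rfl
  · have h3 : (0 : ℝ) < c 0 := by push_cast at h1; linarith
    rw [mul_one]
    exact_mod_cast h3
  · have h3 : (c 0 : ℝ) < 0 := by push_cast at h1; linarith
    have h4 : c 0 < 0 := by exact_mod_cast h3
    linarith

theorem exists_finset_primes_card_eq (M C : ℕ) :
    ∃ S : Finset ℕ, (∀ p ∈ S, p.Prime ∧ M < p) ∧ #S = C := by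
  have h : {p : ℕ | p.Prime ∧ M < p}.Infinite := by
    refine (Nat.infinite_setOfPred_prime.sdiff (Set.finite_Iic M)).mono fun p hp => ?_
    exact ⟨hp.1, not_le.1 hp.2⟩
  obtain ⟨S, hS, hcard⟩ := h.exists_subset_card_eq C
  exact ⟨S, fun p hp => hS hp, hcard⟩

open Classical in
theorem exists_card_localConditions (hn : 3 ≤ n) {M : ℕ} (hM : 20 ≤ M) (hnM : 2 * n ≤ M)
    {S T : Finset ℕ} (hS : ∀ p ∈ S, p.Prime ∧ M < p) (hT : ∀ p, p ∈ T ↔ p.Prime ∧ p ≤ M)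
    {K : ℕ} {N : ℕ} (hN : (n + 1) * M ≤ N)
    (hN' : (n + 1) ^ 4 * (2 * ((∏ p ∈ S ∪ T, (p : ℤ)) * (K + 1))) ^ n < (N : ℤ))
    {s : ℤ} (hs : |s| ≤ K * N) :
    ∃ G : Finset (Fin (n + 1) → ℤ), N ^ (n + 1) ≤ 2 * #G ∧ ∀ c ∈ G, LocalConditions S M c ∧
      ∃ t : Fin (n + 1) → ℕ, (∀ i, t i < N) ∧ boxForm T (∏ p ∈ S ∪ T, (p : ℤ)) s t = c := by
  set W := ∏ p ∈ S ∪ T, (p : ℤ) with hWdef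
  have hP : ∀ p ∈ S ∪ T, p.Prime := fun p hp => by
    rcases mem_union.1 hp with hp | hp
    · exact (hS p hp).1
    · exact ((hT p).1 hp).1
  have hW : 0 < W := Finset.prod_pos fun q hq => by exact_mod_cast (hP q hq).pos
  have hres : ∀ i : Fin (n + 1), residue T i ≤ W := residue_le hP subset_union_right
  have hN0 : 1 ≤ N := by nlinarith
  have hNZ : (1 : ℤ) ≤ N := by exact_mod_cast hN0
  set U : Finset (Fin (n + 1) → ℕ) := Fintype.piFinset fun _ => range N with hU
  have hmemU : ∀ t, t ∈ U ↔ ∀ i, t i < N := fun t => by simp [hU]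
  have hcardU : #U = N ^ (n + 1) := by simp [hU]
  set B := {t ∈ U | ∃ q : ℕ, ∃ _ : Fact q.Prime, M < q ∧ ¬ (q : ℤ) ∣ W ∧
    ¬ HasSimpleRoot (formPolyX (ZMod q) (boxForm T W s t)) ∧
    ¬ HasSimpleRoot (formPolyY (ZMod q) (boxForm T W s t))} with hB
  have hbad : #B * M ≤ 10 * N ^ (n + 1) := by
    refine card_not_hasSimpleRoot_mul_le hn (b := fun i => residue T i +
      W * (if i = 0 ∨ i = Fin.last n then s else 0)) (W := W) (Y := W * (K * N + N)) hnM hN ?_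
      (fun t ht i => abs_boxForm_le hres hs ht i) ?_ B fun t ht => ?_
    · nlinarith [mul_nonneg (Int.natCast_nonneg K) (Int.natCast_nonneg N)]
    · have h1 : (2 * (W * (K * N + N))) ^ n = (2 * (W * (K + 1))) ^ n * (N : ℤ) ^ n := by
        rw [← mul_pow]; ring
      rw [h1, ← mul_assoc, pow_succ' (N : ℤ)]
      exact mul_lt_mul_of_pos_right hN' (by positivity)
    · rw [hB, mem_filter, hmemU] at ht
      exact ht
  have hbad' : 2 * #B ≤ N ^ (n + 1) := by nlinarith
  refine ⟨(U \ B).image (boxForm T W s), ?_, fun c hc => ?_⟩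
  · rw [card_image_of_injective _ (boxForm_injective T hW.ne' s),
      card_sdiff_of_subset (filter_subset _ _), hcardU, ← hB]
    omega
  · obtain ⟨t, ht, rfl⟩ := mem_image.1 hc
    rw [mem_sdiff, hmemU] at ht
    refine ⟨localConditions_of_residue hn hS hT (fun i => ?_) fun p hp hMp hpS => ?_, t, ht.1, rfl⟩
    · rw [boxForm, add_assoc, add_sub_cancel_left, ← mul_add]
      exact dvd_mul_right _ _
    · by_contra! hcon
      refine ht.2 (mem_filter.2 ⟨(hmemU t).2 ht.1, p, hp, hMp, ?_, hcon⟩)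
      refine Int.not_dvd_prod_primes hp.out hP fun hmem => ?_
      rcases mem_union.1 hmem with h | h
      · exact hpS h
      · have := ((hT p).1 h).2
        omega

open Classical in
theorem exists_card_maximal_locallyRep (hn : 3 ≤ n) {h : ℤ} (hh : h ≠ 0) :
    ∃ A L N₀ : ℕ, 0 < A ∧ 0 < L ∧ ∀ N ≥ N₀, ∃ T : Finset (Fin (n + 1) → ℤ),
      (∀ c ∈ T, (∀ i, |c i| ≤ A * N) ∧ IsMaximalForm c ∧ LocallyRep c h ∧
        ¬ ∃ x y : ℤ, binEval c x y = h) ∧ N ^ (n + 1) ≤ L * #T := by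
  obtain ⟨p₀, hp₀⟩ := exists_eval_eq_mul_pow n (by omega)
  set M := h.natAbs + p₀ + 2 * n + 20 with hM
  set C := 1200 * n + 39 * n ^ 2 + 1 with hC
  obtain ⟨S, hS, hScard⟩ := exists_finset_primes_card_eq M C
  set T₀ := (range (M + 1)).filter Nat.Prime with hT₀
  have hT : ∀ p, p ∈ T₀ ↔ p.Prime ∧ p ≤ M := fun p => by
    rw [hT₀, mem_filter, mem_range, Nat.lt_succ_iff, and_comm]
  have hSp : ∀ p ∈ S, p.Prime := fun p hp => (hS p hp).1
  have hP : ∀ p ∈ S ∪ T₀, p.Prime := fun p hp => by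
    rcases mem_union.1 hp with hp | hp
    · exact hSp p hp
    · exact ((hT p).1 hp).1
  set W := ∏ p ∈ S ∪ T₀, (p : ℤ) with hWdef
  set m := ∏ p ∈ S, (p : ℤ) with hm
  have hW : 0 < W := Finset.prod_pos fun q hq => by exact_mod_cast (hP q hq).pos
  have hm0 : 0 < m := Finset.prod_pos fun q hq => by exact_mod_cast (hSp q hq).pos
  have hres : ∀ i : Fin (n + 1), residue T₀ i ≤ W := residue_le hP subset_union_right
  set κ := 8 * (n ^ 2 * 2 ^ n) with hκ
  have hκ1 : 1 < κ := by
    have : 0 < n ^ 2 * 2 ^ n := by positivity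
    omega
  have hκR : (1 : ℝ) < κ := by exact_mod_cast hκ1
  have hε' : (1 / κ : ℝ) * (n ^ 2 * 2 ^ n) ≤ 1 / 8 := by
    have h2 : (κ : ℝ) = 8 * (n ^ 2 * 2 ^ n) := by rw [hκ]; push_cast; rfl
    have h3 : (0 : ℝ) < n ^ 2 * 2 ^ n := by positivity
    rw [h2]
    field_simp
    exact le_rfl
  obtain ⟨R₀, hR₀⟩ := NearDiagonal.exists_card_le hn (ε := 1 / κ) (by positivity) hε'
    (mul_ne_zero hm0.ne' hh)
  obtain ⟨σ, hσ, hσodd, hσh⟩ : ∃ σ : ℤ, |σ| = 1 ∧ (Odd n → σ = 1) ∧ (Odd n ∨ 0 < σ * h) := by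
    by_cases hodd : Odd n
    · exact ⟨1, abs_one, fun _ => rfl, Or.inl hodd⟩
    · refine ⟨h.sign, ?_, fun h => (hodd h).elim, Or.inr ?_⟩
      · rw [Int.abs_eq_natAbs, Int.natAbs_sign_of_ne_zero hh]; rfl
      · rw [Int.sign_mul_self_eq_abs]; exact abs_pos.2 hh
  obtain ⟨N₁, hN₁⟩ := exists_nat_gt ((n + 1) ^ 4 * (2 * (W * (κ + 1))) ^ n : ℤ)
  obtain ⟨N₂, hN₂⟩ := exists_nat_ge R₀
  refine ⟨(W * (κ + 1) * m ^ n).toNat, 2 * 2 ^ #S, (n + 1) * M + N₁ + N₂, ?_, by positivity,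
    fun N hN => ?_⟩
  · rw [Int.lt_toNat]
    positivity
  have hA : (((W * (κ + 1) * m ^ n).toNat : ℕ) : ℤ) = W * (κ + 1) * m ^ n :=
    Int.toNat_of_nonneg (by positivity)
  rw [hA]
  have hN0 : 0 < N := by
    have : 0 < (n + 1) * M := Nat.mul_pos (by omega) (by omega)
    omega
  have hs : |σ * (κ * N)| ≤ κ * N := by
    rw [abs_mul, hσ, one_mul, abs_of_nonneg (by positivity)]
  obtain ⟨G, hGcard, hG⟩ := exists_card_localConditions hn (K := κ) (N := N) (by omega) (by omega)
    hS hT (by omega) (hN₁.trans_le (by exact_mod_cast (by omega : N₁ ≤ N))) hs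
  set T : Finset (Fin (n + 1) → ℤ) := {c ∈ Fintype.piFinset fun _ =>
    Icc (-(W * (κ + 1) * m ^ n * N)) (W * (κ + 1) * m ^ n * N) | IsMaximalForm c ∧
      LocallyRep c h ∧ ¬ ∃ x y : ℤ, binEval c x y = h} with hTdef
  have hmemT : ∀ c, c ∈ T ↔ (∀ i, |c i| ≤ W * (κ + 1) * m ^ n * N) ∧ IsMaximalForm c ∧
      LocallyRep c h ∧ ¬ ∃ x y : ℤ, binEval c x y = h := fun c => by
    simp only [hTdef, mem_filter, Fintype.mem_piFinset, mem_Icc, abs_le]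
  refine ⟨T, fun c hc => (hmemT c).1 hc, ?_⟩
  suffices hle : #G ≤ 2 ^ #S * #T by
    rw [mul_assoc]
    exact hGcard.trans (Nat.mul_le_mul_left 2 hle)
  refine card_le_of_twist_mem hSp G T fun c hc => ?_
  obtain ⟨hloc, t, ht, rfl⟩ := hG c hc
  refine ⟨hloc.first, hloc.last, ?_⟩
  have hnear := nearDiagonal_boxForm hres (by omega : 0 < κ) σ ht
  have hW1 : (1 : ℝ) ≤ W := by exact_mod_cast hW
  have hNR : (1 : ℝ) ≤ N := by exact_mod_cast hN0
  have hRN : (N : ℝ) ≤ W * (κ * N) := by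
    calc (N : ℝ) = 1 * (1 * N) := by ring
      _ ≤ _ := by gcongr
  have hpos := hnear.mul_pos (by linarith) (by rw [div_lt_one (by linarith)]; exact hκR) hσ
  have hNR₀ : R₀ ≤ W * (κ * N) := by
    refine hN₂.trans (le_trans ?_ hRN)
    exact_mod_cast (by omega : N₂ ≤ N)
  obtain ⟨D, hD, F, hF, hbd, hmax⟩ := exists_maximal_locallyRep_twist hn (by omega : n ≤ M)
    (fun p _ hp => hp₀ p (by omega)) hh (by rw [Int.abs_eq_natAbs]; omega) hS hloc
    (fun h0 => by rw [h0, zero_mul] at hpos; exact hpos.false)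
    (hσh.imp_right fun hσh => by
      have h1 := mul_pos hpos hσh
      have h2 : σ * σ = 1 := by rw [← abs_mul_abs_self, hσ, one_mul]
      have h3 : boxForm T₀ W (σ * (κ * N)) t 0 * σ * (σ * h) =
        boxForm T₀ W (σ * (κ * N)) t 0 * h * (σ * σ) := by ring
      rw [h3, h2, mul_one] at h1
      exact h1.le)
    (by rw [hScard]; exact Nat.lt_two_pow_self)
    (hR₀ _ hNR₀ _ _ (by exact_mod_cast hσ) (fun ho => by exact_mod_cast hσodd ho) hnear)
  refine ⟨D, hD, (hF ▸ (hmemT F).2 ⟨fun i => (hbd i).trans ?_, hmax⟩)⟩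
  calc |boxForm T₀ W (σ * (κ * N)) t i| * m ^ n ≤ W * (κ * N + N) * m ^ n := by
        gcongr
        exact abs_boxForm_le hres hs ht i
    _ = W * (κ + 1) * m ^ n * N := by ring

end Count

theorem finite_setOf_forall_abs_lt (n : ℕ) (X : ℝ) :
    {c : Fin (n + 1) → ℤ | ∀ i, (|c i| : ℝ) < X}.Finite := by
  refine Set.Finite.subset
    (Fintype.piFinset fun _ : Fin (n + 1) => Icc (-⌈X⌉) ⌈X⌉).finite_toSet fun c hc => ?_
  rw [mem_coe, Fintype.mem_piFinset]
  intro i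
  have h1 := abs_lt.1 (hc i)
  have h2 := Int.le_ceil X
  rw [mem_Icc]
  constructor
  · have : (-⌈X⌉ : ℝ) ≤ c i := by linarith
    exact_mod_cast this
  · have : (c i : ℝ) ≤ ⌈X⌉ := by linarith
    exact_mod_cast this

theorem card_forall_abs_lt_le (n : ℕ) {X : ℝ} (hX : 1 ≤ X) :
    (Nat.card {c : Fin (n + 1) → ℤ // ∀ i, (|c i| : ℝ) < X} : ℝ) ≤ (3 * X) ^ (n + 1) := by
  have hsub : {c : Fin (n + 1) → ℤ | ∀ i, (|c i| : ℝ) < X} ⊆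
      (Fintype.piFinset fun _ : Fin (n + 1) => Icc (-(⌊X⌋₊ : ℤ)) ⌊X⌋₊ :
        Finset (Fin (n + 1) → ℤ)) := fun c hc => by
    rw [mem_coe, Fintype.mem_piFinset]
    intro i
    have h1 : (|c i| : ℝ) < X := hc i
    have h2 : ((c i).natAbs : ℝ) ≤ X := by
      rw [Nat.cast_natAbs, Int.cast_abs]
      exact h1.le
    have h3 := Nat.le_floor h2
    rw [mem_Icc]
    omega
  have h1 := Nat.card_mono (Finset.finite_toSet _) hsub
  rw [Nat.card_coe_set_eq (SetLike.coe _), Set.ncard_coe_finset, Fintype.card_piFinset_const,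
    Int.card_Icc] at h1
  have h2 : (((⌊X⌋₊ : ℤ) + 1 - -(⌊X⌋₊ : ℤ)).toNat : ℝ) ≤ 3 * X := by
    have h3 : ((⌊X⌋₊ : ℤ) + 1 - -(⌊X⌋₊ : ℤ)).toNat = 2 * ⌊X⌋₊ + 1 := by omega
    have h4 := Nat.floor_le (by linarith : 0 ≤ X)
    rw [h3]
    push_cast
    linarith
  calc _ ≤ ((((⌊X⌋₊ : ℤ) + 1 - -(⌊X⌋₊ : ℤ)).toNat ^ (n + 1) : ℕ) : ℝ) := by exact_mod_cast h1
    _ ≤ _ := by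
      push_cast
      gcongr

/-- A property with at least a constant multiple of `N ^ (n + 1)` instances in the box of size `N`
holds for a positive proportion of the integral binary forms ordered by height. -/
theorem liminf_card_div_card_pos {n : ℕ} {P : (Fin (n + 1) → ℤ) → Prop} {A L N₀ : ℕ}
    (hA : 0 < A) (hL : 0 < L)
    (hP : ∀ N ≥ N₀, ∃ T : Finset (Fin (n + 1) → ℤ), (∀ c ∈ T, (∀ i, |c i| ≤ A * N) ∧ P c) ∧
      N ^ (n + 1) ≤ L * #T) :
    0 < Filter.liminf (fun X : ℝ =>
      (Nat.card {c : Fin (n + 1) → ℤ // (∀ i, (|c i| : ℝ) < X) ∧ P c} : ℝ) /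
      (Nat.card {c : Fin (n + 1) → ℤ // ∀ i, (|c i| : ℝ) < X} : ℝ)) Filter.atTop := by
  have hA' : (1 : ℝ) ≤ A := by exact_mod_cast hA
  have hL' : (0 : ℝ) < L := by exact_mod_cast hL
  have hsub : ∀ X : ℝ, {c : Fin (n + 1) → ℤ | (∀ i, (|c i| : ℝ) < X) ∧ P c} ⊆
      {c | ∀ i, (|c i| : ℝ) < X} := fun X c hc => hc.1
  set δ : ℝ := 1 / ((12 * A) ^ (n + 1) * L) with hδ
  refine lt_of_lt_of_le (by positivity : 0 < δ) (Filter.le_liminf_of_le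
    (Filter.isCoboundedUnder_ge_of_le Filter.atTop (x := (1 : ℝ)) fun X => ?_) ?_)
  · refine div_le_one_of_le₀ ?_ (Nat.cast_nonneg _)
    exact_mod_cast Nat.card_mono (finite_setOf_forall_abs_lt n X) (hsub X)
  filter_upwards [Filter.eventually_ge_atTop (4 * A * (N₀ + 1) : ℝ)] with X hX
  have hX4 : 4 * (A : ℝ) ≤ X := by nlinarith [(Nat.cast_nonneg N₀ : (0 : ℝ) ≤ N₀)]
  have hX1 : 1 ≤ X := by linarith
  set N := ⌊X / (2 * A)⌋₊ with hN
  have hNle : (N : ℝ) ≤ X / (2 * A) := Nat.floor_le (by positivity)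
  have hNlt : X / (2 * A) < N + 1 := Nat.lt_floor_add_one _
  have h2 : X / (2 * A) = 2 * (X / (4 * A)) := by field_simp; norm_num
  have hN₀ : (N₀ : ℝ) + 1 ≤ X / (4 * A) := by
    rw [le_div_iff₀ (by positivity)]
    linarith
  have hNge : X / (4 * A) ≤ N := by linarith [(Nat.cast_nonneg N₀ : (0 : ℝ) ≤ N₀)]
  have hNX : A * (N : ℝ) < X := by
    rw [le_div_iff₀ (by positivity)] at hNle
    nlinarith
  obtain ⟨T, hT, hcard⟩ := hP N (by
    have : (N₀ : ℝ) ≤ N := by linarith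
    exact_mod_cast this)
  have hfin := finite_setOf_forall_abs_lt n X
  have hTle : #T ≤ Nat.card {c : Fin (n + 1) → ℤ // (∀ i, (|c i| : ℝ) < X) ∧ P c} := by
    have h3 : (T : Set (Fin (n + 1) → ℤ)) ⊆ {c | (∀ i, (|c i| : ℝ) < X) ∧ P c} := fun c hc => by
      refine ⟨fun i => lt_of_le_of_lt ?_ hNX, (hT c hc).2⟩
      exact_mod_cast (hT c hc).1 i
    have h4 := Nat.card_mono (hfin.subset (hsub X)) h3
    rwa [Nat.card_coe_set_eq, Set.ncard_coe_finset] at h4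
  have htot : 0 < Nat.card {c : Fin (n + 1) → ℤ // ∀ i, (|c i| : ℝ) < X} := by
    refine Nat.card_pos_iff.2 ⟨⟨0, fun i => ?_⟩, hfin.to_subtype⟩
    rw [Pi.zero_apply, Int.cast_zero, abs_zero]
    linarith
  have htot' : (0 : ℝ) < Nat.card {c : Fin (n + 1) → ℤ // ∀ i, (|c i| : ℝ) < X} := by
    exact_mod_cast htot
  rw [le_div_iff₀ htot']
  have hT' : (#T : ℝ) ≤ Nat.card {c : Fin (n + 1) → ℤ // (∀ i, (|c i| : ℝ) < X) ∧ P c} := by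
    exact_mod_cast hTle
  have hcard' : (N : ℝ) ^ (n + 1) ≤ L * #T := by exact_mod_cast hcard
  refine le_trans ?_ hT'
  calc _ ≤ δ * (3 * X) ^ (n + 1) :=
        mul_le_mul_of_nonneg_left (card_forall_abs_lt_le n hX1) (by positivity)
    _ = (X / (4 * A)) ^ (n + 1) / L := by
        rw [hδ, div_pow, mul_pow 12, mul_pow 4, mul_pow 3,
          show (12 : ℝ) = 3 * 4 by norm_num, mul_pow 3]
        field_simp
    _ ≤ (N : ℝ) ^ (n + 1) / L := by gcongr
    _ ≤ #T := by rw [div_le_iff₀ hL']; linarith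

/-- for each degree `n ≥ 3`, a positive proportion of integral binary `n`-ic
forms, ordered by the maximum of the absolute values of their coefficients, are maximal,
locally represent `h` everywhere, but do not represent `h` over `ℤ`. -/
theorem thue_fail_hasse_positive_proportion_by_height
    (n : ℕ) (hn : 3 ≤ n) (h : ℤ) (hh : h ≠ 0) :
    0 < Filter.liminf (fun X : ℝ =>
      (Nat.card {c : Fin (n + 1) → ℤ // (∀ i, (|c i| : ℝ) < X) ∧ IsMaximalForm c ∧
          LocallyRep c h ∧ ¬ ∃ x y : ℤ, binEval c x y = h} : ℝ) /
      (Nat.card {c : Fin (n + 1) → ℤ // ∀ i, (|c i| : ℝ) < X} : ℝ)) Filter.atTop := by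
  obtain ⟨A, L, N₀, hA, hL, hP⟩ := exists_card_maximal_locallyRep hn hh
  exact liminf_card_div_card_pos hA hL hP
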